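/- Let (R, m) be an analytically unramified Cohen-Macaulay local ring of dimension d > 0 with infinite residue field, I an m-primary ideal, and J a minimal reduction of I. If the Sally module S̄ of the normal filtration is nonzero, then dim S̄ = d. -/

import Mathlib

set_option synthInstance.maxHeartbeats 1000000
set_option maxHeartbeats 2000000

open IsLocalRing Polynomial Finset

variable {R : Type*}

/-- `x` is integral over the ideal `I`: it satisfies an equation
`x^n + a₁ x^{n-1} + ⋯ + aₙ = 0` with `aᵢ ∈ Iⁱ`. -/
def IsIntegralOverIdeal [CommRing R] (I : Ideal R) (x : R) : Prop :=
  ∃ n : ℕ, 0 < n ∧ ∃ a : ℕ → R, (∀ i ∈ Finset.Icc 1 n, a i ∈ I ^ i) ∧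
    x ^ n + ∑ i ∈ Finset.Icc 1 n, a i * x ^ (n - i) = 0

/-- The integral closure of an ideal (the set of integral elements is an ideal,
so the span equals it). -/
def intCl [CommRing R] (I : Ideal R) : Ideal R :=
  Ideal.span {x | IsIntegralOverIdeal I x}

/-- Length of a module, as the Krull dimension of its lattice of submodules. -/
noncomputable def mlen (R M : Type*) [CommRing R] [AddCommGroup M] [Module R M] :
    WithBot ℕ∞ :=
  Order.krullDim (Submodule R M)

/-- The quotient module `N/(K ∩ N)` for ideals `N K`. -/
abbrev idealQuot [CommRing R] (N K : Ideal R) :=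
  N ⧸ (Submodule.comap N.subtype K)

/-- Depth of `M` with respect to the ideal `J`: sup of lengths of `M`-regular
sequences contained in `J`. -/
noncomputable def rdepth (A : Type*) [CommRing A] (J : Ideal A)
    (M : Type*) [AddCommGroup M] [Module A M] : ℕ∞ :=
  sSup {n : ℕ∞ | ∃ rs : List A, (rs.length : ℕ∞) = n ∧ (∀ x ∈ rs, x ∈ J) ∧
    RingTheory.Sequence.IsRegular M rs}

/-- A local ring is Cohen-Macaulay if its depth equals its Krull dimension. -/
def IsCMLocal (R : Type*) [CommRing R] [IsLocalRing R] : Prop :=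
  (rdepth R (maximalIdeal R) R : WithBot ℕ∞) = ringKrullDim R

/-- A local ring is analytically unramified if its `m`-adic completion is reduced. -/
def AnalyticallyUnramified (R : Type*) [CommRing R] [IsLocalRing R] : Prop :=
  IsReduced (AdicCompletion (maximalIdeal R) R)

/-- An ideal is `m`-primary. -/
def IsMPrimary [CommRing R] [IsLocalRing R] (I : Ideal R) : Prop :=
  I.radical = maximalIdeal R

/-- `J ⊆ I` is a minimal reduction: generated by `d = dim R` elements and
`I^{n+1} = J I^n` for `n ≫ 0`. -/
def IsMinimalReduction [CommRing R] (d : ℕ) (J I : Ideal R) : Prop :=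
  J ≤ I ∧ (∃ s : Fin d → R, J = Ideal.span (Set.range s)) ∧
    ∃ N : ℕ, ∀ n ≥ N, I ^ (n + 1) = J * I ^ n

/-- Normal Hilbert data: `L n = λ(R/ intCl(I^{n+1}))` and for `n ≫ 0` this agrees
with the polynomial whose normalized coefficients are the `e i`. -/
def NormalHilbertData [CommRing R] (d : ℕ) (I : Ideal R) (L : ℕ → ℕ) (e : ℕ → ℤ) : Prop :=
  (∀ n, mlen R (R ⧸ intCl (I ^ (n + 1))) = (L n : WithBot ℕ∞)) ∧
    ∃ N : ℕ, ∀ n ≥ N, (L n : ℤ) =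
      ∑ i ∈ Finset.range (d + 1), (-1 : ℤ) ^ i * e i * ((n + d - i).choose (d - i))

/-- `t` is the Cohen-Macaulay type of the local ring `R` of dimension `d`:
`t = λ((Q : m)/Q)` for every ideal `Q` generated by a maximal regular sequence in `m`. -/
def CMTypeData (R : Type*) [CommRing R] [IsLocalRing R] (d t : ℕ) : Prop :=
  ∀ s : List R, s.length = d → (∀ x ∈ s, x ∈ maximalIdeal R) →
    RingTheory.Sequence.IsRegular R s →
      mlen R (idealQuot ((Ideal.span {x | x ∈ s}).colon (maximalIdeal R))
        (Ideal.span {x | x ∈ s})) = (t : WithBot ℕ∞)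

/-- The quotient module `N/(K ∩ N)` for submodules `N K` of a module. -/
abbrev submoduleQuot {A M : Type*} [CommRing A] [AddCommGroup M] [Module A M]
    (N K : Submodule A M) :=
  N ⧸ (Submodule.comap N.subtype K)

section A1
open RingTheory.Sequence CategoryTheory Abelian Limits Pointwise IsSMulRegular in
lemma exch_reg {A : Type*} [CommRing A] [IsNoetherianRing A] (J : Ideal A) (hJ : J ≠ ⊤) (r : ℕ)
    (y : A) (hyJ : y ∈ J) (hy : IsSMulRegular A y) (rs : List A) (hlen : rs.length = r + 1)
    (hmem : ∀ x ∈ rs, x ∈ J) (hreg : IsRegular A rs) :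
    ∃ rs' : List A, rs'.length = r ∧ (∀ x ∈ rs', x ∈ J) ∧ IsRegular (QuotSMulTop y A) rs' := by
  have hlt : J • (⊤ : Submodule A A) < ⊤ := by
    simpa [lt_top_iff_ne_top] using hJ
  have hlt' : J • (⊤ : Submodule A (QuotSMulTop y A)) < ⊤ := by
    rw [lt_top_iff_ne_top]
    by_contra eq
    have e2 := congrArg (Submodule.comap (Submodule.mkQ _)) eq
    rw [Submodule.comap_smul_top_of_surjective J _ (Submodule.mkQ_surjective _)] at e2
    apply hJ
    rw [Submodule.comap_top, Submodule.ker_mkQ, eq_top_iff] at e2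
    rw [eq_top_iff]
    refine e2.trans (sup_le ?_ ?_)
    · simp
    · rintro _ ⟨z, -, rfl⟩
      exact J.mul_mem_right _ hyJ
  have T1 := ModuleCat.exists_isRegular_tfae J (r+1) (ModuleCat.of A A) hlt
  have T2 := ModuleCat.exists_isRegular_tfae J r (ModuleCat.of A (QuotSMulTop y A)) hlt'
  have h1 := (T1.out 3 1 rfl rfl).mp ⟨rs, hlen, hmem, hreg⟩
  refine (T2.out 1 3 rfl rfl).mp ?_
  intro i hi
  have zero1 := AddCommGrpCat.isZero_of_iff_subsingleton.mpr (h1 i (by omega))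
  have zero2 := AddCommGrpCat.isZero_of_iff_subsingleton.mpr (h1 (i + 1) (by omega))
  exact AddCommGrpCat.subsingleton_of_isZero <| ShortComplex.Exact.isZero_of_both_zeros
    ((Ext.covariant_sequence_exact₃' _ (IsSMulRegular.smulShortComplex_shortExact (M := ModuleCat.of A A) hy)) i (i + 1) rfl)
    (zero1.eq_zero_of_src _) (zero2.eq_zero_of_tgt _)

open RingTheory.Sequence in
lemma reg_radical {A : Type*} [CommRing A] [IsNoetherianRing A] (J m : Ideal A) (hJm : J.radical = m)
    (hJ : J ≠ ⊤) (r : ℕ)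
    (rs : List A) (hlen : rs.length = r)
    (hmem : ∀ x ∈ rs, x ∈ m) (hreg : IsRegular A rs) :
    ∃ rs' : List A, rs'.length = r ∧ (∀ x ∈ rs', x ∈ J) ∧ IsRegular A rs' := by
  have hm : m ≠ ⊤ := by
    rintro rfl; exact hJ (Ideal.radical_eq_top.mp hJm)
  have hlt : J • (⊤ : Submodule A A) < ⊤ := by
    simpa [lt_top_iff_ne_top] using hJ
  have hlt' : m • (⊤ : Submodule A A) < ⊤ := by
    simpa [lt_top_iff_ne_top] using hm
  have T1 := ModuleCat.exists_isRegular_tfae m r (ModuleCat.of A A) hlt'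
  have T2 := ModuleCat.exists_isRegular_tfae J r (ModuleCat.of A A) hlt
  obtain ⟨N, h1, h2, h3, h4⟩ := (T1.out 3 2 rfl rfl).mp ⟨rs, hlen, hmem, hreg⟩
  refine (T2.out 2 3 rfl rfl).mp ⟨N, h1, h2, ?_, h4⟩
  rw [h3, ← hJm, PrimeSpectrum.zeroLocus_radical]

lemma infinite_of_nontrivial_mod {A Q : Type*} [CommRing A] [IsLocalRing A] [Infinite (ResidueField A)]
    [AddCommGroup Q] [Module A Q] [Nontrivial Q] : Infinite Q := by
  obtain ⟨q, hq⟩ := exists_ne (0 : Q)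
  by_contra hfin
  rw [not_infinite_iff_finite] at hfin
  have : Function.Injective (fun c : ResidueField A => (Function.surjInv (residue_surjective (R := A)) c) • q) := by
    intro c c' h
    by_contra hne
    set a := Function.surjInv (residue_surjective (R := A)) c
    set b := Function.surjInv (residue_surjective (R := A)) c'
    have ha : residue A a = c := Function.surjInv_eq _ c
    have hb : residue A b = c' := Function.surjInv_eq _ c'
    have hu : IsUnit (a - b) := by
      rw [← residue_ne_zero_iff_isUnit, map_sub, ha, hb, sub_ne_zero]; exact hne
    have h0 : (a - b) • q = 0 := by
      rw [sub_smul, sub_eq_zero]; exact h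
    exact hq ((hu.smul_eq_zero).mp h0)
  exact not_finite_iff_infinite.mpr (Infinite.of_injective _ this) hfin

lemma exists_general {A : Type*} [CommRing A] [IsNoetherianRing A] [IsLocalRing A]
    [Infinite (ResidueField A)] (n : ℕ) (x : Fin n → A)
    (a : A) (ha : a ∈ Ideal.span (Set.range x)) (hreg : IsSMulRegular A a) (hn : 0 < n) :
    ∃ c : Fin n → A, (∃ i, IsUnit (c i)) ∧ IsSMulRegular A (∑ i, c i * x i) := by
  classical
  have hfin := associatedPrimes.finite A A
  let W (p : Ideal A) : Submodule A (Fin n → A) :=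
    Submodule.comap (Fintype.linearCombination A x) p
  let V : Submodule A (Fin n → A) := Submodule.pi Set.univ (fun _ => maximalIdeal A)
  let s : Finset (Submodule A (Fin n → A)) := insert V (hfin.toFinset.image W)
  have htop : ∀ p ∈ s, p ≠ ⊤ := by
    intro p hp
    rw [Finset.mem_insert, Finset.mem_image] at hp
    rcases hp with rfl | ⟨p, hp, rfl⟩
    · intro h
      have : (fun _ => (1 : A)) ∈ V := h ▸ Submodule.mem_top
      have := this ⟨0, hn⟩ trivial
      exact (Ideal.ne_top_iff_one _).mp (maximalIdeal.isMaximal A).ne_top this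
    · intro h
      rw [Set.Finite.mem_toFinset] at hp
      have hle : Ideal.span (Set.range x) ≤ p := by
        rw [Ideal.span_le]
        rintro _ ⟨i, rfl⟩
        have : Pi.single i (1 : A) ∈ W p := h ▸ Submodule.mem_top
        simpa [W, Fintype.linearCombination_apply, Pi.single_apply] using this
      have h2 : a ∈ ⋃ p ∈ associatedPrimes A A, (p : Set A) := by
        simp only [Set.mem_iUnion]
        exact ⟨p, hp, hle ha⟩
      rw [biUnion_associatedPrimes_eq_compl_regular] at h2
      exact h2 hreg
  have hne : ⋃ p ∈ s, ((id p : Submodule A (Fin n → A)) : Set (Fin n → A)) ≠ Set.univ := by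
    intro hcov
    obtain ⟨p, hp, hfi⟩ := Submodule.exists_finiteIndex_of_cover hcov
    have hfi : p.toAddSubgroup.FiniteIndex := hfi
    have : Finite ((Fin n → A) ⧸ p) := AddSubgroup.finite_quotient_of_finiteIndex
    have : Nontrivial ((Fin n → A) ⧸ p) := Submodule.Quotient.nontrivial_iff.mpr (htop p hp)
    have := infinite_of_nontrivial_mod (A := A) (Q := (Fin n → A) ⧸ p)
    exact not_finite ((Fin n → A) ⧸ p)
  rw [Set.ne_univ_iff_exists_notMem] at hne
  obtain ⟨c, hc⟩ := hne
  simp only [Set.mem_iUnion, not_exists, id] at hc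
  refine ⟨c, ?_, ?_⟩
  · have := hc V (Finset.mem_insert_self _ _)
    by_contra hcon
    push Not at hcon
    exact this fun i _ => (mem_maximalIdeal _).mpr (hcon i)
  · by_contra hcon
    have h2 : (∑ i, c i * x i) ∈ ⋃ p ∈ associatedPrimes A A, (p : Set A) := by
      rw [biUnion_associatedPrimes_eq_compl_regular]; exact hcon
    simp only [Set.mem_iUnion] at h2
    obtain ⟨p, hp, h3⟩ := h2
    refine hc (W p) (Finset.mem_insert_of_mem (Finset.mem_image_of_mem _ (hfin.mem_toFinset.mpr hp))) ?_
    simpa [W, Fintype.linearCombination_apply] using h3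
end A1

section A2
open MvPolynomial

lemma map_C_mem_of_coeff {A : Type*} [CommRing A] {σ : Type*} (a : Ideal A) (F : MvPolynomial σ A) :
    F ∈ a.map (MvPolynomial.C : A →+* MvPolynomial σ A) ↔ ∀ m, F.coeff m ∈ a := MvPolynomial.mem_map_C_iff

lemma eval_form_mem {A : Type*} [CommRing A] {σ : Type*} (y : σ → A) (J a : Ideal A)
    (hy : ∀ i, y i ∈ J) (n : ℕ) (F : MvPolynomial σ A) (hF : F.IsHomogeneous n)
    (hFa : F ∈ a.map (MvPolynomial.C : A →+* MvPolynomial σ A)) : MvPolynomial.eval y F ∈ J ^ n * a := by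
  rw [map_C_mem_of_coeff] at hFa
  rw [eval_eq]
  refine Ideal.sum_mem _ fun m hm => ?_
  rw [mul_comm (J ^ n)]
  refine Ideal.mul_mem_mul (hFa m) ?_
  have hdeg : ∑ i ∈ m.support, m i = n := by
    have := hF (mem_support_iff.mp hm)
    rw [← this, Finsupp.weight_apply]
    simp [Finsupp.sum]
  rw [← hdeg, ← Finset.prod_pow_eq_pow_sum]
  exact Ideal.prod_mem_prod fun i _ => Ideal.pow_mem_pow (hy i) _

lemma exists_form {A : Type*} [CommRing A] {σ : Type*} [Fintype σ] (y : σ → A) (a : Ideal A) (n : ℕ)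
    (z : A) (hz : z ∈ (Ideal.span (Set.range y)) ^ n * a) :
    ∃ F : MvPolynomial σ A, F.IsHomogeneous n ∧ F ∈ a.map (MvPolynomial.C : A →+* MvPolynomial σ A) ∧
      MvPolynomial.eval y F = z := by
  induction n generalizing z with
  | zero =>
    refine ⟨MvPolynomial.C z, isHomogeneous_C _ _, Ideal.mem_map_of_mem _ ?_, by simp⟩
    simpa using hz
  | succ n ih =>
    rw [pow_succ', mul_assoc] at hz
    refine Submodule.mul_induction_on hz ?_ ?_
    · intro j hj w hw
      obtain ⟨F, hF, hFa, rfl⟩ := ih w hw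
      obtain ⟨c, rfl⟩ := (Ideal.mem_span_range_iff_exists_fun).mp hj
      refine ⟨(∑ i, MvPolynomial.C (c i) * MvPolynomial.X i) * F, ?_, Ideal.mul_mem_left _ _ hFa, ?_⟩
      · rw [add_comm]
        refine IsHomogeneous.mul (IsHomogeneous.sum _ _ _ fun i _ => ?_) hF
        simpa using (isHomogeneous_C σ (c i)).mul (isHomogeneous_X A i)
      · simp
    · rintro _ _ ⟨F, hF, hFa, rfl⟩ ⟨G, hG, hGa, rfl⟩
      exact ⟨F + G, hF.add hG, Ideal.add_mem _ hFa hGa, by simp⟩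

lemma exists_form' {A : Type*} [CommRing A] {σ : Type*} [Fintype σ] (y : σ → A) (n : ℕ)
    (z : A) (hz : z ∈ (Ideal.span (Set.range y)) ^ n) :
    ∃ F : MvPolynomial σ A, F.IsHomogeneous n ∧ MvPolynomial.eval y F = z := by
  obtain ⟨F, h1, -, h2⟩ := exists_form y ⊤ n z (by simpa using hz)
  exact ⟨F, h1, h2⟩

lemma eval_form_mem' {A : Type*} [CommRing A] {σ : Type*} (y : σ → A) (n : ℕ)
    (F : MvPolynomial σ A) (hF : F.IsHomogeneous n) : MvPolynomial.eval y F ∈ (Ideal.span (Set.range y)) ^ n := by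
  have := eval_form_mem y _ ⊤ (fun i => Ideal.subset_span (Set.mem_range_self i)) n F hF
    (by rw [Ideal.map_top]; trivial)
  simpa using this

/-- quasi-regularity of a finite family. -/
def QReg {A : Type*} [CommRing A] {σ : Type*} (y : σ → A) : Prop :=
  ∀ (n : ℕ) (F : MvPolynomial σ A), F.IsHomogeneous n →
    MvPolynomial.eval y F ∈ (Ideal.span (Set.range y)) ^ (n + 1) →
      F ∈ (Ideal.span (Set.range y)).map (MvPolynomial.C : A →+* MvPolynomial σ A)

lemma form_split {A : Type*} [CommRing A] {r : ℕ} (n : ℕ) (F : MvPolynomial (Fin (r + 1)) A)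
    (hF : F.IsHomogeneous (n + 1)) :
    ∃ (F0 : MvPolynomial (Fin r) A) (F1 : MvPolynomial (Fin (r + 1)) A),
      F0.IsHomogeneous (n + 1) ∧ F1.IsHomogeneous n ∧ F = rename Fin.succ F0 + MvPolynomial.X 0 * F1 := by
  classical
  rw [F.as_sum]
  refine Finset.sum_induction _ (fun F => ∃ (F0 : MvPolynomial (Fin r) A) (F1 : MvPolynomial (Fin (r + 1)) A),
      F0.IsHomogeneous (n + 1) ∧ F1.IsHomogeneous n ∧ F = rename Fin.succ F0 + MvPolynomial.X 0 * F1) ?_ ?_ ?_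
  · rintro _ _ ⟨F0, F1, h0, h1, rfl⟩ ⟨G0, G1, k0, k1, rfl⟩
    exact ⟨F0 + G0, F1 + G1, h0.add k0, h1.add k1, by simp; ring⟩
  · exact ⟨0, 0, isHomogeneous_zero _ _ _, isHomogeneous_zero _ _ _, by simp⟩
  · intro m hm
    have hdeg : m.degree = n + 1 := by
      have := hF (mem_support_iff.mp hm)
      rw [Finsupp.weight_apply] at this
      rw [Finsupp.degree_apply]
      simpa [Finsupp.sum] using this
    by_cases h0 : m 0 = 0
    · refine ⟨MvPolynomial.monomial m.tail (coeff m F), 0, isHomogeneous_monomial _ ?_, isHomogeneous_zero _ _ _, ?_⟩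
      · rw [← hdeg]
        simp [Finsupp.degree_eq_sum, Fin.sum_univ_succ, h0, Finsupp.tail, Fin.tail]
      · rw [rename_monomial]
        simp only [mul_zero, add_zero]
        congr 2
        refine Finsupp.ext fun i => ?_
        refine Fin.cases ?_ (fun i => ?_) i
        · rw [Finsupp.mapDomain_of_notMem_range, h0]
          simp
        · rw [Finsupp.mapDomain_apply (Fin.succ_injective r)]; rfl
    · have hle : Finsupp.single 0 1 ≤ m := by
        rw [Finsupp.single_le_iff]; omega
      refine ⟨0, MvPolynomial.monomial (m - Finsupp.single 0 1) (coeff m F), isHomogeneous_zero _ _ _,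
        isHomogeneous_monomial _ ?_, ?_⟩
      · have h2 := congrArg Finsupp.degree (tsub_add_cancel_of_le hle)
        rw [map_add, hdeg] at h2
        simp at h2
        exact h2
      · rw [map_zero, zero_add, MvPolynomial.X, MvPolynomial.monomial_mul, one_mul, add_tsub_cancel_of_le hle]

lemma span_cons_pow {A : Type*} [CommRing A] (a : A) (K : Ideal A) (n : ℕ) :
    (Ideal.span {a} ⊔ K) ^ (n + 1) = K ^ (n + 1) ⊔ Ideal.span {a} * (Ideal.span {a} ⊔ K) ^ n := by
  apply le_antisymm
  · induction n with
    | zero => simp [sup_comm]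
    | succ n ih =>
      rw [pow_succ (Ideal.span {a} ⊔ K) (n + 1)]
      rw [Ideal.mul_sup]
      refine sup_le ?_ ?_
      · rw [mul_comm]; exact le_sup_right
      · refine (Ideal.mul_mono_left ih).trans ?_
        rw [Ideal.sup_mul, ← pow_succ]
        refine sup_le_sup_left ?_ _
        rw [mul_assoc]
        refine Ideal.mul_mono_right ?_
        rw [pow_succ (Ideal.span {a} ⊔ K) n]
        exact Ideal.mul_mono_right le_sup_right
  · refine sup_le (Ideal.pow_right_mono le_sup_right _) ?_
    rw [pow_succ']
    exact Ideal.mul_mono_left le_sup_left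

lemma range_span_succ {A : Type*} [CommRing A] {r : ℕ} (y : Fin (r + 1) → A) :
    Ideal.span (Set.range y) = Ideal.span {y 0} ⊔ Ideal.span (Set.range (y ∘ Fin.succ)) := by
  rw [← Ideal.span_union]
  congr 1
  ext z
  simp [Fin.exists_fin_succ, eq_comm]

lemma QReg_step {A : Type*} [CommRing A] [IsNoetherianRing A] {r : ℕ} (y : Fin (r + 1) → A)
    (h0 : IsSMulRegular A (y 0))
    (hq : QReg (fun i => Ideal.Quotient.mk (Ideal.span {y 0}) (y (Fin.succ i)))) : QReg y := by
  set a := y 0 with ha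
  set K := Ideal.span (Set.range (y ∘ Fin.succ)) with hK
  set J := Ideal.span (Set.range y) with hJ
  have hJK : J = Ideal.span {a} ⊔ K := range_span_succ y
  have haJ : a ∈ J := Ideal.subset_span ⟨0, rfl⟩
  have hKJ : K ≤ J := hJK ▸ le_sup_right
  -- translate hypothesis
  have hA : ∀ (n : ℕ) (G : MvPolynomial (Fin r) A), G.IsHomogeneous n →
      MvPolynomial.eval (y ∘ Fin.succ) G ∈ J ^ (n + 1) ⊔ Ideal.span {a} →
      G ∈ J.map (MvPolynomial.C : A →+* MvPolynomial (Fin r) A) := by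
    intro n G hG hmem
    let q := Ideal.Quotient.mk (Ideal.span {a})
    have hmapJ : J.map q = Ideal.span (Set.range fun i => q (y (Fin.succ i))) := by
      rw [hJK, Ideal.map_sup, Ideal.map_span, Set.image_singleton,
        Ideal.Quotient.eq_zero_iff_mem.mpr (Ideal.mem_span_singleton_self a), hK, Ideal.map_span,
        ← Set.range_comp]
      simp
      rfl
    have h2 := hq n (MvPolynomial.map q G) (hG.map _) (by
      rw [← hmapJ, ← Ideal.map_pow]
      have := Ideal.mem_map_of_mem q hmem
      rw [Ideal.map_sup, Ideal.map_span, Set.image_singleton,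
        Ideal.Quotient.eq_zero_iff_mem.mpr (Ideal.mem_span_singleton_self a)] at this
      simp only [Ideal.span_singleton_zero, sup_bot_eq] at this
      convert this using 1
      rw [MvPolynomial.eval_map]
      exact (MvPolynomial.eval₂_comp q (y ∘ Fin.succ) G).symm)
    rw [← hmapJ] at h2
    rw [map_C_mem_of_coeff] at h2 ⊢
    intro m
    have := h2 m
    rw [MvPolynomial.coeff_map] at this
    rw [Ideal.mem_quotient_iff_mem] at this
    · exact this
    · rw [Ideal.span_singleton_le_iff_mem]; exact haJ
  have hB : ∀ n z, a * z ∈ J ^ (n + 1) → z ∈ J ^ n := by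
    intro n z hz
    have hk : ∀ k, ∃ w, z - w ∈ J ^ n ∧ a * w ∈ J ^ (n + 1 + k) := by
      intro k
      induction k with
      | zero => exact ⟨z, by simp, hz⟩
      | succ k ih =>
        obtain ⟨w, hw1, hw2⟩ := ih
        have hw3 := hw2
        rw [show n + 1 + k = (n + k) + 1 by ring, hJK, span_cons_pow, ← hJK] at hw3
        obtain ⟨g0, hg0, g1, hg1, hsum⟩ := Submodule.mem_sup.mp hw3
        obtain ⟨g, hg, rfl⟩ := Ideal.mem_span_singleton_mul.mp hg1
        obtain ⟨G, hG, rfl⟩ := exists_form' (y ∘ Fin.succ) _ g0 hg0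
        have hG2 := hA _ G hG (by
          refine Ideal.mem_sup_right ?_
          rw [Ideal.mem_span_singleton]
          exact ⟨w - g, by rw [mul_sub, ← hsum]; ring⟩)
        have hG3 := eval_form_mem (y ∘ Fin.succ) J J
          (fun i => Ideal.subset_span ⟨Fin.succ i, rfl⟩) _ G hG hG2
        refine ⟨w - g, ?_, ?_⟩
        · have : z - (w - g) = (z - w) + g := by ring
          rw [this]
          exact Ideal.add_mem _ hw1 (Ideal.pow_le_pow_right (by omega) hg)
        · have : a * (w - g) = MvPolynomial.eval (y ∘ Fin.succ) G := by rw [mul_sub, ← hsum]; ring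
          rw [this]
          rw [← pow_succ] at hG3
          exact Ideal.pow_le_pow_right (by omega) hG3
    obtain ⟨c, hc⟩ := Ideal.exists_pow_inf_eq_pow_smul J (Ideal.span {a})
    obtain ⟨w, hw1, hw2⟩ := hk (c + n)
    have h3 : a * w ∈ J ^ n * Ideal.span {a} := by
      have : a * w ∈ J ^ (n + 1 + (c + n)) • (⊤ : Submodule A A) ⊓ Ideal.span {a} :=
        ⟨by simpa using hw2, Ideal.mul_mem_right _ _ (Ideal.mem_span_singleton_self a)⟩
      rw [hc _ (by omega)] at this
      have h4 := Submodule.smul_mono (Ideal.pow_le_pow_right (show n ≤ n + 1 + (c + n) - c by omega))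
        (inf_le_right) this
      simpa using h4
    rw [mul_comm (J ^ n)] at h3
    obtain ⟨g, hg, h5⟩ := Ideal.mem_span_singleton_mul.mp h3
    have : g = w := h0 (by simpa using h5)
    subst this
    simpa using Ideal.add_mem _ hw1 hg
  intro n
  induction n with
  | zero =>
    intro F hF hmem
    rw [MvPolynomial.totalDegree_eq_zero_iff_eq_C.mp ((totalDegree_zero_iff_isHomogeneous _).mpr hF)] at hmem ⊢
    rw [MvPolynomial.eval_C] at hmem
    exact Ideal.mem_map_of_mem _ (by simpa using hmem)
  | succ n ih =>
    intro F hF hmem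
    obtain ⟨F0, F1, hF0, hF1, rfl⟩ := form_split n F hF
    have he : MvPolynomial.eval y (rename Fin.succ F0 + MvPolynomial.X 0 * F1) = MvPolynomial.eval (y ∘ Fin.succ) F0 + a * MvPolynomial.eval y F1 := by
      simp [eval_rename]
      rfl
    rw [he] at hmem
    have h1 := hA _ F0 hF0 (by
      have : MvPolynomial.eval (y ∘ Fin.succ) F0 = (MvPolynomial.eval (y ∘ Fin.succ) F0 + a * MvPolynomial.eval y F1) - a * MvPolynomial.eval y F1 := by ring
      rw [this]
      exact Ideal.sub_mem _ (Ideal.mem_sup_left hmem)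
        (Ideal.mem_sup_right (Ideal.mul_mem_right _ _ (Ideal.mem_span_singleton_self a))))
    have h2 := eval_form_mem (y ∘ Fin.succ) J J
          (fun i => Ideal.subset_span ⟨Fin.succ i, rfl⟩) _ F0 hF0 h1
    rw [← pow_succ] at h2
    have h3 : a * MvPolynomial.eval y F1 ∈ J ^ (n + 1 + 1) := by
      simpa using Ideal.sub_mem _ hmem h2
    have h4 := ih F1 hF1 (hB _ _ h3)
    refine Ideal.add_mem _ ?_ (Ideal.mul_mem_left _ _ h4)
    have := Ideal.mem_map_of_mem (rename Fin.succ : MvPolynomial (Fin r) A →ₐ[A] MvPolynomial (Fin (r+1)) A).toRingHom h1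
    rw [Ideal.map_map] at this
    convert this using 1
    · congr 1
      ext; simp
    · rfl

open RingTheory.Sequence in
theorem exists_QReg.{u} (r : ℕ) : ∀ (A : Type u) [CommRing A] [IsNoetherianRing A] [IsLocalRing A]
    [Infinite (ResidueField A)] (x : Fin r → A) (_ : Ideal.span (Set.range x) ≠ ⊤)
    (rs : List A) (_ : rs.length = r) (_ : ∀ z ∈ rs, z ∈ Ideal.span (Set.range x))
    (_ : IsRegular A rs),
    ∃ y : Fin r → A, Ideal.span (Set.range y) = Ideal.span (Set.range x) ∧ QReg y := by
  induction r with
  | zero =>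
    intro A _ _ _ _ x hx rs h1 h2 h3
    refine ⟨x, rfl, ?_⟩
    intro n F hF hmem
    have : Ideal.span (Set.range x) = ⊥ := by simp [Set.range_eq_empty]
    rw [this] at hmem ⊢
    obtain ⟨c, rfl⟩ := MvPolynomial.C_surjective (R := A) (Fin 0) F
    rw [MvPolynomial.eval_C, ← Ideal.zero_eq_bot, zero_pow (by omega), Ideal.zero_eq_bot, Ideal.mem_bot] at hmem
    simp [hmem]
  | succ r ih =>
    intro A _ _ _ _ x hx rs h1 h2 h3
    set J := Ideal.span (Set.range x) with hJ
    obtain ⟨a, ha, hreg⟩ : ∃ a ∈ J, IsSMulRegular A a := by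
      match rs with
      | [] => simp at h1
      | a :: rs' =>
        exact ⟨a, h2 a (by simp), ((isRegular_cons_iff _ _ _).mp h3).1⟩
    obtain ⟨c, ⟨i, hi⟩, hc⟩ := exists_general (r + 1) x a ha hreg (by omega)
    set b := ∑ i, c i * x i with hb
    have hbJ : b ∈ J := Ideal.sum_mem _ fun j _ => Ideal.mul_mem_left _ _ (Ideal.subset_span ⟨j, rfl⟩)
    obtain ⟨rs', k1, k2, k3⟩ := exch_reg J hx r b hbJ hc rs h1 h2 h3
    let q := Ideal.Quotient.mk (Ideal.span {b})
    have hle : Ideal.span {b} ≤ J := by rwa [Ideal.span_singleton_le_iff_mem]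
    have hne : Ideal.span {b} ≠ ⊤ := fun h => hx (top_le_iff.mp (h ▸ hle))
    have hqb : q b = 0 := Ideal.Quotient.eq_zero_iff_mem.mpr (Ideal.mem_span_singleton_self b)
    have : Nontrivial (A ⧸ Ideal.span {b}) := Ideal.Quotient.nontrivial_iff.mpr hne
    have : IsLocalRing (A ⧸ Ideal.span {b}) :=
      IsLocalRing.of_surjective' q Ideal.Quotient.mk_surjective
    have hloc : IsLocalHom q := IsLocalHom.of_surjective q Ideal.Quotient.mk_surjective
    have : Infinite (ResidueField (A ⧸ Ideal.span {b})) :=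
      Infinite.of_injective (ResidueField.map q) (RingHom.injective _)
    have hmapJ : J.map q = Ideal.span (Set.range fun j => q (x (i.succAbove j))) := by
      apply le_antisymm
      · rw [hJ, Ideal.map_span, Ideal.span_le]
        rintro _ ⟨_, ⟨j, rfl⟩, rfl⟩
        have hj : ∀ j, q (x (i.succAbove j)) ∈ Ideal.span (Set.range fun j => q (x (i.succAbove j))) :=
          fun j => Ideal.subset_span ⟨j, rfl⟩
        rcases Fin.eq_self_or_eq_succAbove i j with rfl | ⟨j, rfl⟩
        · have : q (c j) * q (x j) = - ∑ l, q (c (j.succAbove l)) * q (x (j.succAbove l)) := by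
            have h11 : q (∑ i, c i * x i) = 0 := hqb
            rw [map_sum, Fin.sum_univ_succAbove _ j] at h11
            rw [eq_neg_iff_add_eq_zero]
            simpa using h11
          have h5 : q (c j) * q (x j) ∈ Ideal.span (Set.range fun l => q (x (j.succAbove l))) := by
            rw [this]
            exact neg_mem (Ideal.sum_mem _ fun l _ => Ideal.mul_mem_left _ _ (hj l))
          exact (Ideal.unit_mul_mem_iff_mem _ (hi.map q)).mp h5
        · exact hj j
      · rw [Ideal.span_le]
        rintro _ ⟨j, rfl⟩
        exact Ideal.mem_map_of_mem _ (Ideal.subset_span ⟨_, rfl⟩)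
    have hreg' : IsRegular (A ⧸ Ideal.span {b}) (rs'.map q) := by
      have e : QuotSMulTop b A ≃ₗ[A] (A ⧸ Ideal.span {b}) :=
        Submodule.quotEquivOfEq _ _ (by rw [← Submodule.ideal_span_singleton_smul]; simp)
      rw [e.isRegular_congr] at k3
      refine ⟨?_, ?_⟩
      · exact (isWeaklyRegular_map_algebraMap_iff (A ⧸ Ideal.span {b}) (A ⧸ Ideal.span {b}) rs').mpr k3.1
      · intro htop
        have h6 : Ideal.ofList (rs'.map q) ≤ J.map q := by
          rw [Ideal.ofList, Ideal.span_le]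
          intro z hz
          simp only [Set.mem_ofPred_eq, List.mem_map] at hz
          obtain ⟨w, hw, rfl⟩ := hz
          exact Ideal.mem_map_of_mem _ (k2 w hw)
        simp only [smul_eq_mul, Ideal.mul_top] at htop
        rw [← htop, top_le_iff, Ideal.eq_top_iff_one, ← map_one q, Ideal.mem_quotient_iff_mem hle] at h6
        exact hx ((Ideal.eq_top_iff_one _).mpr h6)
    obtain ⟨y, hy1, hy2⟩ := ih (A ⧸ Ideal.span {b}) (fun j => q (x (i.succAbove j)))
      (by
        rw [← hmapJ]
        intro h6
        rw [Ideal.eq_top_iff_one, ← map_one q, Ideal.mem_quotient_iff_mem hle] at h6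
        exact hx ((Ideal.eq_top_iff_one _).mpr h6)) (rs'.map q) (by simpa using k1)
      (by
        rw [← hmapJ]
        intro z hz
        obtain ⟨w, hw, rfl⟩ := List.mem_map.mp hz
        exact Ideal.mem_map_of_mem _ (k2 w hw)) hreg'
    choose y' hy' using fun j => Ideal.Quotient.mk_surjective (y j)
    have hqs : ∀ j, q ((Fin.cons b y' : Fin (r+1) → A) j.succ) = y j := fun j => by simp [q, hy']
    refine ⟨Fin.cons b y', ?_, ?_⟩
    · rw [range_span_succ]
      simp only [Fin.cons_zero]
      have h7 : (Fin.cons b y' : Fin (r+1) → A) ∘ Fin.succ = y' := by ext; simp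
      rw [h7]
      have h8 : (Ideal.span (Set.range y')).map q = J.map q := by
        rw [hmapJ, ← hy1, Ideal.map_span, ← Set.range_comp]
        congr 2
        ext j; exact hy' j
      have h9 := congrArg (Ideal.comap q) h8
      rw [Ideal.comap_map_of_surjective q Ideal.Quotient.mk_surjective,
        Ideal.comap_map_of_surjective q Ideal.Quotient.mk_surjective] at h9
      have h10 : Ideal.comap q ⊥ = Ideal.span {b} := by
        rw [← RingHom.ker_eq_comap_bot]; exact Ideal.mk_ker
      rw [h10] at h9
      rw [sup_comm, h9]
      exact sup_eq_left.mpr hle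
    · refine QReg_step _ hc ?_
      have : (fun i => Ideal.Quotient.mk (Ideal.span {(Fin.cons b y' : Fin (r+1) → A) 0}) ((Fin.cons b y' : Fin (r+1) → A) (Fin.succ i)))
        = y := funext hqs
      rw [this]
      exact hy2

open RingTheory.Sequence in
theorem exists_QReg_of_CM (R : Type*) [CommRing R] [IsLocalRing R] [IsNoetherianRing R]
    (d : ℕ) (hdim : ringKrullDim R = d)
    (hCM : IsCMLocal R) (hres : Infinite (ResidueField R))
    (J : Ideal R) (hJrad : J.radical = maximalIdeal R)
    (hgen : ∃ s : Fin d → R, J = Ideal.span (Set.range s)) :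
    ∃ y : Fin d → R, J = Ideal.span (Set.range y) ∧ QReg y := by
  obtain ⟨s, rfl⟩ := hgen
  have hne : Ideal.span (Set.range s) ≠ ⊤ := by
    intro h
    rw [h, Ideal.radical_top] at hJrad
    exact (maximalIdeal.isMaximal R).ne_top hJrad.symm
  have hdepth : rdepth R (maximalIdeal R) R = (d : ℕ∞) := by
    unfold IsCMLocal at hCM
    rw [hdim] at hCM
    exact_mod_cast hCM
  obtain ⟨rs, h1, h2, h3⟩ : ∃ rs : List R, rs.length = d ∧ (∀ x ∈ rs, x ∈ maximalIdeal R) ∧ IsRegular R rs := by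
    have hmem : rdepth R (maximalIdeal R) R ∈ {n : ℕ∞ | ∃ rs : List R, (rs.length : ℕ∞) = n ∧ (∀ x ∈ rs, x ∈ maximalIdeal R) ∧
      IsRegular R rs} := by
      have : Nonempty {n : ℕ∞ | ∃ rs : List R, (rs.length : ℕ∞) = n ∧ (∀ x ∈ rs, x ∈ maximalIdeal R) ∧
        IsRegular R rs} := ⟨⟨0, [], by simp, by simp, IsRegular.nil _ _⟩⟩
      refine ENat.sSup_mem_of_nonempty_of_lt_top ?_
      show rdepth R (maximalIdeal R) R < ⊤
      rw [hdepth]; exact ENat.natCast_lt_top d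
    obtain ⟨rs, h1, h2⟩ := hmem
    exact ⟨rs, by rw [hdepth] at h1; exact_mod_cast h1, h2⟩
  obtain ⟨rs', k1, k2, k3⟩ := reg_radical _ _ hJrad hne d rs h1 h2 h3
  obtain ⟨y, hy, hq⟩ := exists_QReg d R s hne rs' k1 k2 k3
  exact ⟨y, hy.symm, hq⟩
end A2

section A3
open MvPolynomial

lemma unitcoeff_mul_eq_zero_aux {B : Type*} [CommRing B] {d : ℕ} (m : Ideal B) 
    (hm : ∀ b, b ∈ m ∨ IsUnit b) (f h : MvPolynomial (Fin d) B)
    (hf : ∃ n, IsUnit (f.coeff n)) (hh : ∀ t ∈ m, MvPolynomial.C t * h = 0) (hfh : f * h = 0) : h = 0 := by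
  classical
  rcases subsingleton_or_nontrivial B with hB | hB
  · exact Subsingleton.elim _ _
  by_cases htop : (1 : B) ∈ m
  · simpa using hh 1 htop
  have hnu : ∀ b ∈ m, ¬ IsUnit b := fun b hb hu => htop (by
    obtain ⟨c, hc⟩ := hu.exists_left_inv
    rw [← hc]; exact m.mul_mem_left _ hb)
  set f1 : MvPolynomial (Fin d) B := ∑ n ∈ f.support.filter (fun n => IsUnit (f.coeff n)), MvPolynomial.monomial n (f.coeff n)
  set f2 : MvPolynomial (Fin d) B := ∑ n ∈ f.support.filter (fun n => ¬ IsUnit (f.coeff n)), MvPolynomial.monomial n (f.coeff n)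
  have hsum : f1 + f2 = f := by
    rw [Finset.sum_filter_add_sum_filter_not]; exact f.as_sum.symm
  have h2 : f2 * h = 0 := by
    rw [Finset.sum_mul]
    refine Finset.sum_eq_zero fun n hn => ?_
    have : f.coeff n ∈ m := (hm _).resolve_right (Finset.mem_filter.mp hn).2
    rw [← mul_one (f.coeff n), ← MvPolynomial.C_mul_monomial, mul_right_comm, hh _ this, zero_mul]
  have h1 : f1 * h = 0 := by
    rw [← hsum, add_mul, h2, add_zero] at hfh; exact hfh
  have hc1 : ∀ n, IsUnit (f.coeff n) → f1.coeff n = f.coeff n := by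
    intro n hn
    have : n ∈ f.support := mem_support_iff.mpr hn.ne_zero
    simp only [f1, MvPolynomial.coeff_sum, MvPolynomial.coeff_monomial]
    rw [Finset.sum_ite_eq']
    simp [hn, this]
  have hc2 : ∀ n, f1.coeff n = 0 ∨ IsUnit (f1.coeff n) := by
    intro n
    simp only [f1, MvPolynomial.coeff_sum, MvPolynomial.coeff_monomial]
    rw [Finset.sum_ite_eq']
    split_ifs with h
    · exact Or.inr (Finset.mem_filter.mp h).2
    · exact Or.inl rfl
  have hf1 : f1 ≠ 0 := by
    obtain ⟨n, hn⟩ := hf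
    intro h0
    have := hc1 n hn
    rw [h0, MvPolynomial.coeff_zero] at this
    exact hn.ne_zero this.symm
  have hlc : IsUnit (MonomialOrder.lex.leadingCoeff f1) := by
    rcases hc2 (MonomialOrder.lex.degree f1) with h | h
    · exact absurd (MonomialOrder.leadingCoeff_eq_zero_iff.mp h) hf1
    · exact h
  have hu := hlc.isRegular
  by_contra hne
  have := MonomialOrder.leadingCoeff_mul_of_isRegular_left (g := h) hu
  rw [h1, MonomialOrder.leadingCoeff_zero] at this
  rw [eq_comm, hlc.mul_right_eq_zero, MonomialOrder.leadingCoeff_eq_zero_iff] at this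
  exact hne this

lemma unitcoeff_mul_eq_zero {B : Type*} [CommRing B] {d : ℕ} (m : Ideal B) 
    (hm : ∀ b, b ∈ m ∨ IsUnit b) (c : ℕ) (hc : m ^ c = ⊥) (f h : MvPolynomial (Fin d) B)
    (hf : ∃ n, IsUnit (f.coeff n)) (hfh : f * h = 0) : h = 0 := by
  have key : ∀ k, (∀ t ∈ m ^ k, MvPolynomial.C t * h = 0) → h = 0 := by
    intro k
    induction k with
    | zero => intro H; simpa using H 1 (by simp)
    | succ k ih =>
      intro H
      refine ih fun s hs => ?_
      refine unitcoeff_mul_eq_zero_aux m hm f _ hf ?_ ?_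
      · intro t ht
        rw [← mul_assoc, ← MvPolynomial.C_mul]
        exact H _ (by rw [pow_succ']; exact Ideal.mul_mem_mul ht hs)
      · rw [mul_left_comm, hfh, mul_zero]
  refine key c fun t ht => ?_
  rw [hc, Ideal.mem_bot] at ht
  simp [ht]

lemma unitcoeff_mul_mem {A : Type*} [CommRing A] [IsLocalRing A] {d : ℕ} (a : Ideal A) (c : ℕ)
    (hc : maximalIdeal A ^ c ≤ a) (f p : MvPolynomial (Fin d) A)
    (hf : ∃ n, IsUnit (f.coeff n)) (hfp : f * p ∈ a.map (MvPolynomial.C : A →+* MvPolynomial (Fin d) A)) :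
    p ∈ a.map (MvPolynomial.C : A →+* MvPolynomial (Fin d) A) := by
  let q := Ideal.Quotient.mk a
  have hiff : ∀ g : MvPolynomial (Fin d) A, g ∈ a.map (MvPolynomial.C : A →+* MvPolynomial (Fin d) A) ↔
      MvPolynomial.map q g = 0 := by
    intro g
    rw [map_C_mem_of_coeff, MvPolynomial.ext_iff]
    simp [q, MvPolynomial.coeff_map, Ideal.Quotient.eq_zero_iff_mem]
  rw [hiff] at hfp ⊢
  rw [map_mul] at hfp
  refine unitcoeff_mul_eq_zero ((maximalIdeal A).map q) ?_ c ?_ _ _ ?_ hfp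
  · intro b
    obtain ⟨b, rfl⟩ := Ideal.Quotient.mk_surjective b
    by_cases hb : b ∈ maximalIdeal A
    · exact Or.inl (Ideal.mem_map_of_mem _ hb)
    · right
      rw [mem_maximalIdeal, mem_nonunits_iff, not_not] at hb
      exact hb.map _
  · rw [← Ideal.map_pow, Ideal.map_eq_bot_iff_le_ker, Ideal.mk_ker]; exact hc
  · obtain ⟨n, hn⟩ := hf
    exact ⟨n, by rw [MvPolynomial.coeff_map]; exact hn.map q⟩

/-- Standing set-up: a quasi-regular system of generators of an `m`-primary ideal. -/
structure QSetup {A : Type*} [CommRing A] [IsLocalRing A] {d : ℕ} (y : Fin d → A) : Prop where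
  qreg : QReg y
  prim : ∃ c, maximalIdeal A ^ c ≤ Ideal.span (Set.range y)
  le : Ideal.span (Set.range y) ≤ maximalIdeal A

lemma QSetup.lemT {A : Type*} [CommRing A] [IsLocalRing A] {d : ℕ} {y : Fin d → A} (hy : QSetup y)
    (a : Ideal A) (hJa : Ideal.span (Set.range y) ≤ a) (n i : ℕ) (z : A)
    (hz : z ∈ Ideal.span (Set.range y) ^ n) (f : MvPolynomial (Fin d) A) (hf : f.IsHomogeneous i)
    (hfu : ∃ n, IsUnit (f.coeff n))
    (hfz : MvPolynomial.eval y f * z ∈ Ideal.span (Set.range y) ^ (n + i) * a) :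
    z ∈ Ideal.span (Set.range y) ^ n * a := by
  obtain ⟨p, hp, rfl⟩ := exists_form' y n z hz
  obtain ⟨q, hq, hqa, hqe⟩ := exists_form y a _ _ hfz
  have h1 : (f * p - q).IsHomogeneous (n + i) := by
    rw [add_comm n i] at hq ⊢
    exact (hf.mul hp).sub hq
  have h2 := hy.qreg _ _ h1 (by simp [hqe])
  have h3 : f * p ∈ a.map (MvPolynomial.C : A →+* MvPolynomial (Fin d) A) := by
    have := Ideal.add_mem _ (Ideal.map_mono hJa h2) hqa
    simpa using this
  obtain ⟨c, hc⟩ := hy.prim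
  exact eval_form_mem y (Ideal.span (Set.range y)) a (fun i => Ideal.subset_span ⟨i, rfl⟩) n p hp
    (unitcoeff_mul_mem a c (hc.trans hJa) f p hfu h3)

lemma QSetup.colon {A : Type*} [CommRing A] [IsLocalRing A] {d : ℕ} {y : Fin d → A} (hy : QSetup y)
    (i : ℕ) (f : MvPolynomial (Fin d) A) (hf : f.IsHomogeneous i)
    (hfu : ∃ n, IsUnit (f.coeff n)) (a : ℕ) (x : A)
    (hfz : MvPolynomial.eval y f * x ∈ Ideal.span (Set.range y) ^ (i + a)) :
    x ∈ Ideal.span (Set.range y) ^ a := by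
  have key : ∀ b ≤ a, x ∈ Ideal.span (Set.range y) ^ b := by
    intro b
    induction b with
    | zero => simp
    | succ b ih =>
      intro hb
      rw [pow_succ]
      refine hy.lemT _ le_rfl b i x (ih (by omega)) f hf hfu ?_
      rw [← pow_succ]
      exact Ideal.pow_le_pow_right (by omega) hfz
  exact key a le_rfl
end A3

section A4

/-- asymptotic order of `x` w.r.t. `J` is at least `q`. -/
def AP {A : Type*} [CommRing A] (J : Ideal A) (x : A) (q : ℝ) : Prop :=
  ∀ ε : ℝ, 0 < ε → ∃ b a : ℕ, 1 ≤ b ∧ x ^ b ∈ J ^ a ∧ (q - ε) * b ≤ a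

variable {A : Type*} [CommRing A] {J : Ideal A} {x y : A} {q q' : ℝ}

lemma AP.mono (h : AP J x q) (hq : q' ≤ q) : AP J x q' := by
  intro ε hε
  obtain ⟨b, a, hb, hx, hba⟩ := h ε hε
  refine ⟨b, a, hb, hx, le_trans ?_ hba⟩
  gcongr

lemma AP.of_lt (h : ∀ q' < q, AP J x q') : AP J x q := by
  intro ε hε
  obtain ⟨b, a, hb, hx, hba⟩ := h (q - ε / 2) (by linarith) (ε / 2) (by linarith)
  refine ⟨b, a, hb, hx, le_trans (le_of_eq ?_) hba⟩
  ring

lemma AP.zero' : AP J (0 : A) q := by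
  intro ε hε
  obtain ⟨n, hn⟩ := exists_nat_ge (q - ε)
  exact ⟨1, n, le_rfl, by simp, by simpa using hn⟩

lemma AP.of_mem {b a : ℕ} (hb : 1 ≤ b) (hx : x ^ b ∈ J ^ a) (hq : q * b ≤ a) : AP J x q := by
  intro ε hε
  refine ⟨b, a, hb, hx, le_trans ?_ hq⟩
  gcongr
  linarith

lemma pow_mem_pow_mul {b a : ℕ} (hx : x ^ b ∈ J ^ a) (k : ℕ) : x ^ (b * k) ∈ J ^ (a * k) := by
  rw [pow_mul, pow_mul]
  exact Ideal.pow_mem_pow hx k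

lemma AP.mul (hx : AP J x q) (hy : AP J y q') : AP J (x * y) (q + q') := by
  intro ε hε
  obtain ⟨b, a, hb, hxa, hba⟩ := hx (ε/2) (by linarith)
  obtain ⟨b', a', hb', hya, hba'⟩ := hy (ε/2) (by linarith)
  refine ⟨b * b', a * b' + a' * b, Nat.mul_pos hb hb', ?_, ?_⟩
  · rw [mul_pow, pow_add]
    refine Ideal.mul_mem_mul (pow_mem_pow_mul hxa b') ?_
    rw [mul_comm b b']
    exact pow_mem_pow_mul hya b
  · push_cast
    have h1 := mul_le_mul_of_nonneg_right hba (Nat.cast_nonneg (α := ℝ) b')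
    have h2 := mul_le_mul_of_nonneg_right hba' (Nat.cast_nonneg (α := ℝ) b)
    nlinarith

lemma AP.mul_left (hx : AP J x q) (r : A) : AP J (r * x) q := by
  intro ε hε
  obtain ⟨b, a, hb, hxa, hba⟩ := hx ε hε
  exact ⟨b, a, hb, by rw [mul_pow]; exact Ideal.mul_mem_left _ _ hxa, hba⟩

lemma AP.pow (hx : AP J x q) {n : ℕ} (hn : 1 ≤ n) : AP J (x ^ n) (n * q) := by
  intro ε hε
  have hn' : (1:ℝ) ≤ n := by exact_mod_cast hn
  obtain ⟨b, a, hb, hxa, hba⟩ := hx (ε / n) (by positivity)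
  refine ⟨b, a * n, hb, ?_, ?_⟩
  · rw [← pow_mul, mul_comm n b]
    exact pow_mem_pow_mul hxa n
  · push_cast
    have h1 := mul_le_mul_of_nonneg_right hba (Nat.cast_nonneg (α := ℝ) n)
    refine le_trans (le_of_eq ?_) h1
    field_simp

lemma AP.of_pow {n : ℕ} (hn : 1 ≤ n) (hx : AP J (x ^ n) (n * q)) : AP J x q := by
  intro ε hε
  have hn' : (1:ℝ) ≤ n := by exact_mod_cast hn
  obtain ⟨b, a, hb, hxa, hba⟩ := hx (ε * n) (by positivity)
  refine ⟨n * b, a, Nat.mul_pos hn hb, by rw [pow_mul]; exact hxa, le_trans (le_of_eq ?_) hba⟩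
  push_cast
  ring

lemma AP.add (hx : AP J x q) (hy : AP J y q) : AP J (x + y) q := by
  intro ε hε
  obtain ⟨b1, a1, hb1, hxa, hba1⟩ := hx (ε/2) (by linarith)
  obtain ⟨b2, a2, hb2, hya, hba2⟩ := hy (ε/2) (by linarith)
  -- common exponent
  obtain ⟨b, a, hb, hx', hy', hba⟩ : ∃ b a : ℕ, 1 ≤ b ∧ x ^ b ∈ J ^ a ∧ y ^ b ∈ J ^ a ∧
      (q - ε/2) * b ≤ a := by
    refine ⟨b1 * b2, min (a1 * b2) (a2 * b1), Nat.mul_pos hb1 hb2, ?_, ?_, ?_⟩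
    · exact Ideal.pow_le_pow_right (min_le_left _ _) (pow_mem_pow_mul hxa b2)
    · rw [mul_comm b1]
      exact Ideal.pow_le_pow_right (min_le_right _ _) (pow_mem_pow_mul hya b1)
    · push_cast
      refine le_min ?_ ?_
      · have h1 := mul_le_mul_of_nonneg_right hba1 (Nat.cast_nonneg (α := ℝ) b2)
        nlinarith
      · have h1 := mul_le_mul_of_nonneg_right hba2 (Nat.cast_nonneg (α := ℝ) b1)
        nlinarith
  obtain ⟨M, hM⟩ := exists_nat_ge ((q - ε/2) / (ε/2))
  rw [div_le_iff₀ (by positivity)] at hM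
  refine ⟨(M + 1) * b, a * M, Nat.mul_pos (Nat.succ_pos _) hb, ?_, ?_⟩
  · rw [add_pow]
    refine Ideal.sum_mem _ fun i hi => Ideal.mul_mem_right _ _ ?_
    have hi' : i ≤ (M+1)*b := Nat.lt_succ_iff.mp (Finset.mem_range.mp hi)
    have key : ∀ (z : A) (j : ℕ), z ^ b ∈ J ^ a → z ^ j ∈ J ^ (a * (j / b)) := by
      intro z j hz
      have := pow_mem_pow_mul hz (j / b)
      rw [← Nat.div_add_mod j b, pow_add]
      refine Ideal.mul_mem_right _ _ ?_
      rwa [Nat.div_add_mod]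
    have h3 := Ideal.mul_mem_mul (key x i hx') (key y ((M+1)*b - i) hy')
    rw [← pow_add] at h3
    refine Ideal.pow_le_pow_right ?_ h3
    rw [← mul_add]
    refine Nat.mul_le_mul_left _ ?_
    have h5 := Nat.div_add_mod i b
    have h6 := Nat.div_add_mod ((M+1)*b - i) b
    have h7 := Nat.mod_lt i hb
    have h8 := Nat.mod_lt ((M+1)*b-i) hb
    set u := i / b
    set v := ((M+1)*b - i) / b
    by_contra hlt
    push Not at hlt
    have h9 : b * (u + v + 1) ≤ b * M := Nat.mul_le_mul_left _ hlt
    have : (M+1)*b = b * M + b := by ring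
    have h10 : b * (u + v + 1) = b * u + b * v + b := by ring
    omega
  · push_cast
    have h1 := mul_le_mul_of_nonneg_right hba (Nat.cast_nonneg (α := ℝ) M)
    refine le_trans ?_ h1
    have hb' : (0:ℝ) ≤ b := Nat.cast_nonneg _
    have h2 := mul_le_mul_of_nonneg_right hM hb'
    nlinarith

/-- the filtration ideals -/
def FI (J : Ideal A) (q : ℝ) : Ideal A where
  carrier := {x | AP J x q}
  add_mem' := AP.add
  zero_mem' := AP.zero'
  smul_mem' r _ hx := AP.mul_left hx r

lemma mem_FI : x ∈ FI J q ↔ AP J x q := Iff.rfl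

lemma FI_anti (h : q' ≤ q) : FI J q ≤ FI J q' := fun _ hx => AP.mono hx h

lemma pow_le_FI (n : ℕ) : J ^ n ≤ FI J n := fun z hz =>
  AP.of_mem (b := 1) le_rfl (by simpa using hz) (by simp)

lemma FI_nonpos (h : q ≤ 0) : FI J q = ⊤ := by
  rw [eq_top_iff]
  refine le_trans ?_ (FI_anti h)
  simpa using pow_le_FI (J := J) 0

lemma AP.one_nonpos (hJ : J ≠ ⊤) (h : AP J 1 q) : q ≤ 0 := by
  by_contra hq
  push Not at hq
  obtain ⟨b, a, hb, hxa, hba⟩ := h (q/2) (by linarith)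
  have ha : a = 0 := by
    by_contra ha
    rw [one_pow] at hxa
    exact hJ ((Ideal.eq_top_iff_one _).2 (Ideal.pow_le_self ha hxa))
  subst ha
  have : (1:ℝ) ≤ b := by exact_mod_cast hb
  push_cast at hba
  nlinarith

lemma mul_FI : FI J q * FI J q' ≤ FI J (q + q') :=
  Ideal.mul_le.2 fun _ hr _ hs => AP.mul hr hs

lemma AP.of_isNilpotent (h : IsNilpotent x) : AP J x q := by
  obtain ⟨n, hn⟩ := h
  obtain ⟨k, hk⟩ := exists_nat_ge (q * ((n+1 : ℕ) : ℝ))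
  exact AP.of_mem (b := n+1) (by omega) (by rw [pow_succ, hn, zero_mul]; exact zero_mem _) hk

/-- integral elements -/
lemma AP.of_integral {I : Ideal A} {N0 : ℕ} (hred : ∀ k, I ^ (k + N0) ≤ J ^ k) (n : ℕ)
    (h : IsIntegralOverIdeal (I ^ n) x) : AP J x n := by
  obtain ⟨m, hm, a, ha, heq⟩ := h
  have key : ∀ b, x ^ (b + m) ∈ I ^ (n * (b + 1)) := by
    intro b
    induction b using Nat.strong_induction_on with
    | _ b ih =>
    have hx : x ^ (b + m) = - ∑ i ∈ Finset.Icc 1 m, a i * x ^ (b + m - i) := by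
      have h2 : x ^ m = - ∑ i ∈ Finset.Icc 1 m, a i * x ^ (m - i) := by
        linear_combination heq
      rw [pow_add, h2, mul_neg, Finset.mul_sum]
      congr 1
      refine Finset.sum_congr rfl fun i hi => ?_
      rw [Finset.mem_Icc] at hi
      rw [show b + m - i = b + (m - i) by omega, pow_add]
      ring
    rw [hx]
    refine neg_mem (Ideal.sum_mem _ fun i hi => ?_)
    have hai := ha i hi
    rw [Finset.mem_Icc] at hi
    rw [← pow_mul] at hai
    by_cases hib : i ≤ b
    · have h3 := ih (b - i) (by omega)
      have h4 := Ideal.mul_mem_mul hai h3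
      rw [← pow_add] at h4
      rw [show b + m - i = b - i + m by omega]
      refine Ideal.pow_le_pow_right (le_of_eq ?_) h4
      rw [← mul_add]
      congr 1; omega
    · refine Ideal.mul_mem_right _ _ (Ideal.pow_le_pow_right ?_ hai)
      exact Nat.mul_le_mul_left _ (by omega)
  intro ε hε
  obtain ⟨b, hb⟩ := exists_nat_ge ((n * m + N0) / ε)
  rw [div_le_iff₀ hε] at hb
  have hxb := key b
  refine ⟨b + m, n * (b + 1) - N0, by omega, ?_, ?_⟩
  · by_cases h0 : N0 ≤ n * (b + 1)
    · refine hred _ ?_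
      rwa [Nat.sub_add_cancel h0]
    · rw [Nat.sub_eq_zero_of_le (by omega)]; simp
  · have h1 : ((n * (b+1) : ℕ) : ℝ) ≤ ((n * (b + 1) - N0 : ℕ) : ℝ) + N0 := by
      rw [← Nat.cast_add]
      exact_mod_cast (le_tsub_add : n * (b+1) ≤ n * (b+1) - N0 + N0)
    push_cast at h1 ⊢
    have h0 : (0:ℝ) ≤ ε * m := by positivity
    have h00 : (0:ℝ) ≤ n := by positivity
    nlinarith

lemma QSetup.AP_cancel {A : Type*} [CommRing A] [IsLocalRing A] {d : ℕ} {y : Fin d → A} (hy : QSetup y)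
    {n : ℕ} {f : MvPolynomial (Fin d) A} (hf : f.IsHomogeneous n)
    (hfu : ∃ n, IsUnit (f.coeff n)) {x : A} {q : ℝ}
    (h : AP (Ideal.span (Set.range y)) (MvPolynomial.eval y f * x) (n + q)) :
    AP (Ideal.span (Set.range y)) x q := by
  by_cases hq : q ≤ 0
  · have := FI_nonpos (J := Ideal.span (Set.range y)) hq
    rw [← mem_FI, this]; trivial
  push Not at hq
  have key : ∀ b : ℕ, ∀ a k, MvPolynomial.eval y f ^ b * a ∈ Ideal.span (Set.range y) ^ (n * b + k) →
      a ∈ Ideal.span (Set.range y) ^ k := by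
    intro b
    induction b with
    | zero => intro a k h; simpa using h
    | succ b ih =>
      intro a k h
      refine hy.colon n f hf hfu k a (ih _ _ ?_)
      rw [← mul_assoc, ← pow_succ]
      convert h using 2
      ring
  intro ε hε
  obtain ⟨b, a, hb, hxa, hba⟩ := h (min ε q) (lt_min hε hq)
  have hle : ((n * b : ℕ) : ℝ) ≤ a := by
    push_cast
    refine le_trans ?_ hba
    have := min_le_right ε q
    gcongr
    linarith
  have hle' : n * b ≤ a := by exact_mod_cast hle
  refine ⟨b, a - n * b, hb, key b _ _ ?_, ?_⟩
  · rw [← mul_pow, Nat.add_sub_cancel' hle']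
    exact hxa
  · rw [Nat.cast_sub hle']
    push_cast
    have h1 := min_le_left ε q
    have h2 : (0:ℝ) ≤ b := by positivity
    nlinarith

lemma le_FI_pos [IsLocalRing A] (c : ℕ) (hc : maximalIdeal A ^ c ≤ J) :
    maximalIdeal A ≤ FI J (1 / ((c:ℝ)+1)) := by
  intro z hz
  refine AP.of_mem (b := c + 1) (a := 1) (by omega) ?_ ?_
  · rw [pow_one, pow_succ]
    exact Ideal.mul_mem_right _ _ (hc (Ideal.pow_mem_pow hz c))
  · push_cast
    have : (c:ℝ)+1 ≠ 0 := by positivity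
    field_simp
    rfl

end A4

section A5

lemma lemma_Q {D : Type*} [CommRing D] [IsNoetherianRing D] (w v : D) (hv : v ∈ nonZeroDivisors D)
    (P : Ideal D) (hP : P ∈ (Ideal.span {w}).minimalPrimes) :
    ∃ (K : ℕ) (s c : D), s ∉ P ∧ w ^ K * s = v * c := by
  have hPp : P.IsPrime := hP.1.1
  by_contra hcon
  push Not at hcon
  have hdis : Disjoint ((Ideal.span {v} : Ideal D) : Set D)
      ((Submonoid.powers w ⊔ P.primeCompl : Submonoid D) : Set D) := by
    rw [Set.disjoint_left]
    intro z hz hz'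
    rw [SetLike.mem_coe, Submonoid.mem_sup] at hz'
    obtain ⟨_, ⟨K, rfl⟩, s, hs, rfl⟩ := hz'
    rw [SetLike.mem_coe, Ideal.mem_span_singleton] at hz
    obtain ⟨c, hc⟩ := hz
    exact hcon K s c hs hc
  obtain ⟨q, hq, hvq, hqd⟩ := Ideal.exists_le_prime_disjoint _ _ hdis
  have hqP : q < P := by
    refine lt_of_le_of_ne ?_ ?_
    · intro z hz
      by_contra hzP
      exact Set.disjoint_left.1 hqd hz (Submonoid.mem_sup_right (S := Submonoid.powers w) hzP)
    · rintro rfl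
      have hw : w ∈ q := hP.1.2 (Ideal.mem_span_singleton_self w)
      exact Set.disjoint_left.1 hqd hw (Submonoid.mem_sup_left (Submonoid.mem_powers w))
  have h1 : P.height ≤ 1 := Ideal.height_le_one_of_isPrincipal_of_mem_minimalPrimes (Ideal.span {w}) P hP
  have h2 : q.height + 1 ≤ P.height := by
    have := Ideal.height_add_one_le_of_lt_of_isPrime hqP
    exact this
  have h3 : q.height = 0 := by
    by_contra h5
    have h6 : 1 ≤ q.height := Order.one_le_iff_ne_zero.2 h5
    have h7 : (1 : ℕ∞) + 1 ≤ 1 := (add_le_add_left h6 1).trans (h2.trans h1)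
    exact absurd h7 (by decide)
  rw [Ideal.height_eq_zero_iff] at h3
  exact Set.disjoint_left.1 (Ideal.disjoint_nonZeroDivisors_of_mem_minimalPrimes h3)
    (hvq (Ideal.mem_span_singleton_self v)) hv

open LaurentPolynomial in
/-- auxiliary extended Rees-like algebra -/
noncomputable def reesD {A : Type*} [CommRing A] (s : Finset A) (L : Type*) [CommRing L] [Algebra A L]
    (ξ' : L) (n : ℕ) : Subalgebra A L[T;T⁻¹] :=
  Algebra.adjoin A (((fun y : A => (LaurentPolynomial.C (algebraMap A L y) * T 1 : L[T;T⁻¹])) '' s) ∪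
    {T (-1), LaurentPolynomial.C ξ' * T (-(n:ℤ))})

section
variable {A : Type*} [CommRing A] (s : Finset A) (L : Type*) [CommRing L] [Algebra A L]
    (ξ' : L) (n : ℕ)

instance reesD_noeth [IsNoetherianRing A] : IsNoetherianRing (reesD s L ξ' n) := by
  classical
  haveI : Algebra.FiniteType A (reesD s L ξ' n) := by
    rw [← Subalgebra.fg_iff_finiteType]
    refine Subalgebra.fg_def.2 ⟨_, ?_, rfl⟩
    exact (Set.Finite.image _ s.finite_toSet).union (by simp)
  exact Algebra.FiniteType.isNoetherianRing A _

open LaurentPolynomial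

lemma coeff_C_mul_T' {L : Type*} [CommRing L] (a : L) (k q : ℤ) :
    (LaurentPolynomial.C a * T k : L[T;T⁻¹]).coeff q = if k = q then a else 0 := by
  rw [← single_eq_C_mul_T, AddMonoidAlgebra.coeff_single, Finsupp.single_apply]

lemma reesD_u : (T (-1) : L[T;T⁻¹]) ∈ reesD s L ξ' n :=
  Algebra.subset_adjoin (Or.inr (by simp))

lemma reesD_w : (LaurentPolynomial.C ξ' * T (-(n:ℤ)) : L[T;T⁻¹]) ∈ reesD s L ξ' n :=
  Algebra.subset_adjoin (Or.inr (by simp))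

lemma reesD_C (a : A) : (LaurentPolynomial.C (algebraMap A L a) : L[T;T⁻¹]) ∈ reesD s L ξ' n := by
  rw [← LaurentPolynomial.algebraMap_apply]
  exact Subalgebra.algebraMap_mem _ _

lemma reesD_mono (k : ℕ) : ∀ (a : A), a ∈ (Ideal.span (s : Set A)) ^ k →
    (LaurentPolynomial.C (algebraMap A L a) * T k : L[T;T⁻¹]) ∈ reesD s L ξ' n := by
  induction k with
  | zero =>
    intro a _
    simpa using reesD_C s L ξ' n a
  | succ k ih =>
    intro a ha
    rw [pow_succ] at ha
    refine Submodule.mul_induction_on ha ?_ ?_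
    · intro b hb c hc
      have h1 : (LaurentPolynomial.C (algebraMap A L c) * T 1 : L[T;T⁻¹]) ∈ reesD s L ξ' n := by
        refine Submodule.span_induction (p := fun c _ => (LaurentPolynomial.C (algebraMap A L c) * T 1 : L[T;T⁻¹]) ∈ reesD s L ξ' n) ?_ ?_ ?_ ?_ hc
        · intro y hy
          exact Algebra.subset_adjoin (Or.inl ⟨y, hy, rfl⟩)
        · simp
        · intro x y _ _ hx hy
          rw [map_add, map_add, add_mul]
          exact add_mem hx hy
        · intro r x _ hx
          rw [smul_eq_mul, map_mul, map_mul, mul_assoc]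
          exact mul_mem (reesD_C s L ξ' n r) hx
      have h2 := mul_mem (ih b hb) h1
      convert h2 using 1
      rw [map_mul, map_mul]
      push_cast
      rw [T_add]
      ring
    · intro x y hx hy
      rw [map_add, map_add, add_mul]
      exact add_mem hx hy

lemma reesD_coeff (p : L[T;T⁻¹]) (hp : p ∈ reesD s L ξ' n) (q : ℤ) :
    ∃ (l : ℕ) (a : ℕ → A), (∀ i : ℕ, a i ∈ (Ideal.span (s : Set A)) ^ (q + n * i).toNat) ∧
      p.coeff q = ∑ i ∈ Finset.range l, algebraMap A L (a i) * ξ' ^ i := by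
  classical
  set J := Ideal.span (s : Set A)
  have hadj : p ∈ Submodule.span A (Submonoid.closure (((fun y : A =>
      (LaurentPolynomial.C (algebraMap A L y) * T 1 : L[T;T⁻¹])) '' s) ∪
    {T (-1), LaurentPolynomial.C ξ' * T (-(n:ℤ))}) : Set L[T;T⁻¹]) := by
    rw [← Algebra.adjoin_eq_span]; exact hp
  -- elements of the closure are monomials
  have hcl : ∀ z ∈ Submonoid.closure (((fun y : A =>
      (LaurentPolynomial.C (algebraMap A L y) * T 1 : L[T;T⁻¹])) '' s) ∪
    {T (-1), LaurentPolynomial.C ξ' * T (-(n:ℤ))}), ∃ (a : A) (i : ℕ) (k : ℤ),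
      a ∈ J ^ (k + n * i).toNat ∧ z = LaurentPolynomial.C (algebraMap A L a * ξ' ^ i) * T k := by
    intro z hz
    induction hz using Submonoid.closure_induction with
    | mem z hz =>
      rcases hz with ⟨y, hy, rfl⟩ | hz
      · exact ⟨y, 0, 1, by simpa using Ideal.subset_span hy, by simp⟩
      · rcases hz with rfl | rfl
        · exact ⟨1, 0, -1, by simp, by simp⟩
        · exact ⟨1, 1, -n, by simp, by simp⟩
    | one => exact ⟨1, 0, 0, by simp, by simp⟩
    | mul z z' _ _ h h' =>
      obtain ⟨a, i, k, ha, rfl⟩ := h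
      obtain ⟨a', i', k', ha', rfl⟩ := h'
      refine ⟨a * a', i + i', k + k', ?_, ?_⟩
      · have := Ideal.mul_mem_mul ha ha'
        rw [← pow_add] at this
        refine Ideal.pow_le_pow_right ?_ this
        push_cast
        rw [mul_add]
        omega
      · rw [T_add]
        simp only [map_mul, map_pow, pow_add]
        ring
  induction hadj using Submodule.span_induction with
  | mem z hz =>
    obtain ⟨a, i, k, ha, rfl⟩ := hcl z hz
    by_cases hk : k = q
    · subst hk
      refine ⟨i + 1, fun j => if j = i then a else 0, ?_, ?_⟩
      · intro j
        by_cases hj : j = i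
        · subst hj; simpa using ha
        · simp [hj]
      · rw [Finset.sum_eq_single i]
        · rw [coeff_C_mul_T']; simp
        · intro j _ hj; simp [hj]
        · simp
    · refine ⟨0, 0, by simp, ?_⟩
      rw [coeff_C_mul_T']
      simp [hk]
  | zero => exact ⟨0, 0, by simp, by simp⟩
  | add x y _ _ hx hy =>
    have hx := hx (by rw [reesD, ← Subalgebra.mem_toSubmodule, Algebra.adjoin_eq_span]; assumption)
    have hy := hy (by rw [reesD, ← Subalgebra.mem_toSubmodule, Algebra.adjoin_eq_span]; assumption)
    obtain ⟨l, a, ha, hxa⟩ := hx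
    obtain ⟨l', a', ha', hya⟩ := hy
    refine ⟨max l l', fun i => (if i < l then a i else 0) + (if i < l' then a' i else 0), ?_, ?_⟩
    · intro i
      refine add_mem ?_ ?_
      · split_ifs
        · exact ha i
        · simp
      · split_ifs
        · exact ha' i
        · simp
    · have e1 : ∀ (l m : ℕ) (a : ℕ → A), l ≤ m → ∑ i ∈ Finset.range l, algebraMap A L (a i) * ξ' ^ i =
          ∑ i ∈ Finset.range m, algebraMap A L (if i < l then a i else 0) * ξ' ^ i := by
        intro l m a hlm
        rw [← Finset.sum_subset (Finset.range_subset_range.2 hlm)]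
        · refine Finset.sum_congr rfl fun i hi => ?_
          rw [if_pos (Finset.mem_range.1 hi)]
        · intro i _ hi
          rw [Finset.mem_range] at hi
          simp [hi]
      have : (x + y).coeff q = x.coeff q + y.coeff q := by simp
      rw [this, hxa, hya, e1 l _ a (le_max_left l l'), e1 l' _ a' (le_max_right l l'),
        ← Finset.sum_add_distrib]
      refine Finset.sum_congr rfl fun i _ => ?_
      rw [map_add, add_mul]
  | smul r x _ hx =>
    have hx := hx (by rw [reesD, ← Subalgebra.mem_toSubmodule, Algebra.adjoin_eq_span]; assumption)
    obtain ⟨l, a, ha, hxa⟩ := hx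
    refine ⟨l, fun i => r * a i, fun i => Ideal.mul_mem_left _ _ (ha i), ?_⟩
    have : (r • x).coeff q = algebraMap A L r * x.coeff q := by
      rw [AddMonoidAlgebra.coeff_smul, Finsupp.smul_apply, Algebra.smul_def]
    rw [this, hxa, Finset.mul_sum]
    refine Finset.sum_congr rfl fun i _ => ?_
    rw [map_mul]; ring

end
end A5

section A6
open LaurentPolynomial

lemma AP.attain {A : Type*} [CommRing A] [IsNoetherianRing A] {J : Ideal A} {x : A} {n : ℕ}
    (h : AP J x n) : IsIntegralOverIdeal (J ^ n) x := by
  classical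
  by_cases hn0 : n = 0
  · subst hn0
    exact ⟨1, one_pos, fun _ => -x, by simp, by simp⟩
  obtain ⟨s, hs⟩ := (isNoetherianRing_iff_ideal_fg A).1 inferInstance J
  change Ideal.span (s : Set A) = J at hs
  let L := Localization.Away x
  let ξ : L := algebraMap A L x
  obtain ⟨ξu, hξu⟩ : IsUnit ξ := IsLocalization.Away.algebraMap_isUnit x
  let ξ' : L := ((ξu⁻¹ : Lˣ) : L)
  have hξ : ξ * ξ' = 1 := by rw [← hξu]; simp [ξ']
  let D := reesD s L ξ' n
  let u : D := ⟨_, reesD_u s L ξ' n⟩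
  let w : D := ⟨_, reesD_w s L ξ' n⟩
  have hwinv : (w : L[T;T⁻¹]) * (LaurentPolynomial.C ξ * T n) = 1 := by
    change (LaurentPolynomial.C ξ' * T (-(n:ℤ)) : L[T;T⁻¹]) * (LaurentPolynomial.C ξ * T n) = 1
    rw [mul_mul_mul_comm, ← map_mul, mul_comm ξ' ξ, hξ, ← T_add]
    simp
  by_cases hw : IsUnit w
  · obtain ⟨w', hw'⟩ := hw.exists_right_inv
    have hw1 : (w : L[T;T⁻¹]) * (w' : L[T;T⁻¹]) = 1 := by
      have := congrArg (Subtype.val) hw'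
      simpa using this
    have hw2 : (w' : L[T;T⁻¹]) = LaurentPolynomial.C ξ * T n := by
      have hwu : IsUnit (w : L[T;T⁻¹]) := IsUnit.of_mul_eq_one _ hwinv
      exact hwu.mul_left_cancel (hw1.trans hwinv.symm)
    have hmem : (LaurentPolynomial.C ξ * T n : L[T;T⁻¹]) ∈ reesD s L ξ' n := hw2 ▸ w'.2
    obtain ⟨l, a, ha, hsum⟩ := reesD_coeff s L ξ' n _ hmem n
    rw [coeff_C_mul_T', if_pos rfl, hs] at *
    have ha' : ∀ i : ℕ, a i ∈ (J ^ n) ^ (i + 1) := by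
      intro i
      rw [← pow_mul]
      refine Ideal.pow_le_pow_right (le_of_eq ?_) (ha i)
      have : ((n:ℤ) + n * i) = ((n * (i+1) : ℕ) : ℤ) := by push_cast; ring
      rw [this, Int.toNat_natCast]
    have heq : algebraMap A L (x ^ (l + 1)) =
        algebraMap A L (∑ i ∈ Finset.range l, a i * x ^ (l - i)) := by
      rw [map_pow, map_sum, pow_succ']
      change ξ * ξ ^ l = _
      have hsum' : ξ * ξ ^ l = (∑ i ∈ Finset.range l, (algebraMap A L) (a i) * ξ' ^ i) * ξ ^ l :=
        congrArg (· * ξ ^ l) hsum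
      rw [hsum', Finset.sum_mul]
      refine Finset.sum_congr rfl fun i hi => ?_
      rw [Finset.mem_range] at hi
      rw [map_mul, map_pow]
      change _ = _ * ξ ^ (l - i)
      have : ξ ^ l = ξ ^ (l - i) * ξ ^ i := by rw [← pow_add]; congr 1; omega
      rw [this]
      have h1 : ξ ^ i * ξ' ^ i = 1 := by rw [← mul_pow, hξ, one_pow]
      linear_combination (algebraMap A L (a i)) * ξ ^ (l - i) * h1
    obtain ⟨⟨_, M, rfl⟩, hc⟩ := (IsLocalization.eq_iff_exists (Submonoid.powers x) L).1 heq
    simp only at hc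
    refine ⟨M + (l + 1), by omega, fun i => if i ≤ l then - a (i - 1) else 0, ?_, ?_⟩
    · intro i hi
      rw [Finset.mem_Icc] at hi
      by_cases hil : i ≤ l
      · have := ha' (i - 1)
        rw [Nat.sub_add_cancel hi.1] at this
        simpa [hil] using this
      · simp [hil]
    · have h2 : ∑ i ∈ Finset.Icc 1 (M + (l+1)), (if i ≤ l then - a (i - 1) else 0) * x ^ (M + (l+1) - i)
          = - (x ^ M * ∑ i ∈ Finset.range l, a i * x ^ (l - i)) := by
        rw [← Finset.sum_subset (s₁ := Finset.Icc 1 l)]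
        · rw [Finset.range_eq_Ico, Finset.sum_Ico_eq_sum_range]
          rw [show Finset.Icc 1 l = Finset.Ico 1 (l+1) by ext; simp]
          rw [Finset.sum_Ico_eq_sum_range, Finset.mul_sum, ← Finset.sum_neg_distrib]
          refine Finset.sum_congr (by simp) fun i hi => ?_
          have hi : i < l := by simpa using hi
          rw [if_pos (by omega)]
          have : M + (l + 1) - (1 + i) = M + (l - i) := by omega
          rw [this, pow_add]
          simp
          ring
        · intro i hi
          rw [Finset.mem_Icc] at hi ⊢
          omega
        · intro i hi hi'
          rw [Finset.mem_Icc] at hi hi'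
          rw [if_neg (by omega), zero_mul]
      rw [h2, pow_add, hc]
      ring
  · exfalso
    have htop : (Ideal.span {w} : Ideal D) ≠ ⊤ := by
      rwa [Ne, Ideal.span_singleton_eq_top]
    obtain ⟨P, hP⟩ := Ideal.nonempty_minimalPrimes htop
    have hPp : P.IsPrime := hP.1.1
    have hwP : w ∈ P := hP.1.2 (Ideal.mem_span_singleton_self w)
    have hunz : u ∈ nonZeroDivisors D := by
      rw [mem_nonZeroDivisors_iff_right]
      intro z hz
      have h1 : (z : L[T;T⁻¹]) * T (-1) = 0 := congrArg Subtype.val hz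
      have h2 := (isUnit_T (R := L) (-1)).mul_left_eq_zero.1 h1
      exact Subtype.ext h2
    obtain ⟨K, σ, c, hσ, hK⟩ := lemma_Q w u hunz P hP
    obtain ⟨j, a, hj, hxa, hja⟩ := h (1 / ((K:ℝ)+1)) (by positivity)
    -- exponents
    set b := (K + 1) * j with hb
    have hxb : x ^ b ∈ J ^ (n * b - j) := by
      have h1 : x ^ b ∈ J ^ (a * (K+1)) := by
        rw [hb, mul_comm (K+1) j]; exact pow_mem_pow_mul hxa (K+1)
      refine Ideal.pow_le_pow_right ?_ h1
      have h2 : (n : ℝ) * ((K+1) * j) - j ≤ a * (K + 1) := by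
        have h3 := mul_le_mul_of_nonneg_right hja (by positivity : (0:ℝ) ≤ K + 1)
        refine le_trans (le_of_eq ?_) h3
        field_simp
      have h4 : n * b ≤ a * (K + 1) + j := by
        rw [hb]
        have : (n : ℝ) * ((K+1) * j) ≤ a * (K + 1) + j := by linarith
        exact_mod_cast this
      omega
    have hjb : j ≤ n * b := by
      rw [hb]
      calc j = 1 * (1 * j) := by ring
        _ ≤ n * ((K+1) * j) := Nat.mul_le_mul (by omega) (Nat.mul_le_mul_right _ (by omega))
    let δ : D := ⟨_, reesD_mono s L ξ' n (n * b - j) (x ^ b) (by rw [hs]; exact hxb)⟩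
    have hδ : u ^ j = w ^ b * δ := by
      apply Subtype.ext
      change (T (-1) : L[T;T⁻¹]) ^ j = (LaurentPolynomial.C ξ' * T (-(n:ℤ))) ^ b *
        (LaurentPolynomial.C (algebraMap A L (x ^ b)) * T ((n * b - j : ℕ) : ℤ))
      rw [T_pow, mul_pow, T_pow, mul_mul_mul_comm, ← map_pow, ← map_mul, ← T_add, map_pow]
      change _ = LaurentPolynomial.C (ξ' ^ b * ξ ^ b) * _
      rw [← mul_pow, mul_comm ξ', hξ, one_pow, map_one, one_mul, Nat.cast_sub hjb]
      congr 1
      push_cast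
      ring
    have hcan : w ^ b * σ ^ j = w ^ b * (δ * w ^ j * c ^ j) := by
      calc w ^ b * σ ^ j = (w ^ K * σ) ^ j * w ^ j := by rw [hb, mul_pow, ← pow_mul]; ring
        _ = u ^ j * c ^ j * w ^ j := by rw [hK, mul_pow]
        _ = _ := by rw [hδ]; ring
    have hsj : σ ^ j = δ * w ^ j * c ^ j := by
      apply Subtype.ext
      have h1 := congrArg Subtype.val hcan
      have h2 : (w : L[T;T⁻¹]) ^ b * (σ : L[T;T⁻¹]) ^ j =
        (w : L[T;T⁻¹]) ^ b * ((δ * w ^ j * c ^ j : D) : L[T;T⁻¹]) := by simpa using h1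
      have hwu : IsUnit ((w : L[T;T⁻¹]) ^ b) := (IsUnit.of_mul_eq_one _ hwinv).pow b
      have h3 := hwu.mul_left_cancel h2
      simpa using h3
    apply hσ
    apply hPp.mem_of_pow_mem j
    rw [hsj]
    exact Ideal.mul_mem_right _ _ (Ideal.mul_mem_left _ _ (Ideal.pow_mem_of_mem _ hwP j (by omega)))

lemma AP.nilpotent_of_all {A : Type*} [CommRing A] [IsNoetherianRing A] [IsLocalRing A] {J : Ideal A}
    (hJ : J ≠ ⊤) {z : A} (h : ∀ n : ℕ, AP J z n) : IsNilpotent z := by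
  classical
  by_contra hnil
  obtain ⟨s, hs⟩ := (isNoetherianRing_iff_ideal_fg A).1 inferInstance J
  change Ideal.span (s : Set A) = J at hs
  let L := Localization.Away z
  let ξ : L := algebraMap A L z
  have hξu : IsUnit ξ := IsLocalization.Away.algebraMap_isUnit z
  let D := reesD s L 1 1
  let u : D := ⟨_, reesD_u s L 1 1⟩
  let v : D := ⟨_, reesD_C s L 1 1 z⟩
  have hu : ¬ IsUnit u := by
    intro hu
    obtain ⟨w', hw'⟩ := hu.exists_right_inv
    have hw1 : (T (-1) : L[T;T⁻¹]) * (w' : L[T;T⁻¹]) = 1 := by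
      exact congrArg (Subtype.val) hw'
    have hw2 : (w' : L[T;T⁻¹]) = LaurentPolynomial.C 1 * T 1 := by
      refine (isUnit_T (R := L) (-1)).mul_left_cancel (hw1.trans ?_)
      rw [map_one, one_mul, ← T_add]
      simp
    have hmem := w'.2
    rw [hw2] at hmem
    obtain ⟨l, a, ha, hsum⟩ := reesD_coeff s L 1 1 _ hmem 1
    rw [coeff_C_mul_T', if_pos rfl, hs] at *
    have hJ1 : ∑ i ∈ Finset.range l, a i ∈ J := by
      refine Ideal.sum_mem _ fun i _ => ?_
      have := ha i
      refine Ideal.pow_le_self ?_ this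
      omega
    have heq : algebraMap A L (1 - ∑ i ∈ Finset.range l, a i) = algebraMap A L 0 := by
      rw [map_sub, map_sum, map_one, hsum]
      simp
    obtain ⟨⟨_, M, rfl⟩, hc⟩ := (IsLocalization.eq_iff_exists (Submonoid.powers z) L).1 heq
    have hun : IsUnit (1 - ∑ i ∈ Finset.range l, a i) := by
      have h1 := (le_maximalIdeal hJ) hJ1
      exact IsLocalRing.isUnit_one_sub_self_of_mem_nonunits _ h1
    simp only [mul_zero] at hc
    exact hnil ⟨M, hun.mul_left_eq_zero.1 hc⟩
  have htop : (Ideal.span {u} : Ideal D) ≠ ⊤ := by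
    rwa [Ne, Ideal.span_singleton_eq_top]
  obtain ⟨P, hP⟩ := Ideal.nonempty_minimalPrimes htop
  have hPp : P.IsPrime := hP.1.1
  have huP : u ∈ P := hP.1.2 (Ideal.mem_span_singleton_self u)
  have hvnz : v ∈ nonZeroDivisors D := by
    rw [mem_nonZeroDivisors_iff_right]
    intro x hx
    have h1 : (x : L[T;T⁻¹]) * LaurentPolynomial.C ξ = 0 := congrArg Subtype.val hx
    have h2 := (hξu.map (LaurentPolynomial.C)).mul_left_eq_zero.1 h1
    exact Subtype.ext h2
  obtain ⟨K, σ, c, hσ, hK⟩ := lemma_Q u v hvnz P hP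
  obtain ⟨b, a, hb, hxa, hba⟩ := h (K + 2) 1 one_pos
  have hle : (K + 1) * b ≤ a := by
    have : ((K:ℝ) + 1) * b ≤ a := by
      refine le_trans (le_of_eq ?_) hba
      push_cast; ring
    exact_mod_cast this
  let δ : D := ⟨_, reesD_mono s L 1 1 ((K+1)*b) (z ^ b) (by rw [hs]; exact Ideal.pow_le_pow_right hle hxa)⟩
  have hδ : v ^ b = u ^ ((K+1)*b) * δ := by
    apply Subtype.ext
    change (LaurentPolynomial.C ξ : L[T;T⁻¹]) ^ b = (T (-1)) ^ ((K+1)*b) *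
        (LaurentPolynomial.C (algebraMap A L (z ^ b)) * T (((K+1)*b : ℕ) : ℤ))
    rw [T_pow, mul_left_comm, ← T_add, map_pow, map_pow]
    simp [ξ]
  have hcan : u ^ (K*b) * σ ^ b = u ^ (K*b) * (u ^ b * δ * c ^ b) := by
    calc u ^ (K*b) * σ ^ b = (u ^ K * σ) ^ b := by rw [mul_pow, ← pow_mul]
      _ = v ^ b * c ^ b := by rw [hK, mul_pow]
      _ = _ := by rw [hδ]; ring
  have hsj : σ ^ b = u ^ b * δ * c ^ b := by
    apply Subtype.ext
    have h1 := congrArg Subtype.val hcan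
    have h2 : (u : L[T;T⁻¹]) ^ (K*b) * (σ : L[T;T⁻¹]) ^ b =
      (u : L[T;T⁻¹]) ^ (K*b) * ((u ^ b * δ * c ^ b : D) : L[T;T⁻¹]) := by simpa using h1
    have hwu : IsUnit ((u : L[T;T⁻¹]) ^ (K*b)) := (isUnit_T (-1)).pow _
    have h3 := hwu.mul_left_cancel h2
    simpa using h3
  apply hσ
  apply hPp.mem_of_pow_mem b
  rw [hsj]
  exact Ideal.mul_mem_right _ _ (Ideal.mul_mem_right _ _ (Ideal.pow_mem_of_mem _ huP b (by omega)))

end A6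

section A7

lemma coeff_mul_monomial_aux {R : Type*} [CommRing R] (q : R[X]) (N n : ℕ) (r : R) :
    (q * Polynomial.monomial N r).coeff n = if N ≤ n then q.coeff (n - N) * r else 0 := by
  rw [← Polynomial.C_mul_X_pow_eq_monomial, ← mul_assoc, Polynomial.coeff_mul_X_pow',
    Polynomial.coeff_mul_C]

lemma artin_quot {R : Type*} [CommRing R] [IsLocalRing R] [IsNoetherianRing R] (a : Ideal R) (c : ℕ)
    (h : maximalIdeal R ^ c ≤ a) : IsArtinianRing (R ⧸ a) := by
  by_cases ha : a = ⊤
  · have : Subsingleton (R ⧸ a) := Ideal.Quotient.subsingleton_iff.2 ha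
    infer_instance
  · apply IsLocalRing.quotient_artinian_of_mem_minimalPrimes_of_isLocalRing
    refine ⟨⟨inferInstance, le_maximalIdeal ha⟩, fun q hq _ => ?_⟩
    have := hq.1
    exact this.le_of_pow_le (h.trans hq.2)


lemma noeth_of_adic {R A : Type*} [CommRing R] [IsNoetherianRing R] [CommRing A] (ι : R →+* A)
    (I : Ideal R) (M : Ideal A) (hM : I.map ι = M) (hdense : ∀ a, ∃ r, a - ι r ∈ M)
    [IsAdicComplete M A] : IsNoetherianRing A := by
  classical
  rw [isNoetherianRing_iff_ideal_fg]
  intro 𝔞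
  have hpow : ∀ n, (I ^ n).map ι = M ^ n := fun n => by rw [Ideal.map_pow, hM]
  have hιM : ∀ n r, r ∈ I ^ n → ι r ∈ M ^ n := fun n r hr => by
    rw [← hpow]; exact Ideal.mem_map_of_mem ι hr
  -- approximating elements of M^n
  have happ : ∀ n, ∀ x ∈ M ^ n, ∃ r ∈ I ^ n, x - ι r ∈ M ^ (n + 1) := by
    intro n x hx
    rw [← hpow, Ideal.map] at hx
    refine Submodule.span_induction (p := fun x _ => ∃ r ∈ I ^ n, x - ι r ∈ M ^ (n + 1)) ?_ ?_ ?_ ?_ hx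
    · rintro _ ⟨r, hr, rfl⟩
      exact ⟨r, hr, by simp⟩
    · exact ⟨0, zero_mem _, by simp⟩
    · rintro x y _ _ ⟨r, hr, hxr⟩ ⟨s, hs, hys⟩
      refine ⟨r + s, add_mem hr hs, ?_⟩
      have := add_mem hxr hys
      convert this using 1
      rw [map_add]; ring
    · rintro a x _ ⟨r, hr, hxr⟩
      obtain ⟨s, hs⟩ := hdense a
      refine ⟨s * r, Ideal.mul_mem_left _ _ hr, ?_⟩
      have h1 : a * (x - ι r) ∈ M ^ (n+1) := Ideal.mul_mem_left _ _ hxr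
      have h2 : ι r * (a - ι s) ∈ M ^ (n+1) := by
        rw [pow_succ]; exact Ideal.mul_mem_mul (hιM n r hr) hs
      have := add_mem h1 h2
      convert this using 1
      rw [map_mul, smul_eq_mul]; ring
  let Tset : Set (reesAlgebra I) := {p | ∃ (n : ℕ) (r : R), (p : R[X]) = Polynomial.monomial n r ∧
    ∃ a ∈ 𝔞, ι r - a ∈ M ^ (n + 1)}
  obtain ⟨t, htT, hts⟩ := (Submodule.fg_span_iff_fg_span_finset_subset Tset).1
    ((isNoetherianRing_iff_ideal_fg (reesAlgebra I)).1 inferInstance (Ideal.span Tset))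
  have hdata : ∀ g : t, ∃ (n : ℕ) (r : R) (a : A), ((g : reesAlgebra I) : R[X]) = Polynomial.monomial n r ∧
      a ∈ 𝔞 ∧ ι r - a ∈ M ^ (n + 1) := by
    rintro ⟨g, hg⟩
    obtain ⟨n, r, h1, a, ha, h2⟩ := htT hg
    exact ⟨n, r, a, h1, ha, h2⟩
  choose N rr aa hgm haa hra using hdata
  have step : ∀ n : ℕ, ∀ x : A, x ∈ 𝔞 → x ∈ M ^ n → ∃ c : t → A, (∀ g, c g ∈ M ^ (n - N g)) ∧
      x - ∑ g, c g * aa g ∈ M ^ (n + 1) := by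
    intro n x hxa hx
    obtain ⟨r, hr, hxr⟩ := happ n x hx
    have hmem : (⟨Polynomial.monomial n r, reesAlgebra.monomial_mem.2 hr⟩ : reesAlgebra I) ∈
        Submodule.span (reesAlgebra I) (t : Set (reesAlgebra I)) := by
      rw [← hts]
      refine Submodule.subset_span ⟨n, r, rfl, x, hxa, ?_⟩
      rw [← neg_sub]; exact neg_mem hxr
    rw [Submodule.mem_span_finset'] at hmem
    obtain ⟨q, hq⟩ := hmem
    have hq' := congrArg (fun p : reesAlgebra I => (p : R[X]).coeff n) hq
    simp only [Polynomial.coeff_monomial, if_true] at hq'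
    have hco : ((∑ g : t, q g • (g : reesAlgebra I) : reesAlgebra I) : R[X]).coeff n =
        ∑ g : t, (if N g ≤ n then ((q g : reesAlgebra I) : R[X]).coeff (n - N g) * rr g else 0) := by
      rw [AddSubmonoidClass.coe_finsetSum, Polynomial.finsetSum_coeff]
      refine Finset.sum_congr rfl fun g _ => ?_
      rw [smul_eq_mul, Subalgebra.coe_mul, hgm, coeff_mul_monomial_aux]
    rw [hco] at hq'
    refine ⟨fun g => if N g ≤ n then ι (((q g : reesAlgebra I) : R[X]).coeff (n - N g)) else 0, ?_, ?_⟩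
    · intro g
      simp only
      split_ifs with h
      · exact hιM _ _ ((mem_reesAlgebra_iff I _).1 (q g).2 _)
      · exact zero_mem _
    · have h3 : ι r - ∑ g : t, (if N g ≤ n then ι (((q g : reesAlgebra I) : R[X]).coeff (n - N g)) else 0) * aa g
          ∈ M ^ (n+1) := by
        rw [← hq', map_sum, ← Finset.sum_sub_distrib]
        refine Ideal.sum_mem _ fun g _ => ?_
        split_ifs with h
        · rw [map_mul, ← mul_sub]
          have := Ideal.mul_mem_mul (hιM _ _ ((mem_reesAlgebra_iff I _).1 (q g).2 (n - N g))) (hra g)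
          rw [← pow_add] at this
          convert this using 2
          omega
        · simp
      have := add_mem hxr h3
      convert this using 1
      ring
  choose! c hc1 hc2 using step
  refine ⟨Finset.univ.image aa, ?_⟩
  apply le_antisymm
  · rw [Submodule.span_le]
    intro z hz
    simp only [Finset.coe_image, Finset.coe_univ, Set.image_univ, Set.mem_range] at hz
    obtain ⟨g, rfl⟩ := hz
    exact haa g
  intro x hx
  let xs : ℕ → A := fun n => Nat.rec x (fun n y => y - ∑ g, c n y g * aa g) n
  have hxs : ∀ n, xs n ∈ 𝔞 ∧ xs n ∈ M ^ n := by
    intro n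
    induction n with
    | zero => exact ⟨hx, by simp⟩
    | succ n ih =>
      refine ⟨sub_mem ih.1 (Ideal.sum_mem _ fun g _ => Ideal.mul_mem_left _ _ (haa g)), ?_⟩
      exact hc2 n _ ih.1 ih.2
  let CC : t → ℕ → A := fun g n => ∑ i ∈ Finset.range n, c i (xs i) g
  have hCC : ∀ n, x = xs n + ∑ g, CC g n * aa g := by
    intro n
    induction n with
    | zero => simp [CC, xs]
    | succ n ih =>
      conv_lhs => rw [ih]
      have h1 : xs (n+1) = xs n - ∑ g, c n (xs n) g * aa g := rfl
      have h2 : ∀ g, CC g (n+1) = CC g n + c n (xs n) g := fun g => Finset.sum_range_succ _ _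
      rw [h1]
      simp only [h2, add_mul, Finset.sum_add_distrib]
      ring
  obtain ⟨D, hD⟩ : ∃ D, ∀ g, N g ≤ D := ⟨∑ g, N g, fun g => Finset.single_le_sum (f := N) (fun _ _ => Nat.zero_le _) (Finset.mem_univ g)⟩
  have hlim : ∀ g, ∃ l : A, ∀ m, CC g (m + D) - l ∈ M ^ m := by
    intro g
    obtain ⟨l, hl⟩ := IsPrecomplete.prec' (I := M) (M := A) (fun m => CC g (m + D)) (by
      intro m n hmn
      rw [SModEq.sub_mem, smul_eq_mul, Ideal.mul_top]
      rw [← neg_sub]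
      refine neg_mem ?_
      simp only [CC]
      rw [← Finset.sum_sdiff (Finset.range_subset_range.2 (show m + D ≤ n + D by omega)), add_sub_cancel_right]
      refine Ideal.sum_mem _ fun i hi => ?_
      simp only [Finset.mem_sdiff, Finset.mem_range] at hi
      refine Ideal.pow_le_pow_right ?_ (hc1 i (xs i) (hxs i).1 (hxs i).2 g)
      have := hD g
      omega)
    refine ⟨l, fun m => ?_⟩
    have := hl m
    rwa [SModEq.sub_mem, smul_eq_mul, Ideal.mul_top] at this
  choose l hl using hlim
  have hxl : x - ∑ g, l g * aa g = 0 := by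
    apply IsHausdorff.haus' (I := M) (M := A)
    intro m
    rw [SModEq.sub_mem, smul_eq_mul, Ideal.mul_top, sub_zero]
    have h1 : x - ∑ g, l g * aa g = xs (m + D) + ∑ g, (CC g (m + D) - l g) * aa g := by
      conv_lhs => rw [hCC (m+D)]
      simp only [sub_mul, Finset.sum_sub_distrib]
      ring
    rw [h1]
    refine add_mem (Ideal.pow_le_pow_right (by omega) (hxs (m+D)).2) ?_
    exact Ideal.sum_mem _ fun g _ => Ideal.mul_mem_right _ _ (hl g m)
  rw [sub_eq_zero.1 hxl]
  refine Submodule.sum_mem _ fun g _ => Submodule.smul_mem _ _ (Submodule.subset_span ?_)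
  simp

lemma completion_dense (R : Type*) [CommRing R] [IsLocalRing R] [IsNoetherianRing R]
    (a : AdicCompletion (maximalIdeal R) R) :
    ∃ r, a - algebraMap R _ r ∈ maximalIdeal (AdicCompletion (maximalIdeal R) R) := by
  obtain ⟨k, hk⟩ := (AdicCompletion.residueField_map_bijective (R := R)).2 (residue _ a)
  obtain ⟨r, rfl⟩ := residue_surjective k
  refine ⟨r, ?_⟩
  rw [IsLocalRing.ResidueField.map_residue] at hk
  rw [← residue_eq_zero_iff, map_sub, hk, sub_self]

instance completion_noeth (R : Type*) [CommRing R] [IsLocalRing R] [IsNoetherianRing R] :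
    IsNoetherianRing (AdicCompletion (maximalIdeal R) R) :=
  noeth_of_adic (algebraMap R _) (maximalIdeal R) (maximalIdeal (AdicCompletion (maximalIdeal R) R))
    AdicCompletion.maximalIdeal_eq_map.symm (completion_dense R)

lemma completion_comap (R : Type*) [CommRing R] [IsLocalRing R] [IsNoetherianRing R] (n : ℕ) (x : R)
    (hx : algebraMap R _ x ∈ maximalIdeal (AdicCompletion (maximalIdeal R) R) ^ n) :
    x ∈ maximalIdeal R ^ n := by
  rw [AdicCompletion.maximalIdeal_eq_map, ← Ideal.map_pow] at hx
  have hle : ((maximalIdeal R) ^ n).map (algebraMap R (AdicCompletion (maximalIdeal R) R)) ≤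
      RingHom.ker (AdicCompletion.evalₐ (maximalIdeal R) n) := by
    rw [Ideal.map_le_iff_le_comap]
    intro r hr
    rw [Ideal.mem_comap, RingHom.mem_ker]
    rw [AlgHom.commutes]
    exact Ideal.Quotient.eq_zero_iff_mem.2 hr
  have h1 := hle hx
  rw [RingHom.mem_ker, AlgHom.commutes] at h1
  exact Ideal.Quotient.eq_zero_iff_mem.1 h1

lemma AP.map {A B : Type*} [CommRing A] [CommRing B] (f : A →+* B) {J : Ideal A} {x : A} {q : ℝ}
    (h : AP J x q) : AP (J.map f) (f x) q := by
  intro ε hε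
  obtain ⟨b, a, hb, hx, hba⟩ := h ε hε
  refine ⟨b, a, hb, ?_, hba⟩
  rw [← map_pow, ← Ideal.map_pow]
  exact Ideal.mem_map_of_mem f hx

theorem chevalley (R : Type*) [CommRing R] [IsLocalRing R] [IsNoetherianRing R]
    (hAU : AnalyticallyUnramified R) (J : Ideal R) (c : ℕ) (hc : maximalIdeal R ^ c ≤ J)
    (hJ : J ≤ maximalIdeal R) (n0 : ℕ) : ∃ M : ℕ, FI J M ≤ maximalIdeal R ^ n0 := by
  classical
  set m := maximalIdeal R with hm
  by_contra hcon
  push Not at hcon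
  have hanti : ∀ {M M' : ℕ}, M ≤ M' → FI J (M' : ℝ) ≤ FI J M := fun h => FI_anti (by exact_mod_cast h)
  -- stabilization
  have hstab : ∀ n, ∃ M : ℕ, ∀ M' ≥ M, FI J (M' : ℝ) ⊔ m ^ n = FI J (M : ℝ) ⊔ m ^ n := by
    intro n
    have hart : IsArtinianRing (R ⧸ m ^ n) := artin_quot _ n le_rfl
    let f : ℕ →o (Ideal (R ⧸ m ^ n))ᵒᵈ := ⟨fun M => OrderDual.toDual ((FI J (M:ℝ)).map (Ideal.Quotient.mk (m ^ n))),
      fun a b hab => OrderDual.toDual_le_toDual.2 (Ideal.map_mono (hanti hab))⟩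
    obtain ⟨M, hM⟩ := IsArtinian.monotone_stabilizes f
    refine ⟨M, fun M' hM' => ?_⟩
    have h1 : (FI J (M:ℝ)).map (Ideal.Quotient.mk (m ^ n)) = (FI J (M':ℝ)).map (Ideal.Quotient.mk (m ^ n)) :=
      hM M' hM'
    have h2 := congrArg (Ideal.comap (Ideal.Quotient.mk (m ^ n))) h1
    rw [Ideal.comap_map_of_surjective _ Ideal.Quotient.mk_surjective,
      Ideal.comap_map_of_surjective _ Ideal.Quotient.mk_surjective, ← RingHom.ker_eq_comap_bot, Ideal.mk_ker] at h2
    exact h2.symm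
  choose Ms hMs using hstab
  let 𝔰 : ℕ → Ideal R := fun n => FI J (Ms n : ℝ) ⊔ m ^ n
  have hsle : ∀ n M : ℕ, 𝔰 n ≤ FI J (M:ℝ) ⊔ m ^ n := by
    intro n M
    have := hMs n (max M (Ms n)) (le_max_right _ _)
    change FI J (Ms n : ℝ) ⊔ m ^ n ≤ _
    rw [← this]
    exact sup_le_sup_right (hanti (le_max_left _ _)) _
  have hsucc : ∀ n, ∀ z ∈ 𝔰 n, ∃ z' ∈ 𝔰 (n + 1), z' - z ∈ m ^ n := by
    intro n z hz
    have h1 := hsle n (Ms (n+1)) hz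
    obtain ⟨g, hg, e, he, rfl⟩ := Submodule.mem_sup.1 h1
    exact ⟨g, Ideal.mem_sup_left hg, by simpa using he⟩
  have hstart : ∃ z ∈ 𝔰 n0, z ∉ m ^ n0 := by
    obtain ⟨z, hz, hz'⟩ := Set.not_subset.1 (hcon (Ms n0))
    exact ⟨z, Ideal.mem_sup_left hz, hz'⟩
  obtain ⟨z0, hz0, hz0'⟩ := hstart
  choose! nx hnx1 hnx2 using hsucc
  let ys : ℕ → R := fun k => Nat.rec z0 (fun k y => nx (n0 + k) y) k
  have hys : ∀ k, ys k ∈ 𝔰 (n0 + k) := by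
    intro k
    induction k with
    | zero => exact hz0
    | succ k ih => exact hnx1 _ _ ih
  have hyd : ∀ k, ys (k+1) - ys k ∈ m ^ (n0 + k) := fun k => hnx2 _ _ (hys k)
  have hyd' : ∀ k i, ys (k + i) - ys k ∈ m ^ (n0 + k) := by
    intro k i
    induction i with
    | zero => simp
    | succ i ih =>
      have := add_mem (Ideal.pow_le_pow_right (by omega) (hyd (k+i))) ih
      rwa [sub_add_sub_cancel] at this
  let Rh := AdicCompletion m R
  let ι : R →+* Rh := algebraMap R Rh
  let Mh : Ideal Rh := maximalIdeal Rh
  have hMh : m.map ι = Mh := AdicCompletion.maximalIdeal_eq_map.symm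
  have hιM : ∀ n r, r ∈ m ^ n → ι r ∈ Mh ^ n := fun n r hr => by
    rw [← hMh, ← Ideal.map_pow]; exact Ideal.mem_map_of_mem ι hr
  obtain ⟨z, hz⟩ := IsPrecomplete.prec' (I := Mh) (M := Rh) (fun k => ι (ys k)) (by
      intro k n hkn
      rw [SModEq.sub_mem, smul_eq_mul, Ideal.mul_top, ← neg_sub, ← map_sub]
      refine neg_mem (hιM _ _ ?_)
      obtain ⟨i, rfl⟩ := Nat.exists_eq_add_of_le hkn
      exact Ideal.pow_le_pow_right (by omega) (hyd' k i))
  have hz' : ∀ k, ι (ys k) - z ∈ Mh ^ k := by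
    intro k
    have := hz k
    rwa [SModEq.sub_mem, smul_eq_mul, Ideal.mul_top] at this
  have hznz : z ≠ 0 := by
    rintro rfl
    apply hz0'
    have h1 := hz' n0
    rw [sub_zero] at h1
    have h2 := completion_comap R n0 _ h1
    have h3 := hyd' 0 n0
    rw [zero_add, add_zero] at h3
    have h4 := sub_mem h2 h3
    simpa [ys] using h4
  apply hznz
  have hJh : J.map ι ≠ ⊤ := by
    intro h
    have : (⊤ : Ideal Rh) ≤ Mh := by rw [← h, ← hMh]; exact Ideal.map_mono hJ
    exact (maximalIdeal.isMaximal Rh).ne_top (top_le_iff.1 this)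
  haveI : IsReduced Rh := hAU
  apply IsReduced.eq_zero
  apply AP.nilpotent_of_all hJh
  intro n
  have hMJ : Mh ^ (c * n) ≤ FI (J.map ι) n := by
    refine le_trans ?_ (pow_le_FI n)
    rw [pow_mul]
    refine Ideal.pow_right_mono ?_ n
    rw [← hMh, ← Ideal.map_pow]
    exact Ideal.map_mono hc
  have h1 := hsle _ n (hys (c * n))
  obtain ⟨g, hg, e, he, hge⟩ := Submodule.mem_sup.1 h1
  have h2 := hz' (c * n)
  rw [← hge, map_add] at h2
  have h3 : ι g ∈ FI (J.map ι) n := AP.map ι hg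
  have h4 : ι e ∈ FI (J.map ι) n := hMJ (hιM _ _ (Ideal.pow_le_pow_right (by omega) he))
  have h5 := sub_mem (add_mem h3 h4) (hMJ h2)
  rw [sub_sub_cancel] at h5
  exact h5

end A7

section A8

/-- Length of the quotient by an ideal. -/
noncomputable def qlen {A : Type*} [CommRing A] (K : Ideal A) : ℕ∞ := Module.length A (A ⧸ K)

lemma len_mul {A : Type*} [CommRing A] (K : Ideal A) (a b : A) :
    qlen (K ⊔ Ideal.span {a * b}) ≤
      qlen (K ⊔ Ideal.span {b}) + qlen (K ⊔ Ideal.span {a}) := by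
  have h1 : K ⊔ Ideal.span {b} ≤ Submodule.comap (LinearMap.mulLeft A a) (K ⊔ Ideal.span {a * b}) := by
    refine sup_le (fun x hx => ?_) ?_
    · exact Ideal.mem_sup_left (Ideal.mul_mem_left _ _ hx)
    · rw [Ideal.span_le, Set.singleton_subset_iff]
      exact Ideal.mem_sup_right (Ideal.mem_span_singleton_self _)
  have h2 : K ⊔ Ideal.span {a * b} ≤ K ⊔ Ideal.span {a} := by
    refine sup_le le_sup_left (le_sup_of_le_right ?_)
    rw [Ideal.span_le, Set.singleton_subset_iff]
    exact Ideal.mul_mem_right _ _ (Ideal.mem_span_singleton_self _)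
  let f : (A ⧸ (K ⊔ Ideal.span {b})) →ₗ[A] (A ⧸ (K ⊔ Ideal.span {a * b})) :=
    Submodule.mapQ _ _ (LinearMap.mulLeft A a) h1
  let g : (A ⧸ (K ⊔ Ideal.span {a * b})) →ₗ[A] (A ⧸ (K ⊔ Ideal.span {a})) := Submodule.factor h2
  have hex : Function.Exact (LinearMap.range f).subtype g := by
    intro x
    obtain ⟨x, rfl⟩ := Submodule.Quotient.mk_surjective _ x
    constructor
    · intro hx
      have hx' : x ∈ K ⊔ Ideal.span {a} := (Submodule.Quotient.mk_eq_zero _).1 hx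
      obtain ⟨k, hk, z, hz, rfl⟩ := Submodule.mem_sup.1 hx'
      obtain ⟨t, rfl⟩ := Ideal.mem_span_singleton'.1 hz
      refine ⟨⟨_, ⟨Submodule.Quotient.mk t, rfl⟩⟩, ?_⟩
      change Submodule.Quotient.mk (a * t) = _
      rw [Submodule.Quotient.eq]
      refine Ideal.mem_sup_left ?_
      convert neg_mem hk using 1
      ring
    · rintro ⟨⟨_, ⟨t, rfl⟩⟩, ht⟩
      rw [← ht]
      obtain ⟨t, rfl⟩ := Submodule.Quotient.mk_surjective _ t
      change Submodule.Quotient.mk (a * t) = _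
      refine (Submodule.Quotient.mk_eq_zero _).2 ?_
      exact Ideal.mem_sup_right (Ideal.mul_mem_right _ _ (Ideal.mem_span_singleton_self _))
  unfold qlen
  rw [Module.length_eq_add_of_exact _ g (Submodule.injective_subtype _) (Submodule.factor_surjective h2) hex]
  gcongr
  exact Module.length_le_of_surjective f.rangeRestrict f.surjective_rangeRestrict

lemma len_pow {A : Type*} [CommRing A] (K : Ideal A) (a : A) (n : ℕ) :
    qlen (K ⊔ Ideal.span {a ^ n}) ≤ n * qlen (K ⊔ Ideal.span {a}) := by
  induction n with
  | zero =>
    have : Subsingleton (A ⧸ (K ⊔ Ideal.span {a ^ 0})) := by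
      apply Ideal.Quotient.subsingleton_iff.2
      rw [pow_zero, Ideal.span_singleton_one, sup_top_eq]
    unfold qlen
    rw [Module.length_eq_zero]
    simp
  | succ n ih =>
    rw [pow_succ]
    refine (len_mul K (a ^ n) a).trans ?_
    push_cast
    rw [add_mul, one_mul, add_comm]
    gcongr

lemma len_pows {A : Type*} [CommRing A] {ι : Type*} (y : ι → A) (n : ℕ) (s : Finset ι) (K : Ideal A) :
    qlen (K ⊔ Ideal.span ((fun i => y i ^ n) '' s)) ≤
      n ^ s.card * qlen (K ⊔ Ideal.span (y '' s)) := by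
  classical
  induction s using Finset.induction_on generalizing K with
  | empty => simp
  | insert a s ha ih =>
    rw [Finset.coe_insert, Set.image_insert_eq, Set.image_insert_eq, Ideal.span_insert, Ideal.span_insert,
      ← sup_assoc, ← sup_assoc, Finset.card_insert_of_notMem ha, pow_succ, mul_assoc]
    refine (ih (K ⊔ Ideal.span {y a ^ n})).trans ?_
    gcongr
    have h := len_pow (K ⊔ Ideal.span (y '' s)) (y a) n
    rw [sup_right_comm K (Ideal.span (y '' s)) (Ideal.span {y a ^ n}),
      sup_right_comm K (Ideal.span (y '' s)) (Ideal.span {y a})] at h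
    exact h

lemma len_J_pow {A : Type*} [CommRing A] {d : ℕ} (y : Fin d → A) (n : ℕ) :
    qlen (Ideal.span (Set.range y) ^ n) ≤
      n ^ d * qlen (Ideal.span (Set.range y)) := by
  have h := len_pows y n Finset.univ ⊥
  simp only [Finset.coe_univ, Set.image_univ, bot_sup_eq, Finset.card_univ, Fintype.card_fin] at h
  refine le_trans ?_ h
  have hle : Ideal.span (Set.range fun i => y i ^ n) ≤ Ideal.span (Set.range y) ^ n := by
    rw [Ideal.span_le]
    rintro _ ⟨i, rfl⟩
    exact Ideal.pow_mem_pow (Ideal.subset_span (Set.mem_range_self i)) n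
  exact Module.length_le_of_surjective (Submodule.factor hle) (Submodule.factor_surjective hle)

lemma chain_count {A : Type*} [CommRing A] {ι : Type*} [DecidableEq ι] (F : Ideal A) (v : ι → A) (val : ι → ℝ)
    (h : ∀ (T : Finset ι) (i : ι), i ∉ T → (∀ j ∈ T, val i ≤ val j) → v i ∉ F ⊔ Ideal.span (v '' T))
    (S : Finset ι) : (S.card : ℕ∞) ≤ qlen F := by
  have key : (S.card : ℕ∞) + Order.coheight (F ⊔ Ideal.span (v '' S)) ≤ Order.coheight F := by
    induction S using Finset.induction_on_min_value val with
    | empty => simp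
    | insert a s ha hmin ih =>
      rw [Finset.card_insert_of_notMem ha]
      refine le_trans ?_ ih
      push_cast
      rw [add_assoc]
      gcongr
      rw [add_comm]
      apply Order.coheight_add_one_le
      refine lt_of_le_of_ne (sup_le_sup_left (Ideal.span_mono (Set.image_mono (by simp))) _) ?_
      intro heq
      apply h s a ha hmin
      rw [heq]
      exact Ideal.mem_sup_right (Ideal.subset_span ⟨a, by simp, rfl⟩)
  have := Module.length_quotient (R := A) (N := F)
  unfold qlen
  rw [this]
  exact le_trans le_self_add key

lemma exists_gap (c0 : ℝ) (S : Finset ℝ) : ∃ c' > c0, ∀ x ∈ S, c0 < x → c' ≤ x := by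
  classical
  induction S using Finset.induction_on with
  | empty => exact ⟨c0 + 1, by simp, by simp⟩
  | insert a s ha ih =>
    obtain ⟨c', h1, h2⟩ := ih
    by_cases hac : c0 < a
    · refine ⟨min c' a, lt_min h1 hac, fun x hx hxc => ?_⟩
      rcases Finset.mem_insert.1 hx with rfl | hx
      · exact min_le_right _ _
      · exact (min_le_left _ _).trans (h2 x hx hxc)
    · refine ⟨c', h1, fun x hx hxc => ?_⟩
      rcases Finset.mem_insert.1 hx with rfl | hx
      · exact absurd hxc hac
      · exact h2 x hx hxc

/-- Independence of leading forms. -/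
def LInd {A : Type*} [CommRing A] {d : ℕ} (y : Fin d → A) {r : ℕ} (g : Fin r → A) (s : Fin r → ℝ) : Prop :=
  ∀ (c c' : ℝ) (f : Fin r → MvPolynomial (Fin d) A),
    (∀ i, ∀ m ∈ (f i).support, (m.degree : ℝ) + s i = c) → c < c' →
    AP (Ideal.span (Set.range y)) (∑ i, MvPolynomial.eval y (f i) * g i) c' →
    ∀ i m, ¬ IsUnit ((f i).coeff m)

lemma count_bound {A : Type*} [CommRing A] [IsLocalRing A] [IsNoetherianRing A] {d : ℕ} {y : Fin d → A}
    (hy : QSetup y) : ∃ B : ℕ, ∀ (r : ℕ) (g : Fin r → A) (s : Fin r → ℝ),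
      (∀ i, AP (Ideal.span (Set.range y)) (g i) (s i)) → LInd y g s → r ≤ B := by
  classical
  set J := Ideal.span (Set.range y) with hJ
  obtain ⟨c, hc⟩ := hy.prim
  have : IsArtinianRing (A ⧸ J) := artin_quot J c hc
  have hnt : qlen J ≠ ⊤ := by
    unfold qlen
    rw [Module.length_eq_of_surjective (R := A ⧸ J) (S := A) Ideal.Quotient.mk_surjective]
    exact Module.length_ne_top
  obtain ⟨e, he⟩ := ENat.ne_top_iff_exists.1 hnt
  refine ⟨(d+1)^d * e, fun r g s hgs hind => ?_⟩
  obtain ⟨L, hL⟩ : ∃ L : ℕ, 1 ≤ L ∧ ∀ i, s i < L := by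
    have : ∀ i, ∃ n : ℕ, s i < n := fun i => exists_nat_gt _
    choose n hn using this
    refine ⟨∑ i, n i + 1, by omega, fun i => (hn i).trans_le ?_⟩
    have := Finset.single_le_sum (f := n) (fun i _ => Nat.zero_le _) (Finset.mem_univ i)
    exact_mod_cast this.trans (Nat.le_succ _)
  obtain ⟨hL1, hL2⟩ := hL
  set n := (d + 1) * L with hn
  let fe : (Fin d → Fin L) → (Fin d →₀ ℕ) := fun α => Finsupp.equivFunOnFinite.symm fun i => (α i : ℕ)
  have fe_inj : Function.Injective fe := by
    intro α β h
    funext i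
    have := DFunLike.congr_fun h i
    exact Fin.ext this
  have fe_deg : ∀ α, (fe α).degree ≤ d * L := by
    intro α
    rw [Finsupp.degree_eq_sum]
    refine (Finset.sum_le_card_nsmul _ _ L fun i _ => (α i).2.le).trans ?_
    simp
  let ev : (Fin d →₀ ℕ) → A := fun m => MvPolynomial.eval y (MvPolynomial.monomial m 1)
  have ev_mem : ∀ m, ev m ∈ J ^ m.degree := fun m =>
    eval_form_mem' y _ _ (MvPolynomial.isHomogeneous_monomial 1 rfl)
  let v : Fin r × (Fin d → Fin L) → A := fun p => ev (fe p.2) * g p.1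
  let val : Fin r × (Fin d → Fin L) → ℝ := fun p => (fe p.2).degree + s p.1
  have hv : ∀ p, AP J (v p) (val p) := fun p => (pow_le_FI _ (ev_mem _) : AP J _ _).mul (hgs p.1)
  have hvn : ∀ p, val p < n := by
    intro p
    have h1 := fe_deg p.2
    have h2 := hL2 p.1
    have h3 : ((fe p.2).degree : ℝ) ≤ d * L := by exact_mod_cast h1
    simp only [val, hn]
    push_cast
    linarith
  have hch := chain_count (FI J (n:ℝ)) v val (by
    intro T p hp hmin hmem
    obtain ⟨w, hw, z, hz, hwz⟩ := Submodule.mem_sup.1 hmem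
    obtain ⟨a, ha⟩ := (Submodule.mem_span_image_finset_iff_exists_fun' A).1 hz
    obtain ⟨c', hc1, hc2⟩ := exists_gap (val p) (insert (n:ℝ) (T.image val))
    let f : Fin r → MvPolynomial (Fin d) A := fun i =>
      (if i = p.1 then MvPolynomial.monomial (fe p.2) 1 else 0) -
        ∑ t ∈ T with (t.1 = i ∧ val t = val p), MvPolynomial.monomial (fe t.2) (a t)
    have hsum : ∑ i, MvPolynomial.eval y (f i) * g i =
        v p - ∑ t ∈ T with val t = val p, a t * v t := by
      simp only [f, map_sub, sub_mul, Finset.sum_sub_distrib]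
      congr 1
      · rw [Finset.sum_eq_single p.1]
        · simp [v, ev]
        · intro b _ hb; simp [hb]
        · simp
      · simp only [map_sum, Finset.sum_mul]
        rw [← Finset.sum_fiberwise (s := T.filter (fun t => val t = val p)) (g := fun t => t.1)]
        refine Finset.sum_congr rfl fun i _ => ?_
        rw [Finset.filter_filter]
        refine Finset.sum_congr (by ext t; simp only [Finset.mem_filter]; tauto) fun t ht => ?_
        simp only [Finset.mem_filter] at ht
        have : MvPolynomial.monomial (fe t.2) (a t) = MvPolynomial.C (a t) * MvPolynomial.monomial (fe t.2) 1 := by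
          rw [MvPolynomial.C_mul_monomial, mul_one]
        have hti : t.1 = i := by tauto
        rw [this, map_mul, MvPolynomial.eval_C, ← hti, mul_assoc]
    refine hind (val p) c' f ?_ hc1 ?_ p.1 (fe p.2) ?_
    · intro i m hm
      by_contra hne
      apply MvPolynomial.mem_support_iff.1 hm
      simp only [f, MvPolynomial.coeff_sub, MvPolynomial.coeff_sum, MvPolynomial.coeff_monomial]
      rw [Finset.sum_eq_zero, sub_zero]
      · split_ifs with hi
        · subst hi
          rw [MvPolynomial.coeff_monomial, if_neg]
          rintro rfl
          exact hne rfl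
        · simp
      · intro t ht
        simp only [Finset.mem_filter] at ht
        rw [if_neg]
        rintro rfl
        apply hne
        rw [← ht.2.2, ← ht.2.1]
    · rw [hsum]
      have : v p - ∑ t ∈ T with val t = val p, a t * v t = w + ∑ t ∈ T with ¬ val t = val p, a t * v t := by
        rw [← hwz, ← ha, ← Finset.sum_filter_add_sum_filter_not T (fun t => val t = val p)]
        simp only [smul_eq_mul]
        ring
      rw [this]
      have hwc : w ∈ FI J c' := FI_anti (hc2 _ (Finset.mem_insert_self _ _) (hvn p)) hw
      refine mem_FI.1 (add_mem hwc (Ideal.sum_mem _ fun t ht => Ideal.mul_mem_left _ _ ?_))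
      simp only [Finset.mem_filter] at ht
      refine (hv t).mono (hc2 _ (Finset.mem_insert_of_mem (Finset.mem_image_of_mem _ ht.1)) ?_)
      exact lt_of_le_of_ne (hmin t ht.1) (Ne.symm ht.2)
    · have : (f p.1).coeff (fe p.2) = 1 := by
        simp only [f, if_true, MvPolynomial.coeff_sub, MvPolynomial.coeff_sum, MvPolynomial.coeff_monomial]
        rw [Finset.sum_eq_zero, sub_zero]
        intro t ht
        simp only [Finset.mem_filter] at ht
        rw [if_neg]
        intro h
        apply hp
        have : t = p := Prod.ext ht.2.1 (fe_inj h)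
        rw [← this]; exact ht.1
      rw [this]
      exact isUnit_one) Finset.univ
  have hle : J ^ n ≤ FI J (n:ℝ) := pow_le_FI n
  have h2 := Module.length_le_of_surjective (Submodule.factor hle) (Submodule.factor_surjective hle)
  have h3 := hch.trans (h2.trans (len_J_pow y n))
  rw [← hJ, ← he] at h3
  have h4 : r * L ^ d ≤ n ^ d * e := by
    have : (Finset.univ : Finset (Fin r × (Fin d → Fin L))).card = r * L ^ d := by
      simp
    rw [this] at h3
    exact_mod_cast h3
  rw [hn, mul_pow, mul_right_comm] at h4
  exact Nat.le_of_mul_le_mul_right h4 (by positivity)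

lemma exists_vb {A : Type*} [CommRing A] {J : Ideal A} {x : A} {M : ℝ} (hM : ¬ AP J x M) :
    ∃ q, 0 ≤ q ∧ AP J x q ∧ ∀ q' > q, ¬ AP J x q' := by
  have hb : ∀ q, AP J x q → q ≤ M := fun q hq => by
    by_contra h
    push Not at h
    exact hM (hq.mono h.le)
  have h0 : AP J x 0 := by
    have : x ∈ FI J (0:ℝ) := by rw [FI_nonpos le_rfl]; trivial
    exact this
  have hbdd : BddAbove {q | AP J x q} := ⟨M, fun q hq => hb q hq⟩
  refine ⟨sSup {q | AP J x q}, le_csSup hbdd h0, AP.of_lt fun q' hq' => ?_, fun q' hq' h => ?_⟩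
  · obtain ⟨b, hb1, hb2⟩ := exists_lt_of_lt_csSup ⟨0, h0⟩ hq'
    exact AP.mono hb1 hb2.le
  · exact absurd (le_csSup hbdd h) (not_le.2 hq')

lemma rational_vb {A : Type*} [CommRing A] [IsLocalRing A] [IsNoetherianRing A] {d : ℕ} {y : Fin d → A}
    (hy : QSetup y) (B : ℕ) (hB : ∀ (r : ℕ) (g : Fin r → A) (s : Fin r → ℝ),
      (∀ i, AP (Ideal.span (Set.range y)) (g i) (s i)) → LInd y g s → r ≤ B)
    (x : A) (q : ℝ) (hq0 : 0 ≤ q) (hq : AP (Ideal.span (Set.range y)) x q)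
    (hq' : ∀ q' > q, ¬ AP (Ideal.span (Set.range y)) x q') : ∃ k : ℕ, q * (B.factorial : ℝ) = k := by
  classical
  set J := Ideal.span (Set.range y) with hJ
  have hJT : J ≠ ⊤ := fun h => (maximalIdeal.isMaximal A).ne_top (top_le_iff.1 (h ▸ hy.le))
  let g : Fin (B+1) → A := fun i => x ^ (i:ℕ)
  let s : Fin (B+1) → ℝ := fun i => (i:ℕ) * q
  have hgs : ∀ i, AP J (g i) (s i) := by
    intro i
    rcases Nat.eq_zero_or_pos (i:ℕ) with h | h
    · simp only [g, s, h]
      have : (1:A) ∈ FI J (0:ℝ) := by rw [FI_nonpos le_rfl]; trivial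
      rw [Nat.cast_zero, zero_mul, pow_zero]
      exact this
    · exact hq.pow h
  have hnot : ¬ LInd y g s := fun h => by
    have := hB _ g s hgs h
    omega
  unfold LInd at hnot
  push Not at hnot
  obtain ⟨c, c', f, hf, hcc, hAP, i0, m0, hu⟩ := hnot
  have hm0 : m0 ∈ (f i0).support := MvPolynomial.mem_support_iff.2 hu.ne_zero
  have hi0 := hf i0 m0 hm0
  have hex : ∃ j ≠ i0, f j ≠ 0 := by
    by_contra hcon
    push Not at hcon
    rw [Finset.sum_eq_single i0 (fun j _ hj => by rw [hcon j hj]; simp) (by simp)] at hAP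
    have hhom : (f i0).IsHomogeneous m0.degree := by
      rw [MvPolynomial.IsHomogeneous, MvPolynomial.IsWeightedHomogeneous]
      intro m hm
      have := hf i0 m (MvPolynomial.mem_support_iff.2 hm)
      have h2 : m.degree = m0.degree := by
        have : (m.degree : ℝ) = m0.degree := by linarith
        exact_mod_cast this
      rw [← h2, Finsupp.degree_eq_weight_one]
      rfl
    have h1 : AP J (g i0) (c' - m0.degree) :=
      hy.AP_cancel hhom ⟨m0, hu⟩ (by convert hAP using 1; ring)
    rcases Nat.eq_zero_or_pos (i0:ℕ) with h | h
    · simp only [g, h, pow_zero] at h1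
      have := h1.one_nonpos hJT
      simp only [s, h] at hi0
      simp at hi0
      linarith
    · have h' : (0:ℝ) < (i0:ℕ) := by exact_mod_cast h
      have h2 : AP J x ((c' - m0.degree) / (i0:ℕ)) := by
        refine AP.of_pow h ?_
        convert h1 using 1
        field_simp
      refine hq' _ ?_ h2
      rw [gt_iff_lt, lt_div_iff₀ h']
      simp only [s] at hi0
      linarith
  obtain ⟨j, hj, hfj⟩ := hex
  obtain ⟨mj, hmj⟩ := MvPolynomial.ne_zero_iff.1 hfj
  have hj' := hf j mj (MvPolynomial.mem_support_iff.2 hmj)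
  simp only [s] at hi0 hj'
  have hkey : ∀ a b : Fin (B+1), (a:ℕ) < b → ∀ u w : ℕ, (u:ℝ) + (a:ℕ) * q = w + (b:ℕ) * q →
      ∃ k : ℕ, q * (B.factorial : ℝ) = k := by
    intro a b hab u w h
    have hdvd : (b:ℕ) - a ∣ B.factorial := Nat.dvd_factorial (by omega) (by omega)
    obtain ⟨t, ht⟩ := hdvd
    have hba : (((b:ℕ) - (a:ℕ) : ℕ) : ℝ) = (b:ℕ) - (a:ℕ) := by push_cast [Nat.cast_sub hab.le]; rfl
    have h1 : q * (((b:ℕ) - (a:ℕ) : ℕ) : ℝ) = u - w := by rw [hba]; linarith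
    have hwu : w ≤ u := by
      have : (0:ℝ) ≤ u - w := by rw [← h1]; positivity
      have : (w:ℝ) ≤ u := by linarith
      exact_mod_cast this
    refine ⟨(u - w) * t, ?_⟩
    rw [ht]
    push_cast [Nat.cast_sub hwu]
    rw [← h1]
    ring
  rcases lt_or_gt_of_ne (fun h => hj (Fin.ext h) : (j:ℕ) ≠ i0) with h | h
  · exact hkey j i0 h _ _ (by rw [hj', hi0])
  · exact hkey i0 j h _ _ (by rw [hj', hi0])

end A8

section A9

lemma n2_aux {k : Type*} [Field k] {d : ℕ} {K Ω : Type*} [Field K] [Field Ω]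
    [Algebra (MvPolynomial (Fin d) k) K] [IsFractionRing (MvPolynomial (Fin d) k) K]
    [Algebra K Ω] [Algebra (MvPolynomial (Fin d) k) Ω] [IsScalarTower (MvPolynomial (Fin d) k) K Ω]
    [Algebra k Ω] [IsScalarTower k (MvPolynomial (Fin d) k) Ω] [IsAlgClosed Ω] [Algebra.IsAlgebraic K Ω]
    (S : Finset Ω) :
    ∃ A' : Subalgebra (MvPolynomial (Fin d) k) Ω, Module.Finite (MvPolynomial (Fin d) k) A' ∧
      IsIntegrallyClosed A' ∧
      ∀ x ∈ S, ∃ f : Polynomial Ω, f.Separable ∧ f.eval x = 0 ∧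
        ∀ i, ∃ a ∈ A', ∃ b ∈ A', b ≠ 0 ∧ f.coeff i * b = a := by
  classical
  set A := MvPolynomial (Fin d) k with hA
  have hinj : Function.Injective (algebraMap A Ω) := by
    rw [IsScalarTower.algebraMap_eq A K Ω]
    exact (algebraMap K Ω).injective.comp (IsFractionRing.injective A K)
  let p := ringExpChar K
  have hpK : ExpChar K p := inferInstance
  have hpΩ : ExpChar Ω p := expChar_of_injective_algebraMap (algebraMap K Ω).injective p
  have hpk : ExpChar k p := by
    have h1 : ExpChar k (ringExpChar k) := inferInstance
    have h2 : ExpChar Ω (ringExpChar k) :=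
      expChar_of_injective_algebraMap (algebraMap k Ω).injective (ringExpChar k)
    rw [ExpChar.eq hpΩ h2]
    exact h1
  have hp0 : 0 < p := expChar_pos K p
  let P := perfectClosure K Ω
  have hsepP : Algebra.IsSeparable P Ω := inferInstance
  -- polynomials
  let fx : Ω → Polynomial Ω := fun x => (minpoly P x).map (algebraMap P Ω)
  let Cs : Finset Ω := S.biUnion fun x => (fx x).coeffs
  have hCs : ∀ c ∈ Cs, ∃ n, c ^ p ^ n ∈ (algebraMap K Ω).range := by
    intro c hc
    obtain ⟨x, hx, hcx⟩ := Finset.mem_biUnion.1 hc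
    obtain ⟨i, -, rfl⟩ := Polynomial.mem_coeffs_iff.1 hcx
    rw [Polynomial.coeff_map]
    exact (mem_perfectClosure_iff_pow_mem p).1 ((minpoly P x).coeff i).2
  choose! nn hnn using hCs
  let n := ∑ c ∈ Cs, nn c
  have hCn : ∀ c ∈ Cs, ∃ z : K, algebraMap K Ω z = c ^ p ^ n := by
    intro c hc
    obtain ⟨z, hz⟩ := hnn c hc
    have hle : nn c ≤ n := Finset.single_le_sum (f := nn) (fun i _ => Nat.zero_le _) hc
    refine ⟨z ^ p ^ (n - nn c), ?_⟩
    rw [map_pow, hz, ← pow_mul, ← pow_add, Nat.add_sub_cancel' hle]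
  set q := p ^ n with hq
  have hq0 : 0 < q := by positivity
  have hCab : ∀ c ∈ Cs, ∃ a b : A, b ≠ 0 ∧ c ^ q * algebraMap A Ω b = algebraMap A Ω a := by
    intro c hc
    obtain ⟨z, hz⟩ := hCn c hc
    obtain ⟨a, b, hb, rfl⟩ := IsFractionRing.div_surjective (A := A) z
    refine ⟨a, b, nonZeroDivisors.ne_zero hb, ?_⟩
    rw [← hz, IsScalarTower.algebraMap_apply A K Ω, IsScalarTower.algebraMap_apply A K Ω, ← map_mul]
    congr 1
    refine div_mul_cancel₀ _ ?_
    exact IsFractionRing.to_map_ne_zero_of_mem_nonZeroDivisors hb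
  choose! ca cb hcb hcab using hCab
  -- roots
  have hroot : ∀ z : Ω, ∃ w, w ^ q = z := fun z => IsAlgClosed.exists_pow_nat_eq z hq0
  choose rt hrt using hroot
  let ρ : k → Ω := fun w => rt (algebraMap k Ω w)
  let t : Fin d → Ω := fun i => rt (algebraMap A Ω (MvPolynomial.X i))
  have ht : ∀ i, t i ^ q = algebraMap A Ω (MvPolynomial.X i) := fun i => hrt _
  let W : Finset k := Cs.biUnion fun c => (ca c).support.image (ca c).coeff ∪ (cb c).support.image (cb c).coeff
  let Sρ : Set Ω := ρ '' W
  have hSfin : Sρ.Finite := W.finite_toSet.image ρ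
  have hρalg : ∀ x ∈ Sρ, IsIntegral k x := by
    rintro _ ⟨w, -, rfl⟩
    refine IsIntegral.of_pow hq0 ?_
    rw [hrt]
    exact isIntegral_algebraMap
  let k' : IntermediateField k Ω := IntermediateField.adjoin k Sρ
  have hk'alg : Algebra.IsAlgebraic k k' := IntermediateField.isAlgebraic_adjoin hρalg
  -- algebraic independence
  let Fr : Ω →+* Ω := iterateFrobenius Ω p n
  have hFr : ∀ z, Fr z = z ^ q := fun z => iterateFrobenius_def p n z
  have hti : AlgebraicIndependent k t := by
    rw [algebraicIndependent_iff]
    intro g hg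
    let Fk : k →+* k := iterateFrobenius k p n
    have h1 : Fr (MvPolynomial.aeval t g) = algebraMap A Ω (MvPolynomial.map Fk g) := by
      have h2 : ∀ g : A, algebraMap A Ω g = MvPolynomial.eval₂ (algebraMap k Ω) (fun i => algebraMap A Ω (MvPolynomial.X i)) g := by
        intro g
        have : (IsScalarTower.toAlgHom k A Ω) = MvPolynomial.aeval (fun i => algebraMap A Ω (MvPolynomial.X i)) :=
          MvPolynomial.algHom_ext (by intro i; rw [MvPolynomial.aeval_X]; rfl)
        exact DFunLike.congr_fun this g
      rw [MvPolynomial.aeval_def, MvPolynomial.eval₂_comp_left, h2, MvPolynomial.eval₂_map]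
      congr 1
      · ext w
        rw [RingHom.comp_apply, RingHom.comp_apply, hFr, iterateFrobenius_def, map_pow]
      · funext i
        simp [hFr, ht]
    rw [hg, map_zero] at h1
    have h3 : MvPolynomial.map Fk g = 0 := hinj (by rw [← h1, map_zero])
    exact (MvPolynomial.map_injective Fk Fk.injective) (by rw [h3, map_zero])
  have hti' : AlgebraicIndependent k' t := hti.extendScalars k'
  let φ : MvPolynomial (Fin d) k' →ₐ[k'] Ω := MvPolynomial.aeval t
  have hφ : Function.Injective φ := hti'
  have hkmem : ∀ w : k, algebraMap k Ω w ∈ φ.range := fun w =>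
    ⟨MvPolynomial.C (algebraMap k k' w), by simp [φ]⟩
  have htmem : ∀ i, t i ∈ φ.range := fun i => ⟨MvPolynomial.X i, by simp [φ]⟩
  let A' : Subalgebra A Ω :=
    { φ.range.toSubsemiring with
      algebraMap_mem' := by
        intro g
        change algebraMap A Ω g ∈ φ.range
        induction g using MvPolynomial.induction_on with
        | C w =>
          have : algebraMap A Ω (MvPolynomial.C w) = algebraMap k Ω w := (IsScalarTower.algebraMap_apply k A Ω w).symm
          rw [this]; exact hkmem w
        | add a b ha hb => rw [map_add]; exact add_mem ha hb
        | mul_X a i ha => rw [map_mul, ← ht]; exact mul_mem ha (pow_mem (htmem i) _) }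
  have hA'mem : ∀ z, z ∈ A' ↔ z ∈ φ.range := fun z => Iff.rfl
  refine ⟨A', ?_, ?_, ?_⟩
  · let D : Subalgebra A Ω := Algebra.adjoin A (Sρ ∪ Set.range t)
    have hDfin : D.toSubmodule.FG := by
      refine fg_adjoin_of_finite (hSfin.union (Set.finite_range t)) ?_
      rintro x (hx | ⟨i, rfl⟩)
      · exact (hρalg x hx).tower_top
      · refine IsIntegral.of_pow hq0 ?_
        rw [ht]
        exact isIntegral_algebraMap
    have hle : A'.toSubmodule ≤ D.toSubmodule := by
      rintro _ ⟨g, rfl⟩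
      change φ g ∈ D
      have hk'D : ∀ w : k', (w : Ω) ∈ D := by
        intro w
        have h1 : (w : Ω) ∈ Algebra.adjoin k Sρ := by
          rw [← IntermediateField.adjoin_toSubalgebra_of_isAlgebraic (fun x hx => (hρalg x hx).isAlgebraic)]
          exact w.2
        have h2 : Algebra.adjoin k Sρ ≤ D.restrictScalars k :=
          Algebra.adjoin_le fun x hx => Algebra.subset_adjoin (Or.inl hx)
        exact h2 h1
      induction g using MvPolynomial.induction_on with
      | C w => rw [MvPolynomial.algHom_C]; exact hk'D w
      | add a b ha hb => rw [map_add]; exact add_mem ha hb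
      | mul_X a i ha =>
        rw [map_mul, MvPolynomial.aeval_X]
        exact mul_mem ha (Algebra.subset_adjoin (Or.inr ⟨i, rfl⟩))
    have : IsNoetherian A D.toSubmodule := isNoetherian_of_fg_of_noetherian _ hDfin
    have hfg : A'.toSubmodule.FG := by
      have := isNoetherian_of_le hle
      exact (Submodule.fg_top _).1 (IsNoetherian.noetherian ⊤)
    exact Module.Finite.iff_fg.2 hfg
  · let e : MvPolynomial (Fin d) k' ≃+* A' := 
      RingEquiv.ofBijective (φ.toRingHom.codRestrict A' (fun x => ⟨x, rfl⟩))
        ⟨fun a b h => hφ (congrArg Subtype.val h), by rintro ⟨_, ⟨x, rfl⟩⟩; exact ⟨x, rfl⟩⟩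
    exact IsIntegrallyClosed.of_equiv e
  · intro x hx
    refine ⟨fx x, Polynomial.Separable.map (Algebra.IsSeparable.isSeparable P x), ?_, ?_⟩
    · simp only [fx]
      rw [Polynomial.eval_map_algebraMap]
      exact minpoly.aeval P x
    · intro i
      by_cases h0 : (fx x).coeff i = 0
      · exact ⟨0, zero_mem _, 1, one_mem _, one_ne_zero, by rw [h0, zero_mul]⟩
      set c := (fx x).coeff i with hc
      have hcC : c ∈ Cs := Finset.mem_biUnion.2 ⟨x, hx, Polynomial.coeff_mem_coeffs h0⟩
      have hrootA : ∀ g : A, (∀ m ∈ g.support, g.coeff m ∈ W) → ∃ α ∈ A', α ^ q = algebraMap A Ω g := by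
        intro g hg
        refine ⟨∑ m ∈ g.support, ρ (g.coeff m) * ∏ i, t i ^ m i, ?_, ?_⟩
        · refine sum_mem fun m hm => mul_mem ?_ (prod_mem fun i _ => pow_mem (htmem i) _)
          rw [hA'mem]
          exact ⟨MvPolynomial.C (⟨_, IntermediateField.subset_adjoin k Sρ ⟨_, hg m hm, rfl⟩⟩ : k'), by simp [φ]⟩
        · rw [← hFr, map_sum]
          conv_rhs => rw [g.as_sum, map_sum]
          refine Finset.sum_congr rfl fun m _ => ?_
          rw [map_mul, map_prod, hFr, hrt, MvPolynomial.monomial_eq, map_mul,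
            Finsupp.prod_fintype _ _ (by simp), map_prod]
          congr 1
          · exact IsScalarTower.algebraMap_apply k A Ω _
          · refine Finset.prod_congr rfl fun j _ => ?_
            rw [map_pow, map_pow, hFr, ht]
      obtain ⟨α, hα, hαq⟩ := hrootA (ca c) (fun m hm => Finset.mem_biUnion.2 ⟨c, hcC,
        Finset.mem_union_left _ (Finset.mem_image_of_mem _ hm)⟩)
      obtain ⟨β, hβ, hβq⟩ := hrootA (cb c) (fun m hm => Finset.mem_biUnion.2 ⟨c, hcC,
        Finset.mem_union_right _ (Finset.mem_image_of_mem _ hm)⟩)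
      refine ⟨α, hα, β, hβ, ?_, ?_⟩
      · rintro rfl
        rw [zero_pow hq0.ne'] at hβq
        exact hcb c hcC (hinj (by rw [← hβq, map_zero]))
      · apply Fr.injective
        rw [hFr, hFr, mul_pow, hαq, hβq]
        exact hcab c hcC

end A9

section A10

theorem n2 {k : Type*} [Field k] {d : ℕ} {K L : Type*} [Field K] [Field L]
    [Algebra (MvPolynomial (Fin d) k) K] [IsFractionRing (MvPolynomial (Fin d) k) K]
    [Algebra K L] [Algebra (MvPolynomial (Fin d) k) L] [IsScalarTower (MvPolynomial (Fin d) k) K L]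
    [FiniteDimensional K L] :
    IsNoetherian (MvPolynomial (Fin d) k) (integralClosure (MvPolynomial (Fin d) k) L) := by
  classical
  let A := MvPolynomial (Fin d) k
  letI : Algebra k L := ((algebraMap A L).comp MvPolynomial.C).toAlgebra
  haveI : IsScalarTower k A L := IsScalarTower.of_algebraMap_eq fun x => rfl
  let Ω := AlgebraicClosure L
  haveI : Algebra.IsAlgebraic K Ω := Algebra.IsAlgebraic.trans K L Ω
  let b := Module.finBasis K L
  let S : Finset Ω := Finset.univ.image fun i => algebraMap L Ω (b i)
  obtain ⟨A', hfin, hic, hsep⟩ := n2_aux (k := k) (d := d) (K := K) (Ω := Ω) S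
  have : IsNoetherianRing A' := isNoetherian_of_tower A (isNoetherian_of_isNoetherianRing_of_finite A A')
  let K' := FractionRing A'
  letI : Algebra K' Ω := FractionRing.liftAlgebra A' Ω
  haveI : IsScalarTower A' K' Ω := FractionRing.isScalarTower_liftAlgebra A' Ω
  have hnoethA : IsNoetherian A A' := isNoetherian_of_isNoetherianRing_of_finite A A'
  have hKK : ∀ z : K, ∃ z' : K', algebraMap K' Ω z' = algebraMap K Ω z := by
    intro z
    obtain ⟨a, c, hc, rfl⟩ := IsFractionRing.div_surjective (A := A) z
    refine ⟨algebraMap A' K' (algebraMap A A' a) / algebraMap A' K' (algebraMap A A' c), ?_⟩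
    rw [map_div₀, map_div₀, ← IsScalarTower.algebraMap_apply A' K' Ω, ← IsScalarTower.algebraMap_apply A' K' Ω,
      ← IsScalarTower.algebraMap_apply A K Ω, ← IsScalarTower.algebraMap_apply A K Ω]
    rfl
  have hS : ∀ x ∈ (S : Set Ω), IsSeparable K' x := by
    intro x hx
    obtain ⟨f, hf1, hf2, hf3⟩ := hsep x hx
    have hlift : f ∈ Polynomial.lifts (algebraMap K' Ω) := by
      rw [Polynomial.lifts_iff_coeff_lifts]
      intro i
      obtain ⟨a, ha, c, hc, hc0, hac⟩ := hf3 i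
      refine ⟨algebraMap A' K' ⟨a, ha⟩ / algebraMap A' K' ⟨c, hc⟩, ?_⟩
      rw [map_div₀, ← IsScalarTower.algebraMap_apply A' K' Ω, ← IsScalarTower.algebraMap_apply A' K' Ω]
      change a / c = _
      rw [div_eq_iff hc0, hac]
    obtain ⟨g, rfl⟩ := (Polynomial.mem_lifts _).1 hlift
    have hg : g.Separable := (Polynomial.separable_map _).1 hf1
    refine hg.of_dvd (minpoly.dvd K' x ?_)
    rwa [Polynomial.eval_map_algebraMap] at hf2
  let L' : IntermediateField K' Ω := IntermediateField.adjoin K' (S : Set Ω)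
  haveI : Algebra.IsSeparable K' L' := (IntermediateField.isSeparable_adjoin_iff_isSeparable K' Ω).2 hS
  haveI : FiniteDimensional K' L' := IntermediateField.finiteDimensional_adjoin fun x hx => (hS x hx).isIntegral
  have hLL : ∀ x : L, algebraMap L Ω x ∈ L' := by
    intro x
    rw [← b.sum_repr x, map_sum]
    refine sum_mem fun i _ => ?_
    rw [Algebra.smul_def, map_mul]
    refine mul_mem ?_ (IntermediateField.subset_adjoin K' _ (by simp [S]))
    rw [← IsScalarTower.algebraMap_apply K L Ω]
    obtain ⟨z', hz'⟩ := hKK (b.repr x i)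
    rw [← hz']
    exact L'.algebraMap_mem z'
  letI : Algebra A' L' := ((algebraMap K' L').comp (algebraMap A' K')).toAlgebra
  haveI : IsScalarTower A' K' L' := IsScalarTower.of_algebraMap_eq fun x => rfl
  have hN : IsNoetherian A' (integralClosure A' L') := IsIntegralClosure.isNoetherian A' K' L' (integralClosure A' L')
  letI : Module A (integralClosure A' L') := Module.compHom _ (algebraMap A A')
  haveI : IsScalarTower A A' (integralClosure A' L') := ⟨fun a b c => by
    have h : a • b = algebraMap A A' a * b := Algebra.smul_def a b
    rw [h]
    exact mul_smul (algebraMap A A' a) b c⟩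
  haveI : Module.Finite A' (integralClosure A' L') := Module.IsNoetherian.finite _ _
  haveI : Module.Finite A (integralClosure A' L') := Module.Finite.trans A' _
  haveI : IsNoetherian A (integralClosure A' L') :=
    isNoetherian_of_isNoetherianRing_of_finite A (integralClosure A' L')
  have hintg : ∀ x : integralClosure A L, IsIntegral A' (⟨algebraMap L Ω x, hLL x⟩ : L') := by
    intro x
    obtain ⟨g, hg, hg0⟩ := x.2
    refine ⟨g.map (algebraMap A A'), hg.map _, ?_⟩
    rw [Polynomial.eval₂_map]
    apply (algebraMap L' Ω).injective
    rw [Polynomial.hom_eval₂, map_zero]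
    have h2 := congrArg (algebraMap L Ω) hg0
    rw [Polynomial.hom_eval₂, map_zero] at h2
    have hh : (algebraMap L' Ω).comp ((algebraMap A' L').comp (algebraMap A A')) = (algebraMap L Ω).comp (algebraMap A L) := by
      refine RingHom.ext fun r => ?_
      exact (IsScalarTower.algebraMap_apply A' K' Ω (algebraMap A A' r)).symm
    exact (congrArg (fun φ => Polynomial.eval₂ φ (algebraMap L Ω (x : L)) g) hh).trans h2
  let F : integralClosure A L →ₗ[A] integralClosure A' L' :=
    { toFun := fun x => ⟨⟨algebraMap L Ω x, hLL x⟩, hintg x⟩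
      map_add' := fun x y => by
        apply Subtype.ext; apply Subtype.ext
        exact map_add (algebraMap L Ω) (x : L) (y : L)
      map_smul' := fun r x => by
        apply Subtype.ext; apply Subtype.ext
        have e1 : algebraMap K' Ω (algebraMap A' K' (algebraMap A A' r)) = algebraMap L Ω (algebraMap A L r) :=
          (IsScalarTower.algebraMap_apply A' K' Ω (algebraMap A A' r)).symm
        have e2 : algebraMap L Ω (r • (x : L)) = algebraMap L Ω (algebraMap A L r) * algebraMap L Ω x := by
          rw [Algebra.smul_def, map_mul]
        refine e2.trans ?_
        rw [← e1]
        have e3 : ∀ (a : A') (z : integralClosure A' L'), (((a • z : integralClosure A' L') : L') : Ω) =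
            algebraMap K' Ω (algebraMap A' K' a) * ((z : L') : Ω) := by
          intro a z
          have : ((a • z : integralClosure A' L') : L') = a • (z : L') := rfl
          rw [this, Algebra.smul_def]
          rfl
        exact (e3 (algebraMap A A' r) ⟨⟨algebraMap L Ω x, hLL x⟩, hintg x⟩).symm }
  refine isNoetherian_of_injective F ?_
  intro x y hxy
  apply Subtype.ext
  apply (algebraMap L Ω).injective
  exact congrArg (fun z : integralClosure A' L' => ((z : L') : Ω)) hxy

end A10

section A11

theorem finite_of_reduced {k : Type*} [Field k] {d : ℕ} {H : Type*} [CommRing H]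
    [Algebra (MvPolynomial (Fin d) k) H] [IsReduced H]
    (htf : ∀ (a : MvPolynomial (Fin d) k) (h : H), a ≠ 0 → a • h = 0 → h = 0)
    (hintg : ∀ h : H, IsIntegral (MvPolynomial (Fin d) k) h)
    (S : Finset H) (hS : ∀ h : H, ∃ a : MvPolynomial (Fin d) k, a ≠ 0 ∧
      a • h ∈ Submodule.span (MvPolynomial (Fin d) k) (S : Set H)) :
    IsNoetherian (MvPolynomial (Fin d) k) H := by
  classical
  let A := MvPolynomial (Fin d) k
  let K := FractionRing A
  let W := Algebra.algebraMapSubmonoid H (nonZeroDivisors A)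
  let L := Localization W
  letI : Algebra K L := localizationAlgebra (nonZeroDivisors A) H
  haveI : IsScalarTower A K L := IsScalarTower.of_algebraMap_eq fun x => by
    have h1 : algebraMap K L (algebraMap A K x) = algebraMap H L (algebraMap A H x) :=
      IsLocalization.map_eq _ _
    rw [h1, ← IsScalarTower.algebraMap_apply]
  have hinj : Function.Injective (algebraMap H L) := by
    refine IsLocalization.injective L (M := W) ?_
    rintro _ ⟨a, ha, rfl⟩
    rw [mem_nonZeroDivisors_iff_right]
    intro z hz
    refine htf a z (nonZeroDivisors.ne_zero ha) ?_
    rw [Algebra.smul_def, mul_comm]; exact hz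
  haveI : FiniteDimensional K L := by
    refine ⟨⟨S.image (algebraMap H L), ?_⟩⟩
    rw [eq_top_iff]
    rintro z -
    obtain ⟨h, ⟨_, a, ha, rfl⟩, rfl⟩ := IsLocalization.exists_mk'_eq W z
    obtain ⟨c, hc, hcS⟩ := hS h
    have ha0 : algebraMap A K a ≠ 0 := by
      simpa using nonZeroDivisors.ne_zero ha
    have hc0 : algebraMap A K c ≠ 0 := by
      simpa using hc
    have key : algebraMap H L (c • h) ∈ Submodule.span K ((S.image (algebraMap H L) : Finset L) : Set L) := by
      refine Submodule.span_induction ?_ ?_ ?_ ?_ hcS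
      · intro x hx
        exact Submodule.subset_span (by simpa using ⟨x, hx, rfl⟩)
      · simp
      · intro x y _ _ hx hy
        rw [map_add]; exact add_mem hx hy
      · intro r x _ hx
        rw [Algebra.smul_def, map_mul, ← IsScalarTower.algebraMap_apply A H L, IsScalarTower.algebraMap_apply A K L,
          ← Algebra.smul_def]
        exact Submodule.smul_mem _ _ hx
    have h2 : IsLocalization.mk' L h (⟨algebraMap A H a, a, ha, rfl⟩ : W) =
        ((algebraMap A K a)⁻¹ * (algebraMap A K c)⁻¹) • algebraMap H L (c • h) := by
      rw [IsLocalization.mk'_eq_iff_eq_mul]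
      change algebraMap H L h = _ * algebraMap H L (algebraMap A H a)
      rw [← IsScalarTower.algebraMap_apply A H L, IsScalarTower.algebraMap_apply A K L a, Algebra.smul_def c h, map_mul,
        ← IsScalarTower.algebraMap_apply A H L, IsScalarTower.algebraMap_apply A K L c, Algebra.smul_def]
      have e1 : algebraMap K L (algebraMap A K a)⁻¹ * algebraMap K L (algebraMap A K a) = 1 := by
        rw [← map_mul, inv_mul_cancel₀ ha0, map_one]
      have e2 : algebraMap K L (algebraMap A K c)⁻¹ * algebraMap K L (algebraMap A K c) = 1 := by
        rw [← map_mul, inv_mul_cancel₀ hc0, map_one]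
      rw [map_mul]
      linear_combination (-(algebraMap H L h)) * e1 * (algebraMap K L (algebraMap A K c)⁻¹ * algebraMap K L (algebraMap A K c)) - (algebraMap H L h) * e2
    rw [h2]
    exact Submodule.smul_mem _ _ key
  haveI : IsArtinianRing L := IsArtinianRing.of_finite K L
  have hMN : ∀ M : MaximalSpectrum L, IsNoetherian A (integralClosure A (L ⧸ M.asIdeal)) := by
    intro M
    haveI := M.isMaximal
    letI : Field (L ⧸ M.asIdeal) := Ideal.Quotient.field M.asIdeal
    haveI : IsScalarTower A K (L ⧸ M.asIdeal) := inferInstance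
    haveI : FiniteDimensional K (L ⧸ M.asIdeal) := inferInstance
    exact n2 (K := K)
  have hi : ∀ (M : MaximalSpectrum L) (h : H), IsIntegral A (algebraMap L (L ⧸ M.asIdeal) (algebraMap H L h)) := by
    intro M h
    rw [← IsScalarTower.algebraMap_apply]
    exact (hintg h).map (IsScalarTower.toAlgHom A H (L ⧸ M.asIdeal))
  let F : H →ₗ[A] (∀ M : MaximalSpectrum L, integralClosure A (L ⧸ M.asIdeal)) :=
    LinearMap.pi fun M =>
      { toFun := fun h => ⟨algebraMap L (L ⧸ M.asIdeal) (algebraMap H L h), hi M h⟩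
        map_add' := fun x y => Subtype.ext (by simp)
        map_smul' := fun r x => Subtype.ext (by
          change algebraMap L (L ⧸ M.asIdeal) (algebraMap H L (r • x)) = r • algebraMap L (L ⧸ M.asIdeal) (algebraMap H L x)
          rw [Algebra.smul_def, Algebra.smul_def, map_mul, map_mul, ← IsScalarTower.algebraMap_apply A H L,
            ← IsScalarTower.algebraMap_apply A L (L ⧸ M.asIdeal)]) }
  refine isNoetherian_of_injective F ?_
  rw [← LinearMap.ker_eq_bot, LinearMap.ker_eq_bot']
  intro h hh
  have hM : ∀ M : MaximalSpectrum L, algebraMap H L h ∈ M.asIdeal := by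
    intro M
    have := congrArg (fun f => ((f M : integralClosure A (L ⧸ M.asIdeal)) : L ⧸ M.asIdeal)) hh
    exact Ideal.Quotient.eq_zero_iff_mem.1 this
  have hnil : IsNilpotent (algebraMap H L h) := by
    rw [nilpotent_iff_mem_prime]
    intro P hP
    exact hM ⟨P, IsArtinianRing.isMaximal_of_isPrime P⟩
  obtain ⟨n, hn⟩ := hnil
  rw [← map_pow, ← map_zero (algebraMap H L)] at hn
  exact IsReduced.eq_zero h ⟨n, hinj hn⟩

end A11

section A12

structure DF {R : Type*} [CommRing R] [IsLocalRing R] {d : ℕ} (y : Fin d → R) (N : ℕ) (Fd : ℕ → Ideal R) : Prop where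
  npos : 0 < N
  zero : Fd 0 = ⊤
  anti : ∀ i j, i ≤ j → Fd j ≤ Fd i
  mul : ∀ i j x z, x ∈ Fd i → z ∈ Fd j → x * z ∈ Fd (i + j)
  pow : ∀ n j x, 1 ≤ n → x ^ n ∈ Fd (n * j + 1) → x ∈ Fd (j + 1)
  ym : ∀ i, y i ∈ Fd N
  mm : maximalIdeal R ≤ Fd 1
  cancel : ∀ n (f : MvPolynomial (Fin d) R), f.IsHomogeneous n → (∃ m, IsUnit (f.coeff m)) →
    ∀ j x, MvPolynomial.eval y f * x ∈ Fd (n * N + j + 1) → x ∈ Fd (j + 1)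
  integ : ∀ j x, x ∈ Fd j → IsIntegralOverIdeal (Ideal.span (Set.range y) ^ j) (x ^ N)
  count : ∃ B : ℕ, ∀ (r : ℕ) (g : Fin r → R) (s : Fin r → ℕ), (∀ i, g i ∈ Fd (s i)) →
    (∀ (c : ℕ) (f : Fin r → MvPolynomial (Fin d) R),
      (∀ i, ∀ m ∈ (f i).support, N * m.degree + s i = c) →
      ∑ i, MvPolynomial.eval y (f i) * g i ∈ Fd (c + 1) → ∀ i m, ¬ IsUnit ((f i).coeff m)) → r ≤ B
  top : ∀ n, ∃ M, Fd M ≤ Ideal.span (Set.range y) ^ n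

theorem exists_DF {R : Type*} [CommRing R] [IsLocalRing R] [IsNoetherianRing R]
    (hAU : AnalyticallyUnramified R) {d : ℕ} {y : Fin d → R} (hy : QSetup y) :
    ∃ N : ℕ, DF y N (fun j => FI (Ideal.span (Set.range y)) ((j : ℝ) / N)) := by
  classical
  obtain ⟨c, hc⟩ := hy.prim
  obtain ⟨B, hB⟩ := count_bound hy
  set J := Ideal.span (Set.range y) with hJ
  have hN0 : (0:ℝ) < (B.factorial : ℝ) := by exact_mod_cast Nat.factorial_pos B
  have disc : ∀ (j : ℕ) (q : ℝ) (x : R), (j : ℝ) / B.factorial < q → AP J x q →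
      AP J x (((j + 1 : ℕ) : ℝ) / B.factorial) := by
    intro j q x hjq hx
    by_cases hx0 : x = 0
    · subst hx0; exact AP.zero'
    have hM : ∃ M : ℕ, ¬ AP J x M := by
      by_contra hcon
      push Not at hcon
      apply hx0
      have : x ∈ (⨅ n : ℕ, maximalIdeal R ^ n) := by
        rw [Submodule.mem_iInf]
        intro n
        obtain ⟨M, hM⟩ := chevalley R hAU J c hc hy.le n
        exact hM (hcon M)
      rwa [Ideal.iInf_pow_eq_bot_of_isLocalRing _ (maximalIdeal.isMaximal R).ne_top, Ideal.mem_bot] at this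
    obtain ⟨M, hM⟩ := hM
    obtain ⟨q0, h0, h1, h2⟩ := exists_vb hM
    obtain ⟨k, hk⟩ := rational_vb hy B hB x q0 h0 h1 h2
    have hq : q ≤ q0 := by
      by_contra h
      push Not at h
      exact h2 q h hx
    refine h1.mono ?_
    rw [div_le_iff₀ hN0, hk]
    have : (j : ℝ) < k := by
      rw [← hk]
      rw [div_lt_iff₀ hN0] at hjq
      nlinarith
    have h3 : j < k := by exact_mod_cast this
    exact_mod_cast h3
  refine ⟨B.factorial, ?_⟩
  have hne := hN0.ne'
  constructor
  · exact Nat.factorial_pos B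
  · exact FI_nonpos (by simp)
  · intro i j hij
    exact FI_anti (by gcongr)
  · intro i j x z hx hz
    have := AP.mul hx hz
    refine AP.mono this (le_of_eq ?_)
    push_cast; ring
  · intro n j x hn hx
    refine disc j ((((n * j + 1 : ℕ) : ℝ) / B.factorial) / n) x ?_ ?_
    · have : (0:ℝ) < n := by exact_mod_cast hn
      push_cast
      rw [lt_div_iff₀ this, div_mul_eq_mul_div]
      gcongr
      nlinarith
    · refine AP.of_pow hn ?_
      refine AP.mono hx (le_of_eq ?_)
      have : (0:ℝ) < n := by exact_mod_cast hn
      field_simp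
  · intro i
    have h1 : y i ∈ J ^ 1 := by rw [pow_one]; exact Ideal.subset_span ⟨i, rfl⟩
    have := pow_le_FI 1 h1
    change AP J (y i) _
    rw [div_self hne]
    simpa [mem_FI] using this
  · intro z hz
    refine disc 0 (1 / ((c:ℝ) + 1)) z ?_ (le_FI_pos c hc hz)
    simp only [Nat.cast_zero, zero_div]
    positivity
  · intro n f hf hfu j x hx
    refine hy.AP_cancel hf hfu (AP.mono hx (le_of_eq ?_))
    push_cast
    field_simp
    ring
  · intro j x hx
    refine AP.attain ?_
    refine AP.mono (AP.pow hx (Nat.factorial_pos B)) (le_of_eq ?_)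
    field_simp
  · refine ⟨B, fun r g s hg hind => hB r g (fun i => (s i : ℝ) / B.factorial) hg ?_⟩
    intro e e' f hf hee hAP i m hu
    have hmi : m ∈ (f i).support := by
      rw [MvPolynomial.mem_support_iff]
      exact hu.ne_zero
    have hc0 := hf i m hmi
    refine hind (B.factorial * m.degree + s i) f ?_ ?_ i m hu
    · intro i' m' hm'
      have h1 := hf i' m' hm'
      rw [← hc0] at h1
      field_simp at h1
      rw [mul_comm B.factorial m'.degree]
      exact_mod_cast h1
    · refine disc _ e' _ ?_ hAP
      refine lt_of_eq_of_lt ?_ hee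
      rw [← hc0]
      push_cast
      field_simp
  · intro n
    obtain ⟨M, hM⟩ := chevalley R hAU J c hc hy.le (c * n)
    refine ⟨B.factorial * M, ?_⟩
    have : (((B.factorial * M : ℕ) : ℝ) / B.factorial) = M := by
      push_cast
      field_simp
    change FI J _ ≤ _
    rw [this]
    refine hM.trans ?_
    rw [pow_mul]
    exact Ideal.pow_right_mono hc n

end A12

section A13

variable {R : Type*} [CommRing R] [IsLocalRing R] {d : ℕ} {y : Fin d → R} {N : ℕ} {Fd : ℕ → Ideal R}

/-- The Rees-type subring `⊕ Fd j X^j`. -/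
def DF.E (h : DF y N Fd) : Subring (Polynomial R) where
  carrier := {p | ∀ j, p.coeff j ∈ Fd j}
  zero_mem' := fun j => by simp
  one_mem' := fun j => by
    rw [Polynomial.coeff_one]
    split_ifs with hj
    · subst hj; rw [h.zero]; trivial
    · exact zero_mem _
  add_mem' := fun {a b} ha hb j => by
    rw [Polynomial.coeff_add]; exact add_mem (ha j) (hb j)
  neg_mem' := fun {a} ha j => by
    rw [Polynomial.coeff_neg]; exact neg_mem (ha j)
  mul_mem' := fun {a b} ha hb j => by
    rw [Polynomial.coeff_mul]
    refine sum_mem fun x hx => ?_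
    rw [← Finset.HasAntidiagonal.mem_antidiagonal.1 hx]
    exact h.mul _ _ _ _ (ha _) (hb _)

lemma DF.mem_E (h : DF y N Fd) {p : Polynomial R} : p ∈ h.E ↔ ∀ j, p.coeff j ∈ Fd j := Iff.rfl

/-- The ideal `⊕ Fd (j+1) X^j`. -/
def DF.P (h : DF y N Fd) : Ideal h.E where
  carrier := {p | ∀ j, (p : Polynomial R).coeff j ∈ Fd (j + 1)}
  zero_mem' := fun j => by simp
  add_mem' := fun {a b} ha hb j => by
    change ((a : Polynomial R) + b).coeff j ∈ _
    rw [Polynomial.coeff_add]; exact add_mem (ha j) (hb j)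
  smul_mem' := fun a b hb j => by
    change ((a : Polynomial R) * b).coeff j ∈ _
    rw [Polynomial.coeff_mul]
    refine sum_mem fun x hx => ?_
    rw [← Finset.HasAntidiagonal.mem_antidiagonal.1 hx, add_assoc]
    exact h.mul _ _ _ _ (a.2 _) (hb _)

lemma DF.mem_P (h : DF y N Fd) {p : h.E} : p ∈ h.P ↔ ∀ j, (p : Polynomial R).coeff j ∈ Fd (j + 1) := Iff.rfl

/-- The associated graded ring. -/
abbrev DF.H (h : DF y N Fd) : Type _ := h.E ⧸ h.P

lemma DF.monomial_mem (h : DF y N Fd) {j : ℕ} {x : R} (hx : x ∈ Fd j) : Polynomial.monomial j x ∈ h.E := by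
  intro i
  rw [Polynomial.coeff_monomial]
  split_ifs with hij
  · subst hij; exact hx
  · exact zero_mem _

/-- homogeneous elements -/
noncomputable def DF.mon (h : DF y N Fd) (j : ℕ) (x : Fd j) : h.E := ⟨Polynomial.monomial j (x : R), h.monomial_mem x.2⟩

lemma DF.mon_mem_P (h : DF y N Fd) {j : ℕ} {x : Fd j} (hx : (x : R) ∈ Fd (j + 1)) : h.mon j x ∈ h.P := by
  intro i
  change (Polynomial.monomial j (x : R)).coeff i ∈ _
  rw [Polynomial.coeff_monomial]
  split_ifs with hij
  · subst hij; exact hx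
  · exact zero_mem _

noncomputable def DF.CE (h : DF y N Fd) : R →+* h.E :=
  (Polynomial.C : R →+* Polynomial R).codRestrict h.E fun r => by
    rw [← Polynomial.monomial_zero_left]
    exact h.monomial_mem (by rw [h.zero]; trivial)

/-- The map `R[T] → E`. -/
noncomputable def DF.Psi (h : DF y N Fd) : MvPolynomial (Fin d) R →+* h.E :=
  MvPolynomial.eval₂Hom h.CE fun i => h.mon N ⟨y i, h.ym i⟩

lemma DF.Psi_coe (h : DF y N Fd) (f : MvPolynomial (Fin d) R) : ((h.Psi f : h.E) : Polynomial R) =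
    ∑ m ∈ f.support, Polynomial.monomial (N * m.degree) (f.coeff m * ∏ i, y i ^ m i) := by
  have h0 : ((h.Psi f : h.E) : Polynomial R) = MvPolynomial.eval₂ Polynomial.C (fun i => Polynomial.monomial N (y i)) f := by
    change h.E.subtype (MvPolynomial.eval₂ h.CE _ f) = _
    rw [MvPolynomial.eval₂_comp_left]
    rfl
  rw [h0, MvPolynomial.eval₂_eq']
  refine Finset.sum_congr rfl fun m _ => ?_
  have h1 : ∀ s : Finset (Fin d), ∏ i ∈ s, (Polynomial.monomial N (y i)) ^ m i =
      Polynomial.monomial (N * ∑ i ∈ s, m i) (∏ i ∈ s, y i ^ m i) := by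
    classical
    intro s
    induction s using Finset.induction_on with
    | empty => simp
    | insert a s ha ih =>
      rw [Finset.prod_insert ha, Finset.prod_insert ha, Finset.sum_insert ha, ih, Polynomial.monomial_pow,
        Polynomial.monomial_mul_monomial, mul_add]
  rw [h1, Polynomial.C_mul_monomial, Finsupp.degree_eq_sum]

lemma DF.Psi_mul_mon (h : DF y N Fd) (f : MvPolynomial (Fin d) R) (s c : ℕ) (g : R)
    (hf : ∀ m ∈ f.support, N * m.degree + s = c) :
    ((h.Psi f : h.E) : Polynomial R) * Polynomial.monomial s g = Polynomial.monomial c (MvPolynomial.eval y f * g) := by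
  rw [h.Psi_coe, Finset.sum_mul, MvPolynomial.eval_eq', Finset.sum_mul, map_sum]
  refine Finset.sum_congr rfl fun m hm => ?_
  rw [Polynomial.monomial_mul_monomial, hf m hm]

lemma DF.Psi_coeff (h : DF y N Fd) (f : MvPolynomial (Fin d) R) (n : ℕ) :
    ((h.Psi f : h.E) : Polynomial R).coeff (N * n) = MvPolynomial.eval y (MvPolynomial.homogeneousComponent n f) := by
  classical
  rw [h.Psi_coe, Polynomial.finsetSum_coeff, MvPolynomial.homogeneousComponent_apply, map_sum,
    Finset.sum_filter]
  refine Finset.sum_congr rfl fun m hm => ?_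
  rw [Polynomial.coeff_monomial, MvPolynomial.eval_monomial]
  have : N * m.degree = N * n ↔ m.degree = n := Nat.mul_right_inj h.npos.ne'
  simp only [this]
  split_ifs with hmn
  · rw [Finsupp.prod_fintype]; simp
  · rfl

lemma DF.Psi_natDegree (h : DF y N Fd) (f : MvPolynomial (Fin d) R) (n : ℕ) (hf : ∀ m ∈ f.support, m.degree ≤ n) :
    ((h.Psi f : h.E) : Polynomial R).natDegree ≤ N * n := by
  rw [h.Psi_coe]
  refine Polynomial.natDegree_sum_le_of_forall_le _ _ fun m hm => ?_
  refine (Polynomial.natDegree_monomial_le _).trans ?_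
  exact Nat.mul_le_mul_left _ (hf m hm)

/-- normalisation of representatives -/
lemma DF.rep (h : DF y N Fd) : ∀ (n : ℕ) (p : h.E), (p : Polynomial R).natDegree ≤ n → p ∉ h.P →
    ∃ p' : h.E, p - p' ∈ h.P ∧ (p' : Polynomial R).leadingCoeff ∉ Fd ((p' : Polynomial R).natDegree + 1) := by
  intro n
  induction n with
  | zero =>
    intro p hp hpP
    refine ⟨p, by simp, fun hl => hpP ?_⟩
    have h0 : (p : Polynomial R).natDegree = 0 := by omega
    intro j
    rcases Nat.eq_zero_or_pos j with hj | hj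
    · subst hj
      rw [Polynomial.leadingCoeff, h0] at hl
      exact hl
    · rw [Polynomial.coeff_eq_zero_of_natDegree_lt (by omega)]; exact zero_mem _
  | succ n ih =>
    intro p hp hpP
    by_cases hl : (p : Polynomial R).leadingCoeff ∈ Fd ((p : Polynomial R).natDegree + 1)
    · let q : h.E := p - h.mon _ ⟨(p : Polynomial R).leadingCoeff, p.2 _⟩
      have hq : (q : Polynomial R) = (p : Polynomial R).eraseLead := by
        exact Polynomial.self_sub_monomial_natDegree_leadingCoeff (p : Polynomial R)
      have hpq : p - q ∈ h.P := by
        have : p - q = h.mon _ ⟨(p : Polynomial R).leadingCoeff, p.2 _⟩ := by simp [q]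
        rw [this]
        exact h.mon_mem_P hl
      obtain ⟨p', h1, h2⟩ := ih q (by
        rw [hq]
        have := Polynomial.eraseLead_natDegree_le (p : Polynomial R)
        omega) (fun hqP => hpP (by simpa using add_mem hpq hqP))
      exact ⟨p', by simpa using add_mem hpq h1, h2⟩
    · exact ⟨p, by simp, hl⟩

lemma DF.reduced (h : DF y N Fd) : IsReduced h.H := by
  refine ⟨fun x hx => ?_⟩
  obtain ⟨p, rfl⟩ := Ideal.Quotient.mk_surjective x
  by_contra hne
  rw [Ideal.Quotient.eq_zero_iff_mem] at hne
  obtain ⟨p', h1, h2⟩ := h.rep _ p le_rfl hne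
  rw [Ideal.Quotient.eq.2 h1] at hx
  obtain ⟨n, hn⟩ := hx
  have hn' : (Ideal.Quotient.mk h.P p') ^ (n + 1) = 0 := by rw [pow_succ, hn, zero_mul]
  rw [← map_pow, Ideal.Quotient.eq_zero_iff_mem] at hn'
  have h3 := hn' ((n + 1) * (p' : Polynomial R).natDegree)
  apply h2
  refine h.pow (n + 1) _ _ (by omega) ?_
  rw [← Polynomial.coeff_pow_mul_natDegree, mul_comm]
  rw [mul_comm]
  exact h3

end A13

section A14

variable {R : Type*} [CommRing R] [IsLocalRing R] {d : ℕ} {y : Fin d → R} {N : ℕ} {Fd : ℕ → Ideal R}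

noncomputable def DF.kH (h : DF y N Fd) : ResidueField R →+* h.H :=
  Ideal.Quotient.lift (maximalIdeal R) ((Ideal.Quotient.mk h.P).comp h.CE) fun r hr => by
    rw [RingHom.comp_apply, Ideal.Quotient.eq_zero_iff_mem]
    intro j
    change (Polynomial.C r).coeff j ∈ _
    rw [Polynomial.coeff_C]
    split_ifs with hj
    · subst hj; exact h.mm hr
    · exact zero_mem _

noncomputable def DF.phi (h : DF y N Fd) : MvPolynomial (Fin d) (ResidueField R) →+* h.H :=
  MvPolynomial.eval₂Hom h.kH fun i => Ideal.Quotient.mk h.P (h.mon N ⟨y i, h.ym i⟩)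

lemma DF.phi_map (h : DF y N Fd) (f : MvPolynomial (Fin d) R) :
    h.phi (MvPolynomial.map (residue R) f) = Ideal.Quotient.mk h.P (h.Psi f) := by
  have : h.phi.comp (MvPolynomial.map (residue R)) = (Ideal.Quotient.mk h.P).comp h.Psi := by
    refine MvPolynomial.ringHom_ext (fun r => ?_) (fun i => ?_)
    · rw [RingHom.comp_apply, RingHom.comp_apply, MvPolynomial.map_C, DF.phi, DF.Psi, MvPolynomial.eval₂Hom_C,
        MvPolynomial.eval₂Hom_C]
      rfl
    · rw [RingHom.comp_apply, RingHom.comp_apply, MvPolynomial.map_X, DF.phi, DF.Psi, MvPolynomial.eval₂Hom_X',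
        MvPolynomial.eval₂Hom_X']
  exact congrArg (fun φ => φ f) this

lemma isUnit_of_residue {r : R} (hr : residue R r ≠ 0) : IsUnit r := by
  by_contra hu
  exact hr ((residue_eq_zero_iff r).2 ((mem_maximalIdeal r).2 hu))

lemma exists_lift_form (a : MvPolynomial (Fin d) (ResidueField R)) (ha : a ≠ 0) :
    ∃ (n : ℕ) (f : MvPolynomial (Fin d) R), MvPolynomial.map (residue R) f = a ∧ (∀ m ∈ f.support, m.degree ≤ n) ∧
      ∃ m, IsUnit ((MvPolynomial.homogeneousComponent n f).coeff m) := by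
  classical
  obtain ⟨m0, hm0, hmax⟩ := Finset.exists_max_image a.support (fun m => m.degree)
    (MvPolynomial.support_nonempty.2 ha)
  obtain ⟨σ, hσ⟩ := (residue_surjective (R := R)).hasRightInverse
  let f : MvPolynomial (Fin d) R := ∑ m ∈ a.support, MvPolynomial.monomial m (σ (a.coeff m))
  have hcoef : ∀ m, f.coeff m = if m ∈ a.support then σ (a.coeff m) else 0 := by
    intro m
    simp only [f, MvPolynomial.coeff_sum, MvPolynomial.coeff_monomial]
    rw [Finset.sum_ite_eq']
  refine ⟨m0.degree, f, ?_, ?_, m0, ?_⟩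
  · ext m
    rw [MvPolynomial.coeff_map, hcoef]
    split_ifs with hm
    · exact hσ _
    · rw [map_zero]; exact (MvPolynomial.notMem_support_iff.1 hm).symm
  · intro m hm
    rw [MvPolynomial.mem_support_iff, hcoef] at hm
    split_ifs at hm with h1
    · exact hmax m h1
    · exact absurd rfl hm
  · rw [MvPolynomial.coeff_homogeneousComponent, if_pos rfl, hcoef, if_pos hm0]
    apply isUnit_of_residue
    rw [hσ]
    exact MvPolynomial.mem_support_iff.1 hm0

lemma DF.torsionfree (h : DF y N Fd) (a : MvPolynomial (Fin d) (ResidueField R)) (x : h.H) (ha : a ≠ 0)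
    (hax : h.phi a * x = 0) : x = 0 := by
  obtain ⟨p, rfl⟩ := Ideal.Quotient.mk_surjective x
  by_contra hne
  rw [Ideal.Quotient.eq_zero_iff_mem] at hne
  obtain ⟨p', h1, h2⟩ := h.rep _ p le_rfl hne
  obtain ⟨n, f, rfl, hfd, hfu⟩ := exists_lift_form a ha
  rw [Ideal.Quotient.eq.2 h1, h.phi_map, ← map_mul, Ideal.Quotient.eq_zero_iff_mem] at hax
  have h3 := hax (N * n + (p' : Polynomial R).natDegree)
  change (((h.Psi f : h.E) : Polynomial R) * (p' : Polynomial R)).coeff _ ∈ _ at h3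
  rw [Polynomial.coeff_mul_add_eq_of_natDegree_le (h.Psi_natDegree f n hfd) le_rfl, h.Psi_coeff] at h3
  apply h2
  refine h.cancel n _ (MvPolynomial.homogeneousComponent_isHomogeneous n f) hfu _ _ ?_
  rw [mul_comm n N]
  exact h3

/-- every element is a sum of homogeneous ones -/
lemma DF.sum_mon (h : DF y N Fd) (p : h.E) :
    p = ∑ j ∈ (p : Polynomial R).support, h.mon j ⟨(p : Polynomial R).coeff j, p.2 j⟩ := by
  apply Subtype.ext
  rw [AddSubmonoidClass.coe_finsetSum]
  exact (Polynomial.sum_monomial_eq (p : Polynomial R)).symm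

lemma DF.pow_le (h : DF y N Fd) (n : ℕ) : Ideal.span (Set.range y) ^ n ≤ Fd (N * n) := by
  induction n with
  | zero => rw [mul_zero, h.zero]; exact le_top
  | succ n ih =>
    rw [pow_succ, mul_add, mul_one, Ideal.mul_le]
    intro r hr s hs
    refine h.mul _ _ _ _ (ih hr) ?_
    refine (Ideal.span_le.2 ?_) hs
    rintro _ ⟨i, rfl⟩
    exact h.ym i

lemma DF.Psi_form (h : DF y N Fd) {n : ℕ} {z : R} (hz : z ∈ Ideal.span (Set.range y) ^ n) :
    ∃ f, h.Psi f = h.mon (N * n) ⟨z, h.pow_le n hz⟩ := by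
  obtain ⟨f, hf, rfl⟩ := exists_form' y n z hz
  refine ⟨f, Subtype.ext ?_⟩
  have := h.Psi_mul_mon f 0 (N * n) 1 (fun m hm => by
    rw [add_zero]; congr 1
    have := hf (MvPolynomial.mem_support_iff.1 hm)
    rw [Finsupp.degree_eq_weight_one]; exact this)
  change ((h.Psi f : h.E) : Polynomial R) = Polynomial.monomial (N * n) (MvPolynomial.eval y f)
  simpa using this

lemma DF.mon_integral (h : DF y N Fd) (j : ℕ) (x : Fd j) :
    h.phi.IsIntegralElem (Ideal.Quotient.mk h.P (h.mon j x)) := by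
  obtain ⟨n, hn, a, ha, heq⟩ := h.integ j x x.2
  have key : h.phi.IsIntegralElem (Ideal.Quotient.mk h.P (h.mon j x) ^ N) := by
    have hf : ∀ i, ∃ f, i ∈ Finset.Icc 1 n → (h.Psi f : Polynomial R) = Polynomial.monomial (N * (j * i)) (a i) := by
      intro i
      by_cases hi : i ∈ Finset.Icc 1 n
      · have := ha i hi
        rw [← pow_mul] at this
        obtain ⟨f, hf⟩ := h.Psi_form this
        exact ⟨f, fun _ => by rw [hf]; rfl⟩
      · exact ⟨0, fun hi' => absurd hi' hi⟩
    choose f hf using hf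
    let q : Polynomial (MvPolynomial (Fin d) (ResidueField R)) :=
      ∑ i ∈ Finset.Icc 1 n, Polynomial.C (MvPolynomial.map (residue R) (f i)) * Polynomial.X ^ (n - i)
    refine ⟨Polynomial.X ^ n + q, ?_, ?_⟩
    · refine Polynomial.monic_X_pow_add ?_
      refine (Polynomial.degree_sum_le _ _).trans_lt ?_
      rw [Finset.sup_lt_iff (WithBot.bot_lt_coe _)]
      intro i hi
      refine (Polynomial.degree_C_mul_X_pow_le _ _).trans_lt ?_
      rw [Finset.mem_Icc] at hi
      exact_mod_cast (by omega : n - i < n)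
    · rw [Polynomial.eval₂_add, Polynomial.eval₂_X_pow, Polynomial.eval₂_finsetSum]
      simp only [Polynomial.eval₂_mul, Polynomial.eval₂_C, Polynomial.eval₂_X_pow, h.phi_map]
      simp only [← map_pow, ← map_mul, ← map_sum, ← map_add]
      convert map_zero (Ideal.Quotient.mk h.P)
      apply Subtype.ext
      have e1 : ∀ t : ℕ, ((((h.mon j x) ^ N) ^ t : h.E) : Polynomial R) = Polynomial.monomial (j * N * t) (((x:R) ^ N) ^ t) := by
        intro t
        change ((Polynomial.monomial j (x:R)) ^ N) ^ t = _
        rw [Polynomial.monomial_pow, Polynomial.monomial_pow]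
      change (((((h.mon j x) ^ N) ^ n : h.E) : Polynomial R)) + ((∑ i ∈ Finset.Icc 1 n, h.Psi (f i) * ((h.mon j x) ^ N) ^ (n - i) : h.E) : Polynomial R) = 0
      rw [AddSubmonoidClass.coe_finsetSum, e1]
      have e2 : ∑ i ∈ Finset.Icc 1 n, ((h.Psi (f i) * ((h.mon j x) ^ N) ^ (n - i) : h.E) : Polynomial R) =
          ∑ i ∈ Finset.Icc 1 n, Polynomial.monomial (j * N * n) (a i * ((x:R) ^ N) ^ (n - i)) := by
        refine Finset.sum_congr rfl fun i hi => ?_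
        rw [Subring.coe_mul, e1, hf i hi, Polynomial.monomial_mul_monomial]
        have e3 : N * (j * i) + j * N * (n - i) = j * N * n := by
          rw [Finset.mem_Icc] at hi
          obtain ⟨t, rfl⟩ := Nat.exists_eq_add_of_le hi.2
          rw [Nat.add_sub_cancel_left]; ring
        rw [e3]
      rw [e2, ← map_sum, ← map_add, heq, map_zero]
  letI := h.phi.toAlgebra
  exact IsIntegral.of_pow h.npos key

theorem DF.noetherian (h : DF y N Fd) :
    @IsNoetherian (MvPolynomial (Fin d) (ResidueField R)) h.H _ _ h.phi.toAlgebra.toModule := by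
  classical
  letI := h.phi.toAlgebra
  haveI := h.reduced
  let v : (Σ j, Fd j) → h.H := fun t => Ideal.Quotient.mk h.P (h.mon t.1 t.2)
  obtain ⟨B, hB⟩ := h.count
  obtain ⟨s, hs1, hs2⟩ := exists_maximal_linearIndepOn (MvPolynomial (Fin d) (ResidueField R)) v
  have hbound : ∀ t : Finset (Σ j, Fd j), (t : Set (Σ j, Fd j)) ⊆ s → t.card ≤ B := by
    intro t ht
    have hli : LinearIndependent (MvPolynomial (Fin d) (ResidueField R)) (fun i : Fin t.card => v (t.equivFin.symm i)) := by
      have := (hs1.mono ht).linearIndependent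
      exact this.comp (fun i => t.equivFin.symm i) t.equivFin.symm.injective
    refine hB t.card (fun i => ((t.equivFin.symm i : Σ j, Fd j).2 : R)) (fun i => (t.equivFin.symm i : Σ j, Fd j).1)
      (fun i => (t.equivFin.symm i : Σ j, Fd j).2.2) ?_
    intro c f hf hsum i m hu
    rw [Fintype.linearIndependent_iff] at hli
    have h0 := hli (fun i => MvPolynomial.map (residue R) (f i)) ?_ i
    · have := congrArg (MvPolynomial.coeff m) h0
      rw [MvPolynomial.coeff_map, MvPolynomial.coeff_zero, residue_eq_zero_iff, mem_maximalIdeal] at this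
      exact this hu
    · have e1 : ∀ i, MvPolynomial.map (residue R) (f i) • v (t.equivFin.symm i) =
          Ideal.Quotient.mk h.P (h.Psi (f i) * h.mon _ (t.equivFin.symm i : Σ j, Fd j).2) := by
        intro i
        rw [Algebra.smul_def, map_mul, ← h.phi_map]
        rfl
      simp only [e1]
      rw [← map_sum, Ideal.Quotient.eq_zero_iff_mem]
      intro j
      rw [AddSubmonoidClass.coe_finsetSum]
      have e2 : ∑ i, ((h.Psi (f i) * h.mon _ (t.equivFin.symm i : Σ j, Fd j).2 : h.E) : Polynomial R) =
          Polynomial.monomial c (∑ i, MvPolynomial.eval y (f i) * ((t.equivFin.symm i : Σ j, Fd j).2 : R)) := by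
        rw [map_sum]
        exact Finset.sum_congr rfl fun i _ => h.Psi_mul_mon (f i) _ c _ (hf i)
      rw [e2, Polynomial.coeff_monomial]
      split_ifs with hcj
      · subst hcj; exact hsum
      · exact zero_mem _
  have hfin : s.Finite := by
    by_contra hinf
    obtain ⟨t, ht, htc⟩ := Set.Infinite.exists_subset_card_eq hinf (B + 1)
    have := hbound t ht
    omega
  refine finite_of_reduced (fun a x ha hax => h.torsionfree a x ha (by rwa [Algebra.smul_def] at hax)) ?_
    (hfin.toFinset.image v) ?_
  · intro x
    obtain ⟨p, rfl⟩ := Ideal.Quotient.mk_surjective x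
    rw [h.sum_mon p, map_sum]
    exact IsIntegral.sum _ fun j _ => h.mon_integral _ _
  · have hc : (((hfin.toFinset.image v : Finset h.H)) : Set h.H) = v '' s := by simp
    rw [hc]
    have hmon : ∀ j (x : Fd j), ∃ a : MvPolynomial (Fin d) (ResidueField R), a ≠ 0 ∧
        a • Ideal.Quotient.mk h.P (h.mon j x) ∈ Submodule.span (MvPolynomial (Fin d) (ResidueField R)) (v '' s) := by
      intro j x
      by_cases hx : (⟨j, x⟩ : Σ j, Fd j) ∈ s
      · exact ⟨1, one_ne_zero, by rw [one_smul]; exact Submodule.subset_span ⟨⟨j, x⟩, hx, rfl⟩⟩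
      · exact hs2 ⟨j, x⟩ hx
    intro x
    obtain ⟨p, rfl⟩ := Ideal.Quotient.mk_surjective x
    rw [h.sum_mon p, map_sum]
    generalize (p : Polynomial R).support = T
    induction T using Finset.induction_on with
    | empty => exact ⟨1, one_ne_zero, by simp⟩
    | insert j T hj ih =>
      obtain ⟨a, ha, ha'⟩ := ih
      obtain ⟨b, hb, hb'⟩ := hmon j ⟨(p : Polynomial R).coeff j, p.2 j⟩
      refine ⟨a * b, mul_ne_zero ha hb, ?_⟩
      rw [Finset.sum_insert hj, smul_add]
      refine add_mem ?_ ?_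
      · rw [mul_smul]; exact Submodule.smul_mem _ _ hb'
      · rw [mul_comm, mul_smul]; exact Submodule.smul_mem _ _ ha'

end A14

section A15

variable {R : Type*} [CommRing R] [IsLocalRing R] {d : ℕ} {y : Fin d → R} {N : ℕ} {Fd : ℕ → Ideal R}

theorem DF.P8 (h : DF y N Fd) : ∃ D : ℕ, ∀ j n, n * N + D ≤ j → Fd j ≤ Ideal.span (Set.range y) ^ n := by
  classical
  letI := h.phi.toAlgebra
  have hN := h.noetherian
  obtain ⟨G, hG⟩ := hN.noetherian (⊤ : Submodule (MvPolynomial (Fin d) (ResidueField R)) h.H)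
  let σ : h.H → h.E := fun x => (Ideal.Quotient.mk_surjective x).choose
  have hσ : ∀ x, Ideal.Quotient.mk h.P (σ x) = x := fun x => (Ideal.Quotient.mk_surjective x).choose_spec
  let D := G.sup fun x => ((σ x : h.E) : Polynomial R).natDegree
  let Q : h.H → Prop := fun x => ∃ p : h.E, Ideal.Quotient.mk h.P p = x ∧
    ∀ j n, n * N + D ≤ j → (p : Polynomial R).coeff j ∈ Ideal.span (Set.range y) ^ n
  have hadd : ∀ x z, Q x → Q z → Q (x + z) := by
    rintro _ _ ⟨p, rfl, hp⟩ ⟨q, rfl, hq⟩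
    refine ⟨p + q, map_add _ _ _, fun j n hj => ?_⟩
    change ((p : Polynomial R) + q).coeff j ∈ _
    rw [Polynomial.coeff_add]
    exact add_mem (hp j n hj) (hq j n hj)
  have hsmul : ∀ (f : MvPolynomial (Fin d) R) (x : h.H), Q x → Q (Ideal.Quotient.mk h.P (h.Psi f) * x) := by
    intro f
    induction f using MvPolynomial.induction_on with
    | C r =>
      rintro _ ⟨p, rfl, hp⟩
      refine ⟨h.Psi (MvPolynomial.C r) * p, map_mul _ _ _, fun j n hj => ?_⟩
      rw [DF.Psi, MvPolynomial.eval₂Hom_C]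
      change (Polynomial.C r * (p : Polynomial R)).coeff j ∈ _
      rw [Polynomial.coeff_C_mul]
      exact Ideal.mul_mem_left _ _ (hp j n hj)
    | add f g hf hg =>
      intro x hx
      rw [map_add, map_add, add_mul]
      exact hadd _ _ (hf x hx) (hg x hx)
    | mul_X f i hf =>
      intro x hx
      rw [map_mul, map_mul, mul_assoc]
      refine hf _ ?_
      obtain ⟨p, rfl, hp⟩ := hx
      refine ⟨h.Psi (MvPolynomial.X i) * p, map_mul _ _ _, fun j n hj => ?_⟩
      rw [DF.Psi, MvPolynomial.eval₂Hom_X']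
      change (Polynomial.monomial N (y i) * (p : Polynomial R)).coeff j ∈ _
      rcases n with _ | n
      · simp
      rw [mul_comm, coeff_mul_monomial_aux]
      split_ifs with hNj
      · rw [pow_succ]
        refine Ideal.mul_mem_mul (hp _ _ ?_) (Ideal.subset_span ⟨i, rfl⟩)
        rw [add_mul, one_mul] at hj
        omega
      · exact zero_mem _
  have hall : ∀ x, Q x := by
    intro x
    have hx : x ∈ Submodule.span (MvPolynomial (Fin d) (ResidueField R)) (G : Set h.H) := by rw [hG]; trivial
    refine Submodule.span_induction ?_ ?_ ?_ ?_ hx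
    · intro x hx
      refine ⟨σ x, hσ x, fun j n hj => ?_⟩
      rcases n with _ | n
      · simp
      rw [Polynomial.coeff_eq_zero_of_natDegree_lt]
      · exact zero_mem _
      · have h1 : ((σ x : h.E) : Polynomial R).natDegree ≤ D :=
          Finset.le_sup (f := fun x => ((σ x : h.E) : Polynomial R).natDegree) hx
        have := h.npos
        rw [add_mul, one_mul] at hj
        have := Nat.zero_le (n * N)
        omega
    · exact ⟨0, map_zero _, fun j n _ => by simp⟩
    · intro x z _ _ hx hz
      exact hadd x z hx hz
    · intro a x _ hx
      obtain ⟨f, rfl⟩ := MvPolynomial.map_surjective (residue R) residue_surjective a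
      rw [Algebra.smul_def]
      change Q (h.phi _ * x)
      rw [h.phi_map]
      exact hsmul f x hx
  have step : ∀ j n, n * N + D ≤ j → Fd j ≤ Ideal.span (Set.range y) ^ n ⊔ Fd (j + 1) := by
    intro j n hj x hx
    obtain ⟨p, hp, hp2⟩ := hall (Ideal.Quotient.mk h.P (h.mon j ⟨x, hx⟩))
    rw [Ideal.Quotient.eq] at hp
    have h1 := hp j
    change ((p : Polynomial R) - Polynomial.monomial j x).coeff j ∈ _ at h1
    rw [Polynomial.coeff_sub, Polynomial.coeff_monomial, if_pos rfl] at h1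
    have h2 : x = (p : Polynomial R).coeff j - ((p : Polynomial R).coeff j - x) := by ring
    rw [h2]
    exact sub_mem (Ideal.mem_sup_left (hp2 j n hj)) (Ideal.mem_sup_right h1)
  refine ⟨D, fun j n hj => ?_⟩
  have iter : ∀ t, Fd j ≤ Ideal.span (Set.range y) ^ n ⊔ Fd (j + t) := by
    intro t
    induction t with
    | zero => exact le_sup_right
    | succ t ih =>
      exact ih.trans (sup_le le_sup_left (step (j + t) n (by omega)))
  obtain ⟨M, hM⟩ := h.top n
  refine (iter M).trans (sup_le le_rfl (le_trans (h.anti _ _ (Nat.le_add_left _ _)) hM))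

end A15

section A16

lemma dim_eq_of_radical {S S1 S2 : Type*} [CommRing S] [CommRing S1] [CommRing S2] (f : S →+* S1) (g : S →+* S2)
    (hf : Function.Surjective f) (hg : Function.Surjective g)
    (h1 : RingHom.ker f ≤ RingHom.ker g) (h2 : RingHom.ker g ≤ (RingHom.ker f).radical) :
    ringKrullDim S1 = ringKrullDim S2 := by
  rw [← ringKrullDim_eq_of_ringEquiv (RingHom.quotientKerEquivOfSurjective hf),
    ← ringKrullDim_eq_of_ringEquiv (RingHom.quotientKerEquivOfSurjective hg), ringKrullDim_quotient, ringKrullDim_quotient]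
  have : PrimeSpectrum.zeroLocus (RingHom.ker f : Set S) = PrimeSpectrum.zeroLocus (RingHom.ker g : Set S) := by
    apply le_antisymm
    · rw [← PrimeSpectrum.zeroLocus_radical (RingHom.ker f)]
      exact PrimeSpectrum.zeroLocus_anti_mono h2
    · exact PrimeSpectrum.zeroLocus_anti_mono h1
  rw [this]

lemma dim_quot_of_radical {S S1 S2 : Type*} [CommRing S] [CommRing S1] [CommRing S2] (a : Ideal S1) (f : S →+* S1)
    (g : S →+* S2) (hf : Function.Surjective f) (hg : Function.Surjective g)
    (h1 : ∀ x, f x ∈ a → g x = 0) (h2 : RingHom.ker g ≤ (Ideal.comap f a).radical) :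
    ringKrullDim (S1 ⧸ a) = ringKrullDim S2 := by
  have hk : RingHom.ker ((Ideal.Quotient.mk a).comp f) = Ideal.comap f a := by
    ext x
    rw [RingHom.mem_ker, RingHom.comp_apply, Ideal.Quotient.eq_zero_iff_mem, Ideal.mem_comap]
  refine dim_eq_of_radical ((Ideal.Quotient.mk a).comp f) g (Ideal.Quotient.mk_surjective.comp hf) hg ?_ ?_
  · rw [hk]; exact h1
  · rw [hk]; exact h2

variable {R : Type*} [CommRing R] {d : ℕ}

lemma reesEval_coe (y : Fin d → R) (f : MvPolynomial (Fin d) R) :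
    MvPolynomial.eval₂ Polynomial.C (fun i => Polynomial.monomial 1 (y i)) f =
    ∑ m ∈ f.support, Polynomial.monomial m.degree (f.coeff m * ∏ i, y i ^ m i) := by
  rw [MvPolynomial.eval₂_eq']
  refine Finset.sum_congr rfl fun m _ => ?_
  have h1 : ∀ s : Finset (Fin d), ∏ i ∈ s, (Polynomial.monomial 1 (y i)) ^ m i =
      Polynomial.monomial (∑ i ∈ s, m i) (∏ i ∈ s, y i ^ m i) := by
    classical
    intro s
    induction s using Finset.induction_on with
    | empty => simp
    | insert a s ha ih =>
      rw [Finset.prod_insert ha, Finset.prod_insert ha, Finset.sum_insert ha, ih, Polynomial.monomial_pow,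
        Polynomial.monomial_mul_monomial, one_mul]
  rw [h1, Polynomial.C_mul_monomial, Finsupp.degree_eq_sum]

lemma reesEval_coeff (y : Fin d → R) (f : MvPolynomial (Fin d) R) (n : ℕ) :
    (MvPolynomial.eval₂ Polynomial.C (fun i => Polynomial.monomial 1 (y i)) f).coeff n =
      MvPolynomial.eval y (MvPolynomial.homogeneousComponent n f) := by
  classical
  rw [reesEval_coe, Polynomial.finsetSum_coeff, MvPolynomial.homogeneousComponent_apply, map_sum,
    Finset.sum_filter]
  refine Finset.sum_congr rfl fun m hm => ?_
  rw [Polynomial.coeff_monomial, MvPolynomial.eval_monomial]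
  split_ifs with hmn
  · rw [Finsupp.prod_fintype]; simp
  · rfl

lemma reesEval_form (y : Fin d → R) (f : MvPolynomial (Fin d) R) (n : ℕ) (hf : f.IsHomogeneous n) :
    MvPolynomial.eval₂ Polynomial.C (fun i => Polynomial.monomial 1 (y i)) f =
      Polynomial.monomial n (MvPolynomial.eval y f) := by
  rw [reesEval_coe, MvPolynomial.eval_eq', map_sum]
  refine Finset.sum_congr rfl fun m hm => ?_
  have := hf (MvPolynomial.mem_support_iff.1 hm)
  rw [Finsupp.degree_eq_weight_one]
  congr 2

/-- The presentation `R[T] → R(J)`. -/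
noncomputable def reesPsi (y : Fin d → R) : MvPolynomial (Fin d) R →+* reesAlgebra (Ideal.span (Set.range y)) :=
  MvPolynomial.eval₂Hom (algebraMap R _) fun i => ⟨Polynomial.monomial 1 (y i),
    reesAlgebra.monomial_mem.2 (by rw [pow_one]; exact Ideal.subset_span ⟨i, rfl⟩)⟩

lemma reesPsi_coe (y : Fin d → R) (f : MvPolynomial (Fin d) R) : ((reesPsi y f : reesAlgebra (Ideal.span (Set.range y))) : Polynomial R) =
    MvPolynomial.eval₂ Polynomial.C (fun i => Polynomial.monomial 1 (y i)) f := by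
  change (reesAlgebra (Ideal.span (Set.range y))).val.toRingHom (MvPolynomial.eval₂ _ _ f) = _
  rw [MvPolynomial.eval₂_comp_left]
  rfl

lemma reesPsi_surjective (y : Fin d → R) : Function.Surjective (reesPsi y) := by
  classical
  intro p
  have hf : ∀ n, ∃ f : MvPolynomial (Fin d) R, f.IsHomogeneous n ∧ MvPolynomial.eval y f = (p : Polynomial R).coeff n :=
    fun n => exists_form' y n _ ((mem_reesAlgebra_iff _ _).1 p.2 n)
  choose f hf1 hf2 using hf
  refine ⟨∑ n ∈ (p : Polynomial R).support, f n, Subtype.ext ?_⟩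
  rw [reesPsi_coe, MvPolynomial.eval₂_sum]
  conv_rhs => rw [← Polynomial.sum_monomial_eq (p : Polynomial R)]
  refine Finset.sum_congr rfl fun n _ => ?_
  rw [reesEval_form y _ n (hf1 n), hf2]

end A16

theorem sally_module_dimension
    (R : Type*) [CommRing R] [IsLocalRing R] [IsNoetherianRing R]
    (d : ℕ) (hd : 0 < d) (hdim : ringKrullDim R = d)
    (hCM : IsCMLocal R) (hAU : AnalyticallyUnramified R)
    (hres : Infinite (ResidueField R))
    (I J : Ideal R) (hI : IsMPrimary I) (hJ : IsMinimalReduction d J I)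
    (N₁ N₂ : Submodule (reesAlgebra J) (Polynomial R))
    (h₁ : ∀ p : Polynomial R, p ∈ N₁ ↔
      (p.coeff 0 = 0 ∧ ∀ n, 1 ≤ n → p.coeff n ∈ intCl (I ^ (n + 1))))
    (h₂ : ∀ p : Polynomial R, p ∈ N₂ ↔
      (p.coeff 0 = 0 ∧ ∀ n, 1 ≤ n → p.coeff n ∈ J ^ n * intCl I))
    (hnz : Nontrivial (submoduleQuot N₁ N₂)) :
    ringKrullDim ((reesAlgebra J) ⧸
      Module.annihilator (reesAlgebra J) (submoduleQuot N₁ N₂)) = d := by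
  classical
  obtain ⟨hJI, hgen, N0, hN0⟩ := hJ
  have hred : ∀ k, I ^ (k + N0) ≤ J ^ k := by
    intro k
    induction k with
    | zero => simp
    | succ k ih =>
      have : k + 1 + N0 = (k + N0) + 1 := by omega
      rw [this, hN0 _ (by omega), pow_succ', ]
      exact Ideal.mul_mono le_rfl ih
  have hJrad : J.radical = maximalIdeal R := by
    apply le_antisymm
    · rw [← hI]; exact Ideal.radical_mono hJI
    · rw [← hI]
      intro x hx
      obtain ⟨n, hn⟩ := hx
      refine ⟨n * (1 + N0), ?_⟩
      rw [pow_mul]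
      have := hred 1 (Ideal.pow_mem_pow hn (1 + N0))
      rwa [pow_one] at this
  obtain ⟨y, rfl, hq⟩ := exists_QReg_of_CM R d hdim hCM hres J hJrad hgen
  have hprim : ∃ c, maximalIdeal R ^ c ≤ (Ideal.span (Set.range y)) := by
    obtain ⟨c, hc⟩ := Ideal.exists_radical_pow_le_of_fg (Ideal.span (Set.range y)) (by rw [hJrad]; exact IsNoetherian.noetherian _)
    exact ⟨c, by rwa [hJrad] at hc⟩
  have hy : QSetup y := ⟨hq, hprim, by rw [← hJrad]; exact Ideal.le_radical⟩
  have hIcl : (Ideal.span (Set.range y)) ≤ intCl I := fun x hx => Ideal.subset_span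
    ⟨1, one_pos, fun _ => -x, by
      intro i hi
      have : i = 1 := by simpa using hi
      subst this
      rw [pow_one]
      exact neg_mem (hJI hx), by simp⟩
  obtain ⟨N, hDF⟩ := exists_DF hAU hy
  obtain ⟨D, hD⟩ := hDF.P8
  have hcl : ∀ n k, k + D ≤ n → intCl (I ^ n) ≤ (Ideal.span (Set.range y)) ^ k := by
    intro n k hk
    have hNpos := hDF.npos
    refine le_trans ?_ (hD (n * N) k ?_)
    · refine Ideal.span_le.2 fun x hx => ?_
      have hx' : AP (Ideal.span (Set.range y)) x n := AP.of_integral hred n hx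
      refine AP.mono hx' (le_of_eq ?_)
      have : (N:ℝ) ≠ 0 := by exact_mod_cast hNpos.ne'
      push_cast
      field_simp
    · calc k * N + D ≤ k * N + D * N := by
            have := Nat.le_mul_of_pos_right D hNpos
            omega
        _ = (k + D) * N := by ring
        _ ≤ n * N := Nat.mul_le_mul_right _ hk
  have hann : ∀ r : reesAlgebra (Ideal.span (Set.range y)), r ∈ Module.annihilator (reesAlgebra (Ideal.span (Set.range y))) (submoduleQuot N₁ N₂) ↔
      ∀ p ∈ N₁, (r : Polynomial R) * p ∈ N₂ := by
    intro r
    rw [Module.mem_annihilator]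
    constructor
    · intro h p hp
      have := h (Submodule.Quotient.mk ⟨p, hp⟩)
      rw [← Submodule.Quotient.mk_smul, Submodule.Quotient.mk_eq_zero] at this
      exact this
    · intro h x
      obtain ⟨⟨p, hp⟩, rfl⟩ := Submodule.Quotient.mk_surjective _ x
      rw [← Submodule.Quotient.mk_smul, Submodule.Quotient.mk_eq_zero]
      exact h p hp
  -- a nonzero homogeneous element
  obtain ⟨n, hn, z, hz1, hz2⟩ : ∃ n, 1 ≤ n ∧ ∃ z, z ∈ intCl (I ^ (n + 1)) ∧ z ∉ (Ideal.span (Set.range y)) ^ n * intCl I := by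
    by_contra hcon
    push Not at hcon
    obtain ⟨x, hx⟩ := exists_ne (0 : submoduleQuot N₁ N₂)
    obtain ⟨⟨p, hp⟩, rfl⟩ := Submodule.Quotient.mk_surjective _ x
    apply hx
    rw [Submodule.Quotient.mk_eq_zero]
    change p ∈ N₂
    rw [h₁] at hp
    rw [h₂]
    exact ⟨hp.1, fun n hn => hcon n hn _ (hp.2 n hn)⟩
  have hzN : Polynomial.monomial n z ∈ N₁ := by
    rw [h₁]
    refine ⟨by rw [Polynomial.coeff_monomial, if_neg (by omega)], fun i _ => ?_⟩
    rw [Polynomial.coeff_monomial]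
    split_ifs with hi
    · subst hi; exact hz1
    · exact zero_mem _
  have hdk : ringKrullDim (MvPolynomial (Fin d) (ResidueField R)) = d := by
    rw [MvPolynomial.ringKrullDim_of_isNoetherianRing, ringKrullDim_eq_zero_of_field]
    simp
  rw [← hdk]
  refine dim_quot_of_radical _ (reesPsi y) (MvPolynomial.map (σ := Fin d) (residue R)) (reesPsi_surjective y)
    (MvPolynomial.map_surjective _ residue_surjective) ?_ ?_
  · intro f hf
    rw [hann] at hf
    by_contra hne
    obtain ⟨m, hm⟩ := MvPolynomial.ne_zero_iff.1 hne
    rw [MvPolynomial.coeff_map] at hm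
    have hu := isUnit_of_residue hm
    have h3 := ((h₂ _).1 (hf _ hzN)).2 (m.degree + n) (by omega)
    rw [Polynomial.coeff_mul_monomial, reesPsi_coe, reesEval_coeff] at h3
    have hF := MvPolynomial.homogeneousComponent_isHomogeneous m.degree f
    have hFu : ∃ m', IsUnit ((MvPolynomial.homogeneousComponent m.degree f).coeff m') :=
      ⟨m, by rw [MvPolynomial.coeff_homogeneousComponent, if_pos rfl]; exact hu⟩
    apply hz2
    refine hy.lemT (intCl I) hIcl n m.degree z ?_ _ hF hFu (by rw [add_comm]; exact h3)
    have h4 : MvPolynomial.eval y (MvPolynomial.homogeneousComponent m.degree f) * z ∈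
        Ideal.span (Set.range y) ^ (m.degree + n) := Ideal.mul_le_left h3
    exact hy.colon m.degree _ hF hFu n z h4
  · intro f hf
    rw [RingHom.mem_ker] at hf
    obtain ⟨c, hc⟩ := hprim
    have hC : ∀ r ∈ maximalIdeal R, (MvPolynomial.C r : MvPolynomial (Fin d) R) ∈
        (Ideal.comap (reesPsi y) (Module.annihilator (reesAlgebra (Ideal.span (Set.range y))) (submoduleQuot N₁ N₂))).radical := by
      intro r hr
      refine ⟨c * D, ?_⟩
      rw [Ideal.mem_comap, hann]
      intro p hp
      rw [h₁] at hp
      have hrD : r ^ (c * D) ∈ (Ideal.span (Set.range y)) ^ D := by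
        rw [pow_mul]
        exact Ideal.pow_mem_pow (hc (Ideal.pow_mem_pow hr c)) D
      rw [reesPsi_coe, ← MvPolynomial.C_pow, MvPolynomial.eval₂_C, h₂]
      refine ⟨by rw [Polynomial.coeff_C_mul, hp.1, mul_zero], fun i hi => ?_⟩
      rw [Polynomial.coeff_C_mul]
      have hle : (Ideal.span (Set.range y)) ^ (i + 1) ≤ (Ideal.span (Set.range y)) ^ i * intCl I := by
        rw [pow_succ]; exact Ideal.mul_mono le_rfl hIcl
      apply hle
      by_cases hiD : D ≤ i + 1
      · have h5 := hcl (i + 1) (i + 1 - D) (by omega) (hp.2 i hi)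
        have h6 := Ideal.mul_mem_mul hrD h5
        rw [← pow_add] at h6
        have : D + (i + 1 - D) = i + 1 := by omega
        rwa [this] at h6
      · exact Ideal.mul_mem_right _ _ (Ideal.pow_le_pow_right (by omega) hrD)
    rw [MvPolynomial.as_sum f]
    refine sum_mem fun m _ => ?_
    rw [← mul_one (f.coeff m), ← MvPolynomial.C_mul_monomial]
    refine Ideal.mul_mem_right _ _ (hC _ ?_)
    have := congrArg (MvPolynomial.coeff m) hf
    rwa [MvPolynomial.coeff_map, MvPolynomial.coeff_zero, residue_eq_zero_iff] at this
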